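/- arXiv:2002.01654 — 2 statements merged into one kernel-verified Lean document; each statement's English description precedes it below -/
import Mathlib

section
/- For every positive integer k there exists a function u ∈ C¹([0,d]) ∩ C²((0,d)) satisfying equation (★) on (0,d), with u'(0) = 0 and u'(d) = 0, such that u has exactly k zeros in the open interval (0,d). -/
open Set Filter

/-- `u` is a solution of the ODE `u'' + h u' + λ(|u|^{q-1} u - u) = 0`,
being C¹ on the closed set `S` (with derivative `u'`) and C² on `Sint`
(with second derivative `u''`), where the equation holds on `Sint`. -/
def SolOn (h : ℝ → ℝ) (lam q : ℝ) (S Sint : Set ℝ) (u u' u'' : ℝ → ℝ) : Prop :=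
  (∀ t ∈ S, HasDerivWithinAt u (u' t) S t) ∧
  ContinuousOn u' S ∧
  (∀ t ∈ Sint, HasDerivWithinAt u' (u'' t) Sint t) ∧
  ContinuousOn u'' Sint ∧
  (∀ t ∈ Sint, u'' t + h t * u' t + lam * (|u t| ^ (q - 1) * u t - u t) = 0)

/-- The Euclidean norm on ℝ². -/
noncomputable def enorm2 (p : ℝ × ℝ) : ℝ := Real.sqrt (p.1 ^ 2 + p.2 ^ 2)

/-- The nonlinearity `x ↦ λ(|x|^{q-1} x - x)`. -/
noncomputable def nlTerm (lam q x : ℝ) : ℝ := lam * (|x| ^ (q - 1) * x - x)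

/-- The potential of `nlTerm`, vanishing at the origin. -/
noncomputable def nlPot (lam q x : ℝ) : ℝ := lam * (|x| ^ (q + 1) / (q + 1) - x ^ 2 / 2)

/-- `(u, v)` solves the first order system `u' = v`, `v' = -(h v) - g(u)` on `[α, β]`. -/
def IsSolIcc (h g : ℝ → ℝ) (α β : ℝ) (u v : ℝ → ℝ) : Prop :=
  ∀ t ∈ Icc α β, HasDerivAt u (v t) t ∧ HasDerivAt v (-(h t * v t) - g (u t)) t

section Calculus

variable {α β : ℝ}

lemma monotoneOn_of_hasDerivAt {g g' : ℝ → ℝ} (hg : ∀ t ∈ Icc α β, HasDerivAt g (g' t) t)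
    (h0 : ∀ t ∈ Icc α β, 0 ≤ g' t) : MonotoneOn g (Icc α β) :=
  monotoneOn_of_hasDerivWithinAt_nonneg (convex_Icc _ _)
    (fun t ht => (hg t ht).continuousAt.continuousWithinAt)
    (fun t ht => (hg t (interior_subset ht)).hasDerivWithinAt)
    (fun t ht => h0 t (interior_subset ht))

lemma antitoneOn_of_hasDerivAt {g g' : ℝ → ℝ} (hg : ∀ t ∈ Icc α β, HasDerivAt g (g' t) t)
    (h0 : ∀ t ∈ Icc α β, g' t ≤ 0) : AntitoneOn g (Icc α β) := by
  have := monotoneOn_of_hasDerivAt (g := fun t => -g t) (g' := fun t => -g' t)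
    (fun t ht => (hg t ht).neg) (fun t ht => by linarith [h0 t ht])
  intro x hx y hy hxy
  have := this hx hy hxy
  simp only at this
  linarith

/-- A two-sided Grönwall inequality. -/
lemma gronwall_two_sided {D D' : ℝ → ℝ} {L : ℝ} (hD : ∀ t ∈ Icc α β, HasDerivAt D (D' t) t)
    (hL : ∀ t ∈ Icc α β, |D' t| ≤ L * D t) {s t : ℝ} (hs : s ∈ Icc α β) (ht : t ∈ Icc α β) :
    D t ≤ D s * Real.exp (L * |t - s|) := by
  have hE : ∀ (c x : ℝ), HasDerivAt (fun t => Real.exp (c * t)) (Real.exp (c * x) * c) x := by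
    intro c x
    simpa using ((hasDerivAt_id x).const_mul c).exp
  have h1 : AntitoneOn (fun t => D t * Real.exp (-L * t)) (Icc α β) := by
    refine antitoneOn_of_hasDerivAt (fun t ht => (hD t ht).mul (hE (-L) t)) fun t ht => ?_
    have := (abs_le.1 (hL t ht)).2
    have hp := Real.exp_pos (-L * t)
    nlinarith [mul_nonneg hp.le (sub_nonneg.2 this)]
  have h2 : MonotoneOn (fun t => D t * Real.exp (L * t)) (Icc α β) := by
    refine monotoneOn_of_hasDerivAt (fun t ht => (hD t ht).mul (hE L t)) fun t ht => ?_
    have := (abs_le.1 (hL t ht)).1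
    have hp := Real.exp_pos (L * t)
    nlinarith [mul_nonneg hp.le (sub_nonneg.2 this)]
  rcases le_total s t with hst | hst
  · have h3 := h1 hs ht hst
    simp only at h3
    have h4 := mul_le_mul_of_nonneg_right h3 (Real.exp_pos (L * t)).le
    rw [mul_assoc, mul_assoc, ← Real.exp_add, ← Real.exp_add] at h4
    rw [abs_of_nonneg (by linarith)]
    rwa [show -L * t + L * t = 0 by ring, Real.exp_zero, mul_one,
      show -L * s + L * t = L * (t - s) by ring] at h4
  · have h3 := h2 ht hs hst
    simp only at h3
    have h4 := mul_le_mul_of_nonneg_right h3 (Real.exp_pos (-L * t)).le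
    rw [mul_assoc, mul_assoc, ← Real.exp_add, ← Real.exp_add] at h4
    rw [abs_of_nonpos (by linarith)]
    rwa [show L * t + -L * t = 0 by ring, Real.exp_zero, mul_one,
      show L * s + -L * t = L * -(t - s) by ring] at h4

/-- A continuous function on a compact interval has a primitive. -/
lemma hasDerivAt_integral_of_continuousOn {f : ℝ → ℝ} {J : Set ℝ} (hJ : IsOpen J)
    (hJc : J.OrdConnected) (hf : ContinuousOn f J) {c t : ℝ} (hc : c ∈ J) (ht : t ∈ J) :
    HasDerivAt (fun x => ∫ s in c..x, f s) (f t) t := by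
  have hsub : uIcc c t ⊆ J := hJc.uIcc_subset hc ht
  refine intervalIntegral.integral_hasDerivAt_right
    ((hf.mono hsub).intervalIntegrable) ?_ (hf.continuousAt (hJ.mem_nhds ht))
  exact hf.stronglyMeasurableAtFilter hJ t ht

end Calculus

section Nonlinearity

variable {lam q : ℝ}

lemma hasDerivAt_nlPot (hq : 1 < q) (x : ℝ) : HasDerivAt (nlPot lam q) (nlTerm lam q x) x := by
  have h1 := hasDerivAt_abs_rpow x (p := q + 1) (by linarith)
  have h2 := ((h1.div_const (q + 1)).sub (((hasDerivAt_id x).pow 2).div_const 2)).const_mul lam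
  have h3 : nlPot lam q = fun x => lam * (|x| ^ (q + 1) / (q + 1) - x ^ 2 / 2) := rfl
  rw [h3]
  refine h2.congr_deriv ?_
  unfold nlTerm
  rw [show q + 1 - 2 = q - 1 by ring]
  have : q + 1 ≠ 0 := by linarith
  simp only [id, pow_one, Nat.cast_ofNat, Nat.add_one_sub_one]
  field_simp

lemma continuous_nlPot (hq : 1 < q) : Continuous (nlPot lam q) :=
  continuous_iff_continuousAt.2 fun x => (hasDerivAt_nlPot hq x).continuousAt

lemma continuous_nlTerm (hq : 1 < q) : Continuous (nlTerm lam q) := by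
  unfold nlTerm
  have : Continuous fun x : ℝ => |x| ^ (q - 1) :=
    continuous_abs.rpow_const fun x => Or.inr (by linarith)
  fun_prop

lemma nlTerm_zero : nlTerm lam q 0 = 0 := by simp [nlTerm]

lemma nlTerm_one : nlTerm lam q 1 = 0 := by simp [nlTerm]

lemma nlPot_abs (x : ℝ) : nlPot lam q |x| = nlPot lam q x := by simp [nlPot]

lemma abs_rpow_mul_sq (hq : 1 < q) (x : ℝ) : |x| ^ (q - 1) * x ^ 2 = |x| ^ (q + 1) := by
  rcases eq_or_ne x 0 with rfl | hx
  · simp [Real.zero_rpow (show q + 1 ≠ 0 by linarith)]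
  · rw [← sq_abs, ← Real.rpow_natCast |x| 2, ← Real.rpow_add (abs_pos.2 hx)]
    congr 1; push_cast; ring

lemma mul_nlTerm (hq : 1 < q) (x : ℝ) : x * nlTerm lam q x = lam * (|x| ^ (q + 1) - x ^ 2) := by
  rw [← abs_rpow_mul_sq hq]; unfold nlTerm; ring

/-- Powers above two dominate the square. -/
lemma exists_sq_le_rpow (hq : 1 < q) {ε W : ℝ} (hε : 0 < ε) (hW : 0 ≤ W) :
    ∃ C, 0 ≤ C ∧ ∀ x : ℝ, W * x ^ 2 ≤ ε * |x| ^ (q + 1) + C := by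
  set X := (W / ε) ^ (1 / (q - 1)) with hX
  have hX0 : 0 ≤ X := by positivity
  refine ⟨W * X ^ 2, by positivity, fun x => ?_⟩
  rcases le_total |x| X with hx | hx
  · have : x ^ 2 ≤ X ^ 2 := by rw [← sq_abs]; gcongr
    have h2 : 0 ≤ ε * |x| ^ (q + 1) := by positivity
    nlinarith [mul_le_mul_of_nonneg_left this hW]
  · have h1 : W / ε ≤ |x| ^ (q - 1) := by
      have := Real.rpow_le_rpow hX0 hx (show 0 ≤ q - 1 by linarith)
      rw [hX, ← Real.rpow_mul (by positivity), one_div_mul_cancel (by linarith),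
        Real.rpow_one] at this
      exact this
    rw [← abs_rpow_mul_sq hq]
    have h2 : W ≤ ε * |x| ^ (q - 1) := by
      rw [div_le_iff₀ hε] at h1; linarith
    nlinarith [mul_le_mul_of_nonneg_right h2 (sq_nonneg x), mul_nonneg hW (sq_nonneg X)]

lemma exists_half_sq_le_nlPot (hlam : 0 < lam) (hq : 1 < q) :
    ∃ C, 0 ≤ C ∧ ∀ x : ℝ, x ^ 2 / 2 ≤ nlPot lam q x + C := by
  obtain ⟨C, hC, h⟩ := exists_sq_le_rpow hq (ε := lam / (q + 1)) (W := (1 + lam) / 2)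
    (div_pos hlam (by linarith)) (by positivity)
  refine ⟨C, hC, fun x => ?_⟩
  have := h x
  unfold nlPot
  have e : lam / (q + 1) * |x| ^ (q + 1) = lam * (|x| ^ (q + 1) / (q + 1)) := by ring
  rw [e] at this
  nlinarith

lemma nlPot_le_of_abs_le (hlam : 0 < lam) (hq : 1 < q) {x A : ℝ} (h : |x| ≤ A) :
    nlPot lam q x ≤ lam * (A ^ (q + 1) / (q + 1)) := by
  unfold nlPot
  have h1 : |x| ^ (q + 1) ≤ A ^ (q + 1) := Real.rpow_le_rpow (abs_nonneg x) h (by linarith)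
  have h2 : |x| ^ (q + 1) / (q + 1) ≤ A ^ (q + 1) / (q + 1) := by gcongr
  have h3 := sq_nonneg x
  gcongr
  linarith

lemma strictMonoOn_nlPot (hlam : 0 < lam) (hq : 1 < q) :
    StrictMonoOn (nlPot lam q) (Ici 1) := by
  refine strictMonoOn_of_deriv_pos (convex_Ici 1) (continuous_nlPot hq).continuousOn fun x hx => ?_
  rw [(hasDerivAt_nlPot hq x).deriv]
  simp only [interior_Ici, mem_Ioi] at hx
  have : 1 < |x| ^ (q - 1) :=
    Real.one_lt_rpow (by rw [abs_of_pos (by linarith)]; exact hx) (by linarith)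
  unfold nlTerm
  have : 0 < |x| ^ (q - 1) * x - x := by nlinarith
  positivity

lemma abs_le_of_nlPot_le (hlam : 0 < lam) (hq : 1 < q) {x a : ℝ} (ha : 1 ≤ |a|)
    (h : nlPot lam q x ≤ nlPot lam q a) : |x| ≤ |a| := by
  by_contra! hlt
  have := strictMonoOn_nlPot hlam hq (mem_Ici.2 ha) (mem_Ici.2 (ha.trans hlt.le)) hlt
  rw [nlPot_abs, nlPot_abs] at this
  linarith

lemma abs_nlTerm_le (hlam : 0 < lam) (hq : 1 < q) {x A : ℝ} (hA : 1 ≤ A) (hx : |x| ≤ A) :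
    |nlTerm lam q x| ≤ lam * A ^ q := by
  have h1 : |x| ^ (q - 1) ≤ A ^ (q - 1) := Real.rpow_le_rpow (abs_nonneg x) hx (by linarith)
  have h2 : 1 ≤ A ^ (q - 1) := Real.one_le_rpow hA (by linarith)
  have h3 : 0 ≤ |x| ^ (q - 1) := by positivity
  have h4 : |(|x| ^ (q - 1) - 1)| ≤ A ^ (q - 1) := by rw [abs_le]; constructor <;> linarith
  have h5 : A ^ q = A ^ (q - 1) * A := by
    rw [← Real.rpow_add_one (by linarith)]; congr 1; ring
  have h6 : nlTerm lam q x = lam * ((|x| ^ (q - 1) - 1) * x) := by unfold nlTerm; ring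
  rw [h6, abs_mul, abs_mul, abs_of_pos hlam, h5]
  gcongr

lemma hasDerivAt_abs_rpow_mul (hq : 1 < q) (x : ℝ) :
    HasDerivAt (fun x : ℝ => |x| ^ (q - 1) * x) (q * |x| ^ (q - 1)) x := by
  rcases lt_trichotomy x 0 with hx | rfl | hx
  · have h1 : HasDerivAt (fun x : ℝ => -((-x) ^ q)) (q * |x| ^ (q - 1)) x := by
      have := ((hasDerivAt_id x).neg.rpow_const (p := q) (Or.inl (by simp; linarith))).neg
      refine this.congr_deriv ?_
      rw [abs_of_neg hx]; simp
    refine h1.congr_of_eventuallyEq ?_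
    filter_upwards [Iio_mem_nhds hx] with y hy
    have hy : y < 0 := hy
    rw [abs_of_neg hy, show (-y) ^ q = (-y) ^ (q - 1) * (-y) by
      rw [← Real.rpow_add_one (by linarith)]; congr 1; ring]
    ring
  · have : q - 1 ≠ 0 := by linarith
    simp only [abs_zero, Real.zero_rpow this, mul_zero]
    rw [hasDerivAt_iff_tendsto_slope]
    have hc : Tendsto (fun x : ℝ => |x| ^ (q - 1)) (nhdsWithin 0 {0}ᶜ) (nhds 0) := by
      have hc : Continuous fun x : ℝ => |x| ^ (q - 1) :=
        continuous_abs.rpow_const fun x => Or.inr (by linarith)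
      have := hc.tendsto 0
      simp only [abs_zero, Real.zero_rpow ‹q - 1 ≠ 0›] at this
      exact this.mono_left nhdsWithin_le_nhds
    refine hc.congr' ?_
    filter_upwards [self_mem_nhdsWithin] with y hy
    have hy : y ≠ 0 := hy
    simp [slope_def_field, hy]
  · have h1 : HasDerivAt (fun x : ℝ => x ^ q) (q * |x| ^ (q - 1)) x := by
      rw [abs_of_pos hx]
      exact Real.hasDerivAt_rpow_const (Or.inl hx.ne')
    refine h1.congr_of_eventuallyEq ?_
    filter_upwards [Ioi_mem_nhds hx] with y hy
    have hy : 0 < y := hy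
    rw [abs_of_pos hy, ← Real.rpow_add_one (by linarith)]
    congr 1; ring

lemma exists_lipschitz_nlTerm (hlam : 0 < lam) (hq : 1 < q) {R : ℝ} (hR : 0 ≤ R) :
    ∃ L, 0 < L ∧ ∀ x y : ℝ, |x| ≤ R → |y| ≤ R →
      |nlTerm lam q x - nlTerm lam q y| ≤ L * |x - y| := by
  have hd : ∀ x ∈ Icc (-R) R,
      HasDerivWithinAt (nlTerm lam q) (lam * (q * |x| ^ (q - 1) - 1)) (Icc (-R) R) x := by
    intro x _
    exact (((hasDerivAt_abs_rpow_mul hq x).sub (hasDerivAt_id x)).const_mul lam).hasDerivWithinAt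
  refine ⟨lam * (q * R ^ (q - 1) + 1), by positivity, fun x y hx hy => ?_⟩
  have := Convex.norm_image_sub_le_of_norm_hasDerivWithin_le hd
    (C := lam * (q * R ^ (q - 1) + 1)) (fun z hz => ?_) (convex_Icc _ _) (abs_le.1 hy) (abs_le.1 hx)
  · simpa [Real.norm_eq_abs] using this
  · have h1 : |z| ^ (q - 1) ≤ R ^ (q - 1) :=
      Real.rpow_le_rpow (abs_nonneg z) (abs_le.2 hz) (by linarith)
    have h3 : 0 ≤ |z| ^ (q - 1) := by positivity
    rw [Real.norm_eq_abs, abs_mul, abs_of_pos hlam]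
    gcongr
    rw [abs_le]
    constructor <;> nlinarith [mul_le_mul_of_nonneg_left h1 (show 0 ≤ q by linarith),
      mul_nonneg (show 0 ≤ q by linarith) h3]

end Nonlinearity

section System

variable {h g : ℝ → ℝ} {α β : ℝ} {u v : ℝ → ℝ}

lemma IsSolIcc.mono (hs : IsSolIcc h g α β u v) {α' β' : ℝ} (hα : α ≤ α') (hβ : β' ≤ β) :
    IsSolIcc h g α' β' u v := fun t ht => hs t ⟨hα.trans ht.1, ht.2.trans hβ⟩

lemma IsSolIcc.continuousOn_fst (hs : IsSolIcc h g α β u v) : ContinuousOn u (Icc α β) :=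
  fun t ht => (hs t ht).1.continuousAt.continuousWithinAt

lemma IsSolIcc.continuousOn_snd (hs : IsSolIcc h g α β u v) : ContinuousOn v (Icc α β) :=
  fun t ht => (hs t ht).2.continuousAt.continuousWithinAt

lemma IsSolIcc.reflect (hs : IsSolIcc h g α β u v) (d : ℝ) :
    IsSolIcc (fun t => -h (d - t)) g (d - β) (d - α) (fun t => u (d - t))
      (fun t => -v (d - t)) := by
  intro t ht
  have ht' : d - t ∈ Icc α β := ⟨by linarith [ht.2], by linarith [ht.1]⟩
  obtain ⟨h1, h2⟩ := hs _ ht'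
  constructor
  · simpa using h1.comp_const_sub d t
  · refine (h2.comp_const_sub d t).neg.congr_deriv ?_
    simp [sub_eq_add_neg]

/-- Solutions depend on the data at one point in a Lipschitz way. -/
lemma IsSolIcc.dist_sq_le {u₁ v₁ u₂ v₂ : ℝ → ℝ} (h₁ : IsSolIcc h g α β u₁ v₁)
    (h₂ : IsSolIcc h g α β u₂ v₂) {H L : ℝ} (hL0 : 0 ≤ L) (hH : ∀ t ∈ Icc α β, |h t| ≤ H)
    (hL : ∀ t ∈ Icc α β, |g (u₁ t) - g (u₂ t)| ≤ L * |u₁ t - u₂ t|) {s t : ℝ}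
    (hs : s ∈ Icc α β) (ht : t ∈ Icc α β) :
    (u₁ t - u₂ t) ^ 2 + (v₁ t - v₂ t) ^ 2 ≤
      ((u₁ s - u₂ s) ^ 2 + (v₁ s - v₂ s) ^ 2) * Real.exp ((1 + 2 * H + L) * |t - s|) := by
  refine gronwall_two_sided (D := fun t => (u₁ t - u₂ t) ^ 2 + (v₁ t - v₂ t) ^ 2)
    (fun t ht => ((((h₁ t ht).1.sub (h₂ t ht).1).pow 2).add
      (((h₁ t ht).2.sub (h₂ t ht).2).pow 2))) ?_ hs ht
  intro t ht
  have hg := hL t ht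
  have hh := hH t ht
  set a := u₁ t - u₂ t with ha
  set b := v₁ t - v₂ t with hb
  set c := g (u₁ t) - g (u₂ t) with hc
  have e : (↑2 * (u₁ - u₂) t ^ (2 - 1) * (v₁ t - v₂ t) + ↑2 * (v₁ - v₂) t ^ (2 - 1) *
      (-(h t * v₁ t) - g (u₁ t) - (-(h t * v₂ t) - g (u₂ t)))) =
      2 * a * b - 2 * h t * b ^ 2 - 2 * b * c := by
    simp only [Pi.sub_apply, ← ha, ← hb]
    rw [hc, hb]; push_cast; ring
  have e' := e
  push_cast at e' ⊢
  rw [e']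
  have h1 : |2 * a * b| ≤ a ^ 2 + b ^ 2 := by
    rw [abs_le]; constructor <;> nlinarith [sq_nonneg (a + b), sq_nonneg (a - b)]
  have h2 : |2 * h t * b ^ 2| ≤ 2 * H * b ^ 2 := by
    rw [abs_mul, abs_mul, abs_of_nonneg (sq_nonneg b), abs_two]; gcongr
  have h4 : |a| * |b| * 2 ≤ a ^ 2 + b ^ 2 := by
    rw [← sq_abs a, ← sq_abs b]; nlinarith [sq_nonneg (|a| - |b|)]
  have h3 : |2 * b * c| ≤ L * (a ^ 2 + b ^ 2) := by
    rw [abs_mul, abs_mul, abs_two]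
    calc 2 * |b| * |c| ≤ 2 * |b| * (L * |a|) := by gcongr
      _ ≤ _ := by nlinarith
  have hH0 : 0 ≤ H := (abs_nonneg _).trans hh
  calc |2 * a * b - 2 * h t * b ^ 2 - 2 * b * c|
      ≤ |2 * a * b| + |2 * h t * b ^ 2| + |2 * b * c| :=
        (abs_sub _ _).trans (add_le_add_left (abs_sub _ _) _)
    _ ≤ _ := by nlinarith [sq_nonneg a]

lemma IsSolIcc.abs_snd_le (hs : IsSolIcc h g α β u v) {P : ℝ → ℝ}
    (hP : ∀ t ∈ Icc α β, HasDerivAt P (h t) t) (hh : ∀ t ∈ Icc α β, 0 ≤ h t) (hv : v α = 0)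
    {S : ℝ} (hS : ∀ t ∈ Icc α β, |g (u t)| ≤ S) {t : ℝ} (ht : t ∈ Icc α β) :
    |v t| ≤ S * (t - α) := by
  have hα : α ∈ Icc α β := ⟨le_rfl, ht.1.trans ht.2⟩
  have key : ∀ σ : ℝ, |σ| = 1 → σ * v t ≤ S * (t - α) := by
    intro σ hσ
    have hanti : AntitoneOn (fun t => Real.exp (P t) * (σ * v t - S * (t - α))) (Icc α β) := by
      refine antitoneOn_of_hasDerivAt (fun x hx => (hP x hx).exp.mul
        (((hs x hx).2.const_mul σ).sub (((hasDerivAt_id x).sub_const α).const_mul S)))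
        fun x hx => ?_
      have hp := Real.exp_pos (P x)
      have h1 : -(σ * g (u x)) ≤ S := by
        refine (neg_le_abs _).trans ?_
        rw [abs_mul, hσ, one_mul]; exact hS x hx
      have hS0 : 0 ≤ S := (abs_nonneg _).trans (hS x hx)
      have h2 : 0 ≤ S * (x - α) * h x := mul_nonneg (mul_nonneg hS0 (by linarith [hx.1])) (hh x hx)
      have : Real.exp (P x) * h x * (σ * v x - S * (x - α)) +
          Real.exp (P x) * (σ * (-(h x * v x) - g (u x)) - S * 1) =
          Real.exp (P x) * (-(σ * g (u x)) - S - S * (x - α) * h x) := by ring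
      rw [this]
      exact mul_nonpos_of_nonneg_of_nonpos hp.le (by linarith)
    have h1 := hanti hα ht ht.1
    simp only [hv, mul_zero, sub_self] at h1
    have := nonpos_of_mul_nonpos_right h1 (Real.exp_pos (P t))
    linarith
  rw [abs_le]
  have h1 := key 1 (by simp)
  have h2 := key (-1) (by simp)
  constructor <;> linarith

lemma IsSolIcc.abs_fst_sub_le (hs : IsSolIcc h g α β u v) {S : ℝ}
    (hS : ∀ t ∈ Icc α β, |v t| ≤ S * (t - α)) {t : ℝ} (ht : t ∈ Icc α β) :
    |u t - u α| ≤ S * (t - α) ^ 2 := by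
  have hα : α ∈ Icc α β := ⟨le_rfl, ht.1.trans ht.2⟩
  have key : ∀ σ : ℝ, |σ| = 1 → σ * (u t - u α) ≤ S * (t - α) ^ 2 := by
    intro σ hσ
    have hanti : AntitoneOn (fun t => σ * u t - S * (t - α) ^ 2) (Icc α β) := by
      refine antitoneOn_of_hasDerivAt (fun x hx => ((hs x hx).1.const_mul σ).sub
        ((((hasDerivAt_id x).sub_const α).pow 2).const_mul S)) fun x hx => ?_
      have h1 : σ * v x ≤ S * (x - α) := by
        refine (le_abs_self _).trans ?_
        rw [abs_mul, hσ, one_mul]; exact hS x hx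
      have h2 : 0 ≤ S * (x - α) := (abs_nonneg _).trans (hS x hx)
      simp only [id, Nat.cast_ofNat, Nat.add_one_sub_one, pow_one, mul_one]
      linarith
    have h1 := hanti hα ht ht.1
    simp only [sub_self, ne_eq, OfNat.ofNat_ne_zero, not_false_eq_true, zero_pow, mul_zero,
      sub_zero] at h1
    linarith
  rw [abs_le]
  have h1 := key 1 (by simp)
  have h2 := key (-1) (by simp)
  constructor <;> linarith

/-- Close to a Neumann end point a solution stays comparable to its boundary value. -/
lemma IsSolIcc.near_endpoint (hs : IsSolIcc h g α β u v) {P : ℝ → ℝ}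
    (hP : ∀ t ∈ Icc α β, HasDerivAt P (h t) t) (hh : ∀ t ∈ Icc α β, 0 ≤ h t) (hv : v α = 0)
    {L τ : ℝ} (hL0 : 0 ≤ L) (hL : ∀ t ∈ Icc α β, |g (u t)| ≤ L * |u t|) (hτ : L * τ ^ 2 ≤ 1 / 3)
    (hβ : β ≤ α + τ) {t : ℝ} (ht : t ∈ Icc α β) :
    |u t - u α| ≤ |u α| / 2 ∧ |v t| ≤ 3 / 2 * L * |u α| * (t - α) := by
  obtain ⟨x, hx, hmax⟩ := isCompact_Icc.exists_isMaxOn ⟨t, ht⟩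
    (continuous_abs.comp_continuousOn hs.continuousOn_fst)
  have hS : ∀ t ∈ Icc α β, |g (u t)| ≤ L * |u x| := fun y hy =>
    (hL y hy).trans (mul_le_mul_of_nonneg_left (hmax hy) hL0)
  have hv' : ∀ t ∈ Icc α β, |v t| ≤ L * |u x| * (t - α) := fun y hy =>
    hs.abs_snd_le hP hh hv hS hy
  have hu' : ∀ t ∈ Icc α β, |u t - u α| ≤ |u x| / 3 := by
    intro y hy
    refine (hs.abs_fst_sub_le hv' hy).trans ?_
    have h1 : (y - α) ^ 2 ≤ τ ^ 2 := by
      have := hy.1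
      have := hy.2
      exact pow_le_pow_left₀ (by linarith) (by linarith) 2
    have h2 := mul_le_mul_of_nonneg_left h1 hL0
    nlinarith [abs_nonneg (u x)]
  have h3 : |u x| ≤ 3 / 2 * |u α| := by
    have h4 := hu' x hx
    have h5 := abs_sub_abs_le_abs_sub (u x) (u α)
    linarith
  refine ⟨by linarith [hu' t ht], (hv' t ht).trans ?_⟩
  have := mul_le_mul_of_nonneg_left h3 hL0
  have h6 : 0 ≤ t - α := by linarith [ht.1]
  nlinarith

end System

section Energy

variable {lam q : ℝ} {h : ℝ → ℝ} {α β : ℝ} {u v : ℝ → ℝ}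

lemma IsSolIcc.hasDerivAt_energy (hq : 1 < q) (hs : IsSolIcc h (nlTerm lam q) α β u v) {t : ℝ}
    (ht : t ∈ Icc α β) :
    HasDerivAt (fun t => v t ^ 2 / 2 + nlPot lam q (u t)) (-(h t * v t ^ 2)) t := by
  obtain ⟨h1, h2⟩ := hs t ht
  refine ((h2.pow 2).div_const 2).add ((hasDerivAt_nlPot hq (u t)).comp t h1) |>.congr_deriv ?_
  push_cast; ring

lemma IsSolIcc.antitoneOn_energy (hq : 1 < q) (hs : IsSolIcc h (nlTerm lam q) α β u v)
    (hh : ∀ t ∈ Icc α β, 0 ≤ h t) :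
    AntitoneOn (fun t => v t ^ 2 / 2 + nlPot lam q (u t)) (Icc α β) :=
  antitoneOn_of_hasDerivAt (fun _ ht => hs.hasDerivAt_energy hq ht)
    fun t ht => by nlinarith [mul_nonneg (hh t ht) (sq_nonneg (v t))]

/-- A solution of large energy vanishes somewhere on each interval of given length. -/
lemma exists_zero_of_large_energy (hlam : 0 < lam) (hq : 1 < q) {H l : ℝ} (hl : 0 < l) :
    ∃ E₀, ∀ (h u v : ℝ → ℝ) (s : ℝ), IsSolIcc h (nlTerm lam q) s (s + l) u v →
      (∀ t ∈ Icc s (s + l), |h t| ≤ H) →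
      (∀ t ∈ Icc s (s + l), E₀ ≤ v t ^ 2 / 2 + nlPot lam q (u t)) →
      ∃ z ∈ Icc s (s + l), u z = 0 := by
  set ω := 4 * Real.pi / l with hω
  have hω0 : 0 < ω := by have := Real.pi_pos; positivity
  set W := ω ^ 2 / 4 + H ^ 2 + lam with hW
  obtain ⟨C, hC0, hC⟩ := exists_sq_le_rpow hq (ε := lam / 2) (W := W) (by positivity)
    (by positivity)
  refine ⟨2 * C, fun h u v s hs hH hE => ?_⟩
  by_contra! hne
  have hd : ∀ t ∈ Icc s (s + l), HasDerivAt (fun t => Real.arctan (v t / u t / ω))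
      (1 / (1 + (v t / u t / ω) ^ 2) *
        (((-(h t * v t) - nlTerm lam q (u t)) * u t - v t * v t) / u t ^ 2 / ω)) t := by
    intro t ht
    exact (((hs t ht).2.div (hs t ht).1 (hne t ht)).div_const ω).arctan
  have hanti : AntitoneOn (fun t => Real.arctan (v t / u t / ω) + ω / 4 * t)
      (Icc s (s + l)) := by
    refine antitoneOn_of_hasDerivAt (fun t ht => (hd t ht).add
      ((hasDerivAt_id t).const_mul (ω / 4))) fun t ht => ?_
    have hu := hne t ht
    have hu2 : 0 < u t ^ 2 := by positivity
    have hden : 0 < ω ^ 2 * u t ^ 2 + v t ^ 2 := by positivity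
    have hmul : (-(h t * v t) - nlTerm lam q (u t)) * u t - v t * v t =
        -(v t ^ 2 + h t * u t * v t + lam * (|u t| ^ (q + 1) - u t ^ 2)) := by
      rw [← mul_nlTerm hq]; ring
    have e : 1 / (1 + (v t / u t / ω) ^ 2) *
        (((-(h t * v t) - nlTerm lam q (u t)) * u t - v t * v t) / u t ^ 2 / ω) =
        -(ω * ((v t ^ 2 + h t * u t * v t + lam * (|u t| ^ (q + 1) - u t ^ 2)) /
          (ω ^ 2 * u t ^ 2 + v t ^ 2))) := by
      rw [hmul]
      field_simp
    rw [e]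
    have hE' := hE t ht
    have hC' := hC (u t)
    have hpot : nlPot lam q (u t) ≤ lam * |u t| ^ (q + 1) := by
      unfold nlPot
      have h0 : 0 ≤ |u t| ^ (q + 1) := by positivity
      have h1 : |u t| ^ (q + 1) / (q + 1) ≤ |u t| ^ (q + 1) := div_le_self h0 (by linarith)
      nlinarith [mul_le_mul_of_nonneg_left h1 hlam.le]
    have hcross : |h t * u t * v t| ≤ H ^ 2 * u t ^ 2 + v t ^ 2 / 4 := by
      have h1 : |h t * u t * v t| ≤ H * |u t| * |v t| := by
        rw [abs_mul, abs_mul]; gcongr; exact hH t ht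
      have h2 : H * |u t| * |v t| ≤ (H * |u t|) ^ 2 + |v t| ^ 2 / 4 := by
        nlinarith [sq_nonneg (H * |u t| - |v t| / 2)]
      rw [mul_pow, sq_abs, sq_abs] at h2
      exact h1.trans h2
    have hcross' := (abs_le.1 hcross).1
    have key : 1 / 4 ≤ (v t ^ 2 + h t * u t * v t + lam * (|u t| ^ (q + 1) - u t ^ 2)) /
        (ω ^ 2 * u t ^ 2 + v t ^ 2) := by
      rw [le_div_iff₀ hden]
      nlinarith
    have := mul_le_mul_of_nonneg_left key hω0.le
    simp only [mul_one]
    linarith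
  have h1 := hanti ⟨le_rfl, by linarith⟩ ⟨by linarith, le_rfl⟩ (show s ≤ s + l by linarith)
  simp only at h1
  have h2 := Real.arctan_lt_pi_div_two (v s / u s / ω)
  have h3 := Real.neg_pi_div_two_lt_arctan (v (s + l) / u (s + l) / ω)
  have h4 : ω / 4 * (s + l) = ω / 4 * s + Real.pi := by
    rw [hω]; field_simp
  linarith

end Energy

section EnergyBlowup

variable {lam q : ℝ}

/-- A Pohozaev type inequality. -/
lemma IsSolIcc.pohozaev (hlam : 0 < lam) (hq : 1 < q) {τ ν θ : ℝ} (hτ : 0 < τ) (hν : 1 ≤ ν)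
    (hθ : 0 ≤ θ) {h P : ℝ → ℝ} (hP : ∀ t ∈ Ioc 0 τ, HasDerivAt P (h t) t)
    (hb : ∀ t ∈ Ioc 0 τ, θ ≤ t * h t ∧ t * h t ≤ ν) {ε C : ℝ} (hε : 0 < ε) (hC0 : 0 ≤ C)
    (hε2 : 2 * ε = lam * ((1 + θ) / (q + 1) - (ν - 1) / 2))
    (hC : ∀ x : ℝ, lam * (1 + ν) / 2 * x ^ 2 ≤ ε * |x| ^ (q + 1) + C)
    {δ s a : ℝ} (hδ : 0 < δ) (hs0 : 0 < s) (hδs : δ + s ≤ τ) {u v : ℝ → ℝ}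
    (hs : IsSolIcc h (nlTerm lam q) δ τ u v) (hv : v δ = 0) (hF : 0 ≤ nlPot lam q (u δ))
    (ha0 : 0 ≤ a) (ha : ∀ t ∈ Icc δ (δ + s), a ≤ |u t|) :
    (s / (2 * τ)) ^ ν * (s / 2) * ε * a ^ (q + 1) - C * τ ≤
      τ * (v τ ^ 2 / 2 + nlPot lam q (u τ)) + (ν - 1) / 2 * (u τ * v τ) := by
  have hh : ∀ t ∈ Ioc 0 τ, 0 ≤ h t := fun t ht =>
    nonneg_of_mul_nonneg_right (hθ.trans (hb t ht).1) ht.1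
  have hsub' : Icc δ τ ⊆ Ioc 0 τ := fun t ht => ⟨hδ.trans_le ht.1, ht.2⟩
  have hPm : MonotoneOn P (Icc δ τ) :=
    monotoneOn_of_hasDerivAt (fun t ht => hP t (hsub' ht)) fun t ht => hh t (hsub' ht)
  have hPa : AntitoneOn (fun t => P t - ν * Real.log t) (Icc δ τ) := by
    refine antitoneOn_of_hasDerivAt (fun t ht => (hP t (hsub' ht)).sub
      ((Real.hasDerivAt_log (hsub' ht).1.ne').const_mul ν)) fun t ht => ?_
    have h1 := (hb t (hsub' ht)).2
    have h0 := (hsub' ht).1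
    rw [sub_nonpos, ← div_eq_mul_inv, le_div_iff₀ h0]
    linarith
  set G : ℝ → ℝ := fun t => Real.exp (P t) *
    (t * (v t ^ 2 / 2 + nlPot lam q (u t)) + (ν - 1) / 2 * (u t * v t)) with hG
  set M := Real.exp (P τ) with hM
  have hM0 : 0 < M := Real.exp_pos _
  have hGd : ∀ t ∈ Icc δ τ, ∃ G', HasDerivAt G G' t ∧
      Real.exp (P t) * (ε * |u t| ^ (q + 1) - C) ≤ G' := by
    intro t ht
    have ht' := hsub' ht
    obtain ⟨h1, h2⟩ := hs t ht
    refine ⟨_, (hP t ht').exp.mul (((hasDerivAt_id t).mul (hs.hasDerivAt_energy hq ht)).add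
      ((h1.mul h2).const_mul ((ν - 1) / 2))), ?_⟩
    have e : Real.exp (P t) * h t *
        (t * (v t ^ 2 / 2 + nlPot lam q (u t)) + (ν - 1) / 2 * (u t * v t)) +
        Real.exp (P t) * (1 * (v t ^ 2 / 2 + nlPot lam q (u t)) + t * -(h t * v t ^ 2) +
          (ν - 1) / 2 * (v t * v t + u t * (-(h t * v t) - nlTerm lam q (u t)))) =
        Real.exp (P t) * (v t ^ 2 * (ν - t * h t) / 2 + (1 + t * h t) * nlPot lam q (u t) -
          (ν - 1) / 2 * (u t * nlTerm lam q (u t))) := by ring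
    refine le_trans ?_ e.ge
    refine mul_le_mul_of_nonneg_left ?_ (Real.exp_pos _).le
    obtain ⟨hb1, hb2⟩ := hb t ht'
    rw [mul_nlTerm hq]
    unfold nlPot
    have hA : 0 ≤ |u t| ^ (q + 1) := by positivity
    set B := |u t| ^ (q + 1) with hB
    have hBq : B / (q + 1) * (1 + θ) = B * ((1 + θ) / (q + 1)) := by ring
    have hBq0 : 0 ≤ B / (q + 1) := div_nonneg hA (by linarith)
    have h3 : 0 ≤ v t ^ 2 * (ν - t * h t) / 2 := by
      have := mul_nonneg (sq_nonneg (v t)) (sub_nonneg.2 hb2)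
      linarith
    have h4 := hC (u t)
    have h5 : (1 + θ) * (lam * (B / (q + 1))) ≤ (1 + t * h t) * (lam * (B / (q + 1))) := by
      apply mul_le_mul_of_nonneg_right (by linarith); positivity
    have h6 : (1 + t * h t) * (lam * (u t ^ 2 / 2)) ≤ (1 + ν) * (lam * (u t ^ 2 / 2)) := by
      apply mul_le_mul_of_nonneg_right (by linarith); positivity
    have h7 : 0 ≤ (ν - 1) / 2 * (lam * u t ^ 2) :=
      mul_nonneg (by linarith) (by positivity)
    have h8 : (2 * ε) * B = (1 + θ) * (lam * (B / (q + 1))) - (ν - 1) / 2 * (lam * B) := by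
      rw [hε2]; ring
    nlinarith
  choose! G' hG' hG'le using hGd
  have hexp : ∀ t ∈ Icc δ τ, Real.exp (P t) ≤ M := fun t ht =>
    Real.exp_le_exp.2 (hPm ht ⟨ht.1.trans ht.2, le_rfl⟩ ht.2)
  have hmono : MonotoneOn (fun t => G t + C * M * t) (Icc δ τ) := by
    refine monotoneOn_of_hasDerivAt (fun t ht => (hG' t ht).add
      ((hasDerivAt_id t).const_mul (C * M))) fun t ht => ?_
    have h1 := hG'le t ht
    have h2 := mul_le_mul_of_nonneg_left (hexp t ht) hC0
    have h3 : 0 ≤ Real.exp (P t) * (ε * |u t| ^ (q + 1)) := by positivity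
    simp only [mul_one]
    nlinarith
  set m := M * (s / (2 * τ)) ^ ν * (ε * a ^ (q + 1)) with hm
  have hsub2 : Icc (δ + s / 2) (δ + s) ⊆ Icc δ τ :=
    Icc_subset_Icc (by linarith) (by linarith)
  have hmono2 : MonotoneOn (fun t => G t + C * M * t - m * t) (Icc (δ + s / 2) (δ + s)) := by
    refine monotoneOn_of_hasDerivAt (fun t ht => ((hG' t (hsub2 ht)).add
      ((hasDerivAt_id t).const_mul (C * M))).sub ((hasDerivAt_id t).const_mul m)) fun t ht => ?_
    have ht' := hsub2 ht
    have h1 := hG'le t ht'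
    have h2 := mul_le_mul_of_nonneg_left (hexp t ht') hC0
    have ht0 : 0 < t := hδ.trans_le ht'.1
    have h3 : M * (s / (2 * τ)) ^ ν ≤ Real.exp (P t) := by
      have h4 := hPa ht' ⟨ht'.1.trans ht'.2, le_rfl⟩ ht'.2
      simp only at h4
      have h5 : s / (2 * τ) ≤ t / τ := by
        rw [div_le_div_iff₀ (by positivity) hτ]; nlinarith [ht.1]
      calc M * (s / (2 * τ)) ^ ν ≤ M * (t / τ) ^ ν := by gcongr
        _ = Real.exp (P τ + ν * (Real.log t - Real.log τ)) := by
          rw [Real.exp_add, Real.rpow_def_of_pos (by positivity),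
            Real.log_div ht0.ne' hτ.ne', mul_comm ν]
        _ ≤ _ := Real.exp_le_exp.2 (by linarith)
    have h4 : a ^ (q + 1) ≤ |u t| ^ (q + 1) :=
      Real.rpow_le_rpow ha0 (ha t ⟨by linarith [ht.1], ht.2⟩) (by linarith)
    have h5 : m ≤ Real.exp (P t) * (ε * |u t| ^ (q + 1)) := by
      rw [hm]; gcongr
    simp only [mul_one]
    nlinarith
  have k1 := hmono ⟨le_rfl, by linarith⟩ (hsub2 ⟨le_rfl, by linarith⟩)
    (show δ ≤ δ + s / 2 by linarith)
  have k2 := hmono2 ⟨le_rfl, by linarith⟩ ⟨by linarith, le_rfl⟩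
    (show δ + s / 2 ≤ δ + s by linarith)
  have k3 := hmono (hsub2 ⟨by linarith, le_rfl⟩) ⟨by linarith, le_rfl⟩ hδs
  simp only at k1 k2 k3
  have k4 : 0 ≤ G δ := by
    simp only [hG, hv]
    have := Real.exp_pos (P δ)
    simp only [ne_eq, OfNat.ofNat_ne_zero, not_false_eq_true, zero_pow, zero_div, zero_add,
      mul_zero, add_zero]
    positivity
  have k5 : 0 ≤ C * M * δ := by positivity
  have k6 : m * (s / 2) ≤ G τ + C * M * τ := by nlinarith
  have k7 : G τ = M * (τ * (v τ ^ 2 / 2 + nlPot lam q (u τ)) + (ν - 1) / 2 * (u τ * v τ)) := rfl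
  rw [k7] at k6
  refine le_of_mul_le_mul_left ?_ hM0
  calc _ = m * (s / 2) - C * M * τ := by rw [hm]; ring
    _ ≤ _ := by linarith

lemma exists_large_energy (hlam : 0 < lam) (hq : 1 < q) {τ ν θ : ℝ} (hτ : 0 < τ) (hν : 1 ≤ ν)
    (hθ : 0 ≤ θ) (hθν : θ ≤ ν) (hsub : (ν - 1) / 2 < (1 + θ) / (q + 1)) {h P : ℝ → ℝ}
    (hP : ∀ t ∈ Ioc 0 τ, HasDerivAt P (h t) t)
    (hb : ∀ t ∈ Ioc 0 τ, θ ≤ t * h t ∧ t * h t ≤ ν) (E₀ : ℝ) :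
    ∃ A, 1 ≤ A ∧ ∀ δ ∈ Ioc 0 (τ / 2), ∀ u v : ℝ → ℝ, IsSolIcc h (nlTerm lam q) δ τ u v →
      v δ = 0 → A ≤ |u δ| → E₀ ≤ v τ ^ 2 / 2 + nlPot lam q (u τ) := by
  set ε := lam * ((1 + θ) / (q + 1) - (ν - 1) / 2) / 2 with hε
  have hε0 : 0 < ε := by have := sub_pos.2 hsub; positivity
  obtain ⟨C, hC0, hC⟩ := exists_sq_le_rpow hq (ε := ε) (W := lam * (1 + ν) / 2) hε0
    (by positivity)
  obtain ⟨C₃, hC₃0, hC₃⟩ := exists_half_sq_le_nlPot hlam hq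
  set r := (q - 1) / 2 with hr
  have hr0 : 0 < r := by rw [hr]; linarith
  set κ := (Real.sqrt (2 * lam))⁻¹ with hκ
  have hκ0 : 0 < κ := by positivity
  have he : 0 < -(r * ν) - r + (q + 1) := by
    rw [div_lt_div_iff₀ (by norm_num) (by linarith)] at hsub
    rw [hr]; nlinarith
  have hev1 : ∀ᶠ a : ℝ in atTop, κ * a ^ (-r) ≤ τ / 2 := by
    have := (tendsto_rpow_neg_atTop hr0).const_mul κ
    rw [mul_zero] at this
    exact (this.eventually_lt_const (by positivity)).mono fun _ h => h.le
  set K := (κ / (2 * τ)) ^ ν * (κ / 2) * ε * (1 / 2) ^ (q + 1) with hK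
  have hK0 : 0 < K := by positivity
  have hev2 : ∀ᶠ a : ℝ in atTop, (τ + (ν - 1) / 2) * |E₀| + (ν - 1) / 2 * C₃ + C * τ ≤
      K * a ^ (-(r * ν) - r + (q + 1)) :=
    ((tendsto_rpow_atTop he).const_mul_atTop hK0).eventually_ge_atTop _
  obtain ⟨A, hA⟩ := eventually_atTop.1 (hev1.and (hev2.and (eventually_ge_atTop (1 + 2 * C₃))))
  refine ⟨max A 1, le_max_right _ _, fun δ hδ u v hs hv hu => ?_⟩
  set a := |u δ| with ha
  have ha1 : 1 ≤ a := (le_max_right _ _).trans hu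
  obtain ⟨h1, h2, h3⟩ := hA a ((le_max_left _ _).trans hu)
  set s := κ * a ^ (-r) with hs_def
  have ha0 : 0 < a := by linarith
  have hs0 : 0 < s := by positivity
  have hδs : δ + s ≤ τ := by linarith [hδ.2]
  have hF : 0 ≤ nlPot lam q (u δ) := by
    have := hC₃ (u δ)
    rw [← sq_abs, ← ha] at this
    nlinarith
  have hh : ∀ t ∈ Icc δ τ, 0 ≤ h t := fun t ht =>
    nonneg_of_mul_nonneg_right (hθ.trans (hb t ⟨hδ.1.trans_le ht.1, ht.2⟩).1)
      (hδ.1.trans_le ht.1)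
  have hδτ : δ ∈ Icc δ τ := ⟨le_rfl, by linarith⟩
  have hbd : ∀ t ∈ Icc δ τ, |u t| ≤ a := by
    intro t ht
    refine abs_le_of_nlPot_le hlam hq ha1 ?_
    have := hs.antitoneOn_energy hq hh hδτ ht ht.1
    simp only [hv] at this
    nlinarith [sq_nonneg (v t)]
  have hsq : lam * a ^ q * s ^ 2 = a / 2 := by
    have e1 : s ^ 2 = κ ^ 2 * a ^ (-(q - 1)) := by
      rw [hs_def, mul_pow, ← Real.rpow_natCast (a ^ (-r)) 2, ← Real.rpow_mul ha0.le]
      congr 2; rw [hr]; push_cast; ring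
    have e2 : κ ^ 2 = (2 * lam)⁻¹ := by rw [hκ, inv_pow, Real.sq_sqrt (by positivity)]
    have e3 : a ^ q * a ^ (-(q - 1)) = a := by
      rw [← Real.rpow_add ha0]
      rw [show q + -(q - 1) = 1 by ring, Real.rpow_one]
    rw [e1, e2]
    calc lam * a ^ q * ((2 * lam)⁻¹ * a ^ (-(q - 1)))
        = lam * (2 * lam)⁻¹ * (a ^ q * a ^ (-(q - 1))) := by ring
      _ = _ := by rw [e3]; field_simp
  have hlow : ∀ t ∈ Icc δ (δ + s), a / 2 ≤ |u t| := by
    intro t ht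
    have ht' : t ∈ Icc δ τ := ⟨ht.1, ht.2.trans hδs⟩
    have h5 : |u t - u δ| ≤ lam * a ^ q * (t - δ) ^ 2 :=
      hs.abs_fst_sub_le (fun y hy => hs.abs_snd_le
        (fun x hx => hP x ⟨hδ.1.trans_le hx.1, hx.2⟩) hh hv
        (fun x hx => abs_nlTerm_le hlam hq ha1 (hbd x hx)) hy) ht'
    have h6 : (t - δ) ^ 2 ≤ s ^ 2 := pow_le_pow_left₀ (by linarith [ht.1]) (by linarith [ht.2]) 2
    have h7 : lam * a ^ q * (t - δ) ^ 2 ≤ a / 2 := by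
      rw [← hsq]; gcongr
    have h8 := abs_sub_abs_le_abs_sub (u δ) (u t)
    rw [abs_sub_comm] at h8
    linarith
  have hpoh := hs.pohozaev hlam hq hτ hν hθ hP hb hε0 hC0 (by rw [hε]; ring) hC hδ.1 hs0 hδs
    hv hF (by positivity) hlow
  have e4 : (s / (2 * τ)) ^ ν * (s / 2) * ε * (a / 2) ^ (q + 1) =
      K * a ^ (-(r * ν) - r + (q + 1)) := by
    have f1 : (s / (2 * τ)) ^ ν = (κ / (2 * τ)) ^ ν * a ^ (-(r * ν)) := by
      rw [show s / (2 * τ) = κ / (2 * τ) * a ^ (-r) by rw [hs_def]; ring,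
        Real.mul_rpow (by positivity) (by positivity), ← Real.rpow_mul ha0.le, neg_mul]
    have f2 : (a / 2) ^ (q + 1) = (1 / 2) ^ (q + 1) * a ^ (q + 1) := by
      rw [← Real.mul_rpow (by norm_num) ha0.le]; congr 1; ring
    have f3 : a ^ (-(r * ν) - r + (q + 1)) = a ^ (-(r * ν)) * a ^ (-r) * a ^ (q + 1) := by
      rw [← Real.rpow_add ha0, ← Real.rpow_add ha0, sub_eq_add_neg]
    rw [f1, f2, f3, hs_def, hK]
    ring
  rw [e4] at hpoh
  set E := v τ ^ 2 / 2 + nlPot lam q (u τ) with hE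
  have h9 : u τ * v τ ≤ E + C₃ := by
    have := hC₃ (u τ)
    nlinarith [sq_nonneg (u τ - v τ)]
  have hα0 : 0 ≤ (ν - 1) / 2 := by linarith
  have h10 := mul_le_mul_of_nonneg_left h9 hα0
  have h11 : (τ + (ν - 1) / 2) * |E₀| ≤ (τ + (ν - 1) / 2) * E := by linarith
  exact (le_abs_self E₀).trans (le_of_mul_le_mul_left h11 (by linarith))

/-- Solutions starting from a large value oscillate many times. -/
lemma exists_many_zeros (hlam : 0 < lam) (hq : 1 < q) {τ ν θ : ℝ} (hτ : 0 < τ) (hν : 1 ≤ ν)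
    (hθ : 0 ≤ θ) (hθν : θ ≤ ν) (hsub : (ν - 1) / 2 < (1 + θ) / (q + 1)) {h P : ℝ → ℝ}
    (hP : ∀ t ∈ Ioc 0 τ, HasDerivAt P (h t) t)
    (hb : ∀ t ∈ Ioc 0 τ, θ ≤ t * h t ∧ t * h t ≤ ν) (K : ℕ) :
    ∃ A, 1 ≤ A ∧ ∀ δ ∈ Ioc 0 (τ / 2), ∀ u v : ℝ → ℝ, IsSolIcc h (nlTerm lam q) δ τ u v →
      v δ = 0 → A ≤ |u δ| → ∃ z : ℕ → ℝ, (∀ j < K, z j ∈ Icc (τ / 2) τ ∧ u (z j) = 0) ∧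
        ∀ i j, i < j → j < K → z i < z j := by
  rcases Nat.eq_zero_or_pos K with rfl | hK
  · exact ⟨1, le_rfl, fun _ _ _ _ _ _ _ => ⟨fun _ => 0, by simp, by simp⟩⟩
  have hK' : (0 : ℝ) < K := by exact_mod_cast hK
  set l := τ / (4 * K) with hl
  have hl0 : 0 < l := by positivity
  obtain ⟨E₀, hE₀⟩ := exists_zero_of_large_energy (H := 2 * ν / τ) hlam hq hl0
  obtain ⟨A, hA1, hA⟩ := exists_large_energy hlam hq hτ hν hθ hθν hsub hP hb E₀
  refine ⟨A, hA1, fun δ hδ u v hs hv hu => ?_⟩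
  have hh : ∀ t ∈ Icc δ τ, 0 ≤ h t := fun t ht =>
    nonneg_of_mul_nonneg_right (hθ.trans (hb t ⟨hδ.1.trans_le ht.1, ht.2⟩).1)
      (hδ.1.trans_le ht.1)
  have hEτ := hA δ hδ u v hs hv hu
  have hz : ∀ j : ℕ, j < K → ∃ z ∈ Icc (τ / 2 + 2 * j * l) (τ / 2 + 2 * j * l + l), u z = 0 := by
    intro j hj
    have hj' : (j : ℝ) + 1 ≤ K := by exact_mod_cast hj
    have hup : τ / 2 + 2 * j * l + l ≤ τ := by
      have : l * K = τ / 4 := by rw [hl]; field_simp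
      nlinarith
    have hlo : τ / 2 ≤ τ / 2 + 2 * j * l := by
      have : 0 ≤ 2 * j * l := by positivity
      linarith
    refine hE₀ h u v _ (hs.mono (hδ.2.trans hlo) hup) (fun t ht => ?_) fun t ht => ?_
    · have ht2 : τ / 2 ≤ t := hlo.trans ht.1
      have ht3 : t ≤ τ := ht.2.trans hup
      have h1 := hh t ⟨hδ.2.trans ht2, ht3⟩
      rw [abs_of_nonneg h1, le_div_iff₀ hτ]
      nlinarith [(hb t ⟨by linarith, ht3⟩).2]
    · have ht2 : τ / 2 ≤ t := hlo.trans ht.1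
      have ht3 : t ≤ τ := ht.2.trans hup
      exact hEτ.trans (hs.antitoneOn_energy hq hh ⟨hδ.2.trans ht2, ht3⟩
        ⟨by linarith [hδ.2], le_rfl⟩ ht3)
  choose! z hz1 hz2 using hz
  refine ⟨z, fun j hj => ⟨⟨?_, ?_⟩, hz2 j hj⟩, fun i j hij hj => ?_⟩
  · have : 0 ≤ 2 * (j : ℝ) * l := by positivity
    linarith [(hz1 j hj).1]
  · have hj' : (j : ℝ) + 1 ≤ K := by exact_mod_cast hj
    have : l * K = τ / 4 := by rw [hl]; field_simp
    nlinarith [(hz1 j hj).2]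
  · have h1 := (hz1 i (hij.trans hj)).2
    have h2 := (hz1 j hj).1
    have h3 : (i : ℝ) + 1 ≤ j := by exact_mod_cast hij
    nlinarith

end EnergyBlowup

section Existence

variable {lam q : ℝ}

/-- The energy grows at most exponentially, in both time directions. -/
lemma IsSolIcc.energy_le {h u v : ℝ → ℝ} {α β : ℝ} (hq : 1 < q)
    (hs : IsSolIcc h (nlTerm lam q) α β u v) {H C : ℝ} (hH : ∀ t ∈ Icc α β, |h t| ≤ H)
    (hC : ∀ x : ℝ, x ^ 2 / 2 ≤ nlPot lam q x + C) {s t : ℝ} (hs' : s ∈ Icc α β)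
    (ht : t ∈ Icc α β) :
    v t ^ 2 / 2 + nlPot lam q (u t) + C ≤
      (v s ^ 2 / 2 + nlPot lam q (u s) + C) * Real.exp (2 * H * |t - s|) := by
  refine gronwall_two_sided (D := fun t => v t ^ 2 / 2 + nlPot lam q (u t) + C)
    (fun t ht => (hs.hasDerivAt_energy hq ht).add_const C) (fun t ht => ?_) hs' ht
  have h1 := hC (u t)
  have h2 := sq_nonneg (u t)
  have h3 : 0 ≤ H := (abs_nonneg _).trans (hH t ht)
  rw [abs_neg, abs_mul, abs_of_nonneg (sq_nonneg (v t))]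
  have h4 := mul_le_mul_of_nonneg_right (hH t ht) (sq_nonneg (v t))
  have h5 : 0 ≤ H * (nlPot lam q (u t) + C) := mul_nonneg h3 (by linarith)
  linarith

lemma abs_max_min_sub_le (M x y : ℝ) :
    |max (-M) (min M x) - max (-M) (min M y)| ≤ |x - y| :=
  by
  refine (abs_max_sub_max_le_max _ _ _ _).trans (max_le (by simp) ?_)
  exact (abs_min_sub_min_le_max _ _ _ _).trans (max_le (by simp) le_rfl)

/-- Solvability of the initial value problem with the unknowns truncated at height `M`. -/
lemma exists_truncated_solution {h g : ℝ → ℝ} {α' α β β' H L M : ℝ} (hα : α' < α) (hαβ : α ≤ β)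
    (hβ : β < β') (hh : ContinuousOn h (Icc α' β')) (hH : ∀ t ∈ Icc α' β', |h t| ≤ H)
    (hL0 : 0 ≤ L) (hM0 : 0 ≤ M) (hg0 : g 0 = 0)
    (hL : ∀ x y : ℝ, |x| ≤ M → |y| ≤ M → |g x - g y| ≤ L * |x - y|) (a : ℝ) :
    ∃ u v : ℝ → ℝ, u α = a ∧ v α = 0 ∧
      (∀ t ∈ Icc α β, HasDerivAt u (max (-M) (min M (v t))) t) ∧
      ∀ t ∈ Icc α β, HasDerivAt v
        (-(h t * max (-M) (min M (v t))) - g (max (-M) (min M (u t)))) t := by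
  have hH0 : 0 ≤ H := (abs_nonneg _).trans (hH α ⟨hα.le, by linarith⟩)
  set cl : ℝ → ℝ := fun x => max (-M) (min M x) with hcl
  have hclM : ∀ x, |cl x| ≤ M := fun x => by
    rw [abs_le]; exact ⟨le_max_left _ _, max_le (by linarith) (min_le_left _ _)⟩
  have hcl_lip : ∀ x y, |cl x - cl y| ≤ |x - y| := abs_max_min_sub_le M
  set V : ℝ → ℝ × ℝ → ℝ × ℝ := fun t p => (cl p.2, -(h t * cl p.2) - g (cl p.1))
    with hV
  have ht0 : α ∈ Icc α' β' := ⟨hα.le, by linarith⟩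
  set B := M + H * M + L * M with hB
  have hB0 : 0 ≤ B := by positivity
  set K := 1 + H + L with hK
  have hK0 : 0 ≤ K := by positivity
  have hPL : IsPicardLindelof V (⟨α, ht0⟩ : Icc α' β') ((a, 0) : ℝ × ℝ)
      ⟨B * (β' - α'), mul_nonneg hB0 (by linarith)⟩ 0 ⟨B, hB0⟩ ⟨K, hK0⟩ := by
    constructor
    · intro t ht
      refine LipschitzOnWith.of_dist_le_mul fun p _ p' _ => ?_
      simp only [hV, Prod.dist_eq, Real.dist_eq]
      set m := max |p.1 - p'.1| |p.2 - p'.2| with hm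
      have hm1 : |p.1 - p'.1| ≤ m := le_max_left _ _
      have hm2 : |p.2 - p'.2| ≤ m := le_max_right _ _
      have hm0 : 0 ≤ m := (abs_nonneg _).trans hm1
      have h1 := (hcl_lip p.2 p'.2).trans hm2
      have h2 := (hL _ _ (hclM p.1) (hclM p'.1)).trans
        (mul_le_mul_of_nonneg_left ((hcl_lip p.1 p'.1).trans hm1) hL0)
      have h3 : |h t * (cl p.2 - cl p'.2)| ≤ H * m := by
        rw [abs_mul]; exact mul_le_mul (hH t ht) h1 (abs_nonneg _) hH0
      change max _ _ ≤ K * m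
      refine max_le ?_ ?_
      · have : 0 ≤ H * m := by positivity
        have : 0 ≤ L * m := by positivity
        linarith
      · have h4 : -(h t * cl p.2) - g (cl p.1) -
            (-(h t * cl p'.2) - g (cl p'.1)) =
            -(h t * (cl p.2 - cl p'.2)) + -(g (cl p.1) - g (cl p'.1)) := by
          ring
        rw [h4]
        refine (abs_add_le _ _).trans ?_
        rw [abs_neg, abs_neg]
        linarith
    · intro p _
      exact continuousOn_const.prodMk ((hh.mul continuousOn_const).neg.sub continuousOn_const)
    · intro t ht p _
      simp only [hV, Prod.norm_def, Real.norm_eq_abs]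
      change max _ _ ≤ B
      have h1 := hclM p.2
      have h2 : |g (cl p.1)| ≤ L * M := by
        have := hL (cl p.1) 0 (hclM _) (by simpa using hM0)
        rw [hg0, sub_zero, sub_zero] at this
        exact this.trans (mul_le_mul_of_nonneg_left (hclM _) hL0)
      have h3 : |h t * cl p.2| ≤ H * M := by
        rw [abs_mul]; exact mul_le_mul (hH t ht) h1 (abs_nonneg _) hH0
      have h4 : 0 ≤ H * M := by positivity
      have h5 : 0 ≤ L * M := by positivity
      refine max_le (by linarith) ?_
      refine (abs_sub _ _).trans ?_
      rw [abs_neg]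
      linarith
    · change B * max (β' - α) (α - α') ≤ B * (β' - α') - 0
      rw [sub_zero]
      exact mul_le_mul_of_nonneg_left (max_le (by linarith) (by linarith)) hB0
  obtain ⟨w, hw0, hw⟩ := hPL.exists_eq_forall_mem_Icc_hasDerivWithinAt₀
  simp only at hw0
  have hw' : ∀ t ∈ Icc α β, HasDerivAt w (V t (w t)) t := fun t ht =>
    (hw t ⟨by linarith [ht.1], by linarith [ht.2]⟩).hasDerivAt
      (Icc_mem_nhds (by linarith [ht.1]) (by linarith [ht.2]))
  exact ⟨fun t => (w t).1, fun t => (w t).2, congrArg Prod.fst hw0, congrArg Prod.snd hw0,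
    fun t ht => (hw' t ht).fst,
    fun t ht => (hw' t ht).snd⟩

/-- Global existence for the initial value problem, with bounds locally uniform in the data. -/
lemma exists_isSolIcc (hlam : 0 < lam) (hq : 1 < q) {h : ℝ → ℝ} {α' α β β' : ℝ} (hα : α' < α)
    (hαβ : α ≤ β) (hβ : β < β') (hh : ContinuousOn h (Icc α' β')) (A : ℝ) :
    ∃ R, ∀ a, |a| ≤ A → ∃ u v : ℝ → ℝ, IsSolIcc h (nlTerm lam q) α β u v ∧ u α = a ∧ v α = 0 ∧
      ∀ t ∈ Icc α β, |u t| ≤ R ∧ |v t| ≤ R := by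
  obtain ⟨H, hH⟩ := isCompact_Icc.exists_bound_of_continuousOn hh
  simp only [Real.norm_eq_abs] at hH
  have hH0 : 0 ≤ H := (abs_nonneg _).trans (hH α ⟨hα.le, by linarith⟩)
  obtain ⟨C, hC0, hC⟩ := exists_half_sq_le_nlPot hlam hq
  set D₀ := lam * (A ^ (q + 1) / (q + 1)) + C with hD₀
  set e := Real.exp (2 * H * (β - α)) with he
  have he0 : 0 < e := Real.exp_pos _
  rcases lt_or_ge A 0 with hA | hA
  · exact ⟨0, fun a ha => absurd (ha.trans_lt hA) (not_lt.2 (abs_nonneg a))⟩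
  have hD0 : 0 ≤ D₀ := by positivity
  set M := 2 * D₀ * e + 2 + A with hM
  have hDe : 0 ≤ D₀ * e := by positivity
  have hM2 : 2 ≤ M := by linarith
  have hMA : A < M := by linarith
  have hMD : 2 * D₀ * e < M ^ 2 := by nlinarith
  refine ⟨M, fun a ha => ?_⟩
  obtain ⟨L, hL0, hL⟩ := exists_lipschitz_nlTerm hlam hq (R := M) (by linarith)
  obtain ⟨u, v, hu0, hv0, hu, hv⟩ := exists_truncated_solution hα hαβ hβ hh hH hL0.le
    (by linarith : 0 ≤ M) nlTerm_zero hL a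
  have hcl_eq : ∀ x, |x| ≤ M → max (-M) (min M x) = x := fun x hx => by
    rw [abs_le] at hx
    rw [min_eq_right hx.2, max_eq_right hx.1]
  have hsol : ∀ T ∈ Icc α β, (∀ t ∈ Icc α T, |u t| ≤ M ∧ |v t| ≤ M) →
      IsSolIcc h (nlTerm lam q) α T u v := by
    intro T hT hb t ht
    have ht' : t ∈ Icc α β := ⟨ht.1, ht.2.trans hT.2⟩
    have h1 := hu t ht'
    have h2 := hv t ht'
    rw [hcl_eq _ (hb t ht).2] at h1 h2
    rw [hcl_eq _ (hb t ht).1] at h2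
    exact ⟨h1, h2⟩
  set m : ℝ → ℝ := fun t => max |u t| |v t| with hm
  have hmc : ContinuousOn m (Icc α β) := fun t ht =>
    ContinuousAt.continuousWithinAt <|
      ((hu t ht).continuousAt.abs).sup ((hv t ht).continuousAt.abs)
  have hmα : m α < M := by
    simp only [hm, hu0, hv0, abs_zero]
    exact max_lt (by linarith) (by linarith)
  have hlt : ∀ t ∈ Icc α β, m t < M := by
    by_contra! hcon
    obtain ⟨t₁, ht₁, hmt₁⟩ := hcon
    have hcpt : IsCompact (Icc α β ∩ m ⁻¹' (Ici M)) :=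
      isCompact_Icc.of_isClosed_subset (hmc.preimage_isClosed_of_isClosed isClosed_Icc isClosed_Ici)
        inter_subset_left
    obtain ⟨T, ⟨hT, hTM⟩, hTl⟩ := hcpt.exists_isLeast ⟨t₁, ht₁, hmt₁⟩
    have hTM' : M ≤ m T := hTM
    have hmT : m T = M := by
      have hivt := intermediate_value_Icc hT.1 (hmc.mono (Icc_subset_Icc_right hT.2))
      obtain ⟨t, ht, hmt⟩ := hivt ⟨hmα.le, hTM'⟩
      have h1 : T ≤ t := hTl ⟨⟨ht.1, ht.2.trans hT.2⟩, hmt.ge⟩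
      rwa [le_antisymm ht.2 h1] at hmt
    have hb : ∀ t ∈ Icc α T, m t ≤ M := by
      intro t ht
      by_contra! hlt
      have h1 : T ≤ t := hTl ⟨⟨ht.1, ht.2.trans hT.2⟩, hlt.le⟩
      rw [le_antisymm ht.2 h1] at hlt
      linarith
    have hs := hsol T hT fun t ht => max_le_iff.1 (hb t ht)
    have hE := hs.energy_le hq (H := H) (fun t ht => hH t ⟨by linarith [ht.1], by
      linarith [ht.2, hT.2]⟩) hC (left_mem_Icc.2 hT.1) (right_mem_Icc.2 hT.1)
    rw [hu0, hv0] at hE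
    have h3 : 0 ^ 2 / 2 + nlPot lam q a + C ≤ D₀ := by
      have := nlPot_le_of_abs_le hlam hq ha
      rw [hD₀]; linarith
    have h4 : Real.exp (2 * H * |T - α|) ≤ e := by
      rw [abs_of_nonneg (by linarith [hT.1]), he]
      gcongr
      exact hT.2
    have h5 := mul_le_mul h3 h4 (Real.exp_pos _).le hD0
    have h6 := hC (u T)
    have h7 : M ^ 2 ≤ u T ^ 2 + v T ^ 2 := by
      rw [← hmT, ← sq_abs (u T), ← sq_abs (v T)]
      rcases max_choice |u T| |v T| with hh | hh
      · change (max |u T| |v T|) ^ 2 ≤ _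
        rw [hh]; linarith [sq_nonneg |v T|]
      · change (max |u T| |v T|) ^ 2 ≤ _
        rw [hh]; linarith [sq_nonneg |u T|]
    linarith
  exact ⟨u, v, hsol β (right_mem_Icc.2 hαβ) fun t ht => max_le_iff.1 (hlt t ht).le, hu0,
    hv0, fun t ht => max_le_iff.1 (hlt t ht).le⟩

end Existence

section Angle

variable {φ φ' : ℝ → ℝ} {α β : ℝ}

/-- The zeros of the cosine are crossed upwards, hence never crossed back. -/
lemma lt_of_le_of_cos_eq_zero (hφ : ∀ t ∈ Icc α β, HasDerivAt φ (φ' t) t)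
    (hpos : ∀ t ∈ Icc α β, Real.cos (φ t) = 0 → 0 < φ' t) {c s t : ℝ} (hc : Real.cos c = 0)
    (hs : α ≤ s) (ht : t ≤ β) (hst : s < t) (hcs : c ≤ φ s) : c < φ t := by
  have key : ∀ x ∈ Icc s t, c ≤ φ x := by
    refine image_le_of_deriv_right_lt_deriv_boundary' (f := fun _ => c) (f' := fun _ => 0)
      (B' := φ') continuousOn_const (fun x _ => (hasDerivAt_const x c).hasDerivWithinAt) hcs
      (fun x hx => (hφ x ⟨hs.trans hx.1, hx.2.trans ht⟩).continuousAt.continuousWithinAt)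
      (fun x hx => (hφ x ⟨hs.trans hx.1, hx.2.le.trans ht⟩).hasDerivWithinAt) ?_
    intro x hx hcx
    exact hpos x ⟨hs.trans hx.1, hx.2.le.trans ht⟩ (by rw [← hcx, hc])
  refine lt_of_le_of_ne (key t ⟨hst.le, le_rfl⟩) fun hct => ?_
  have htI : t ∈ Icc α β := ⟨hs.trans hst.le, ht⟩
  have hp := hpos t htI (by rw [← hct, hc])
  have h1 := (hasDerivAt_iff_tendsto_slope_left_right.1 (hφ t htI)).1
  have h2 := (h1.eventually (lt_mem_nhds hp)).and (Ioo_mem_nhdsLT hst)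
  obtain ⟨x, hx, hxs⟩ := h2.exists
  rw [slope_def_field] at hx
  have h3 := key x ⟨hxs.1.le, hxs.2.le⟩
  rw [hct] at h3
  have h4 : (φ x - φ t) / (x - t) ≤ 0 :=
    div_nonpos_of_nonneg_of_nonpos (by linarith) (by linarith [hxs.2])
  linarith

/-- The number of zeros of `cos ∘ φ` is read off from the values of `φ` at the end points. -/
lemma ncard_zeros_cos (hφ : ∀ t ∈ Icc α β, HasDerivAt φ (φ' t) t)
    (hpos : ∀ t ∈ Icc α β, Real.cos (φ t) = 0 → 0 < φ' t) (hαβ : α ≤ β) {k : ℕ}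
    (hα₁ : -(Real.pi / 2) < φ α) (hα₂ : φ α < Real.pi / 2)
    (hβ₁ : k * Real.pi - Real.pi / 2 < φ β) (hβ₂ : φ β < k * Real.pi + Real.pi / 2) :
    {t ∈ Ioo α β | Real.cos (φ t) = 0}.Finite ∧ {t ∈ Ioo α β | Real.cos (φ t) = 0}.ncard = k := by
  have hπ := Real.pi_pos
  have hc : ∀ j : ℕ, Real.cos ((2 * (j : ℝ) + 1) * Real.pi / 2) = 0 := fun j =>
    Real.cos_eq_zero_iff.2 ⟨j, by push_cast; ring⟩
  have hcont : ContinuousOn φ (Icc α β) := fun t ht => (hφ t ht).continuousAt.continuousWithinAt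
  have hex : ∀ j : ℕ, ∃ t, j < k → t ∈ Ioo α β ∧ φ t = (2 * (j : ℝ) + 1) * Real.pi / 2 := by
    intro j
    by_cases hj : j < k
    · have hj' : (j : ℝ) + 1 ≤ k := by exact_mod_cast hj
      have h0 : (0 : ℝ) ≤ j * Real.pi := by positivity
      have h1 : ((j : ℝ) + 1) * Real.pi ≤ k * Real.pi := mul_le_mul_of_nonneg_right hj' hπ.le
      obtain ⟨t, ht, hφt⟩ := intermediate_value_Ioo hαβ hcont
        (show (2 * (j : ℝ) + 1) * Real.pi / 2 ∈ Ioo (φ α) (φ β) from ⟨by linarith, by linarith⟩)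
      exact ⟨t, fun _ => ⟨ht, hφt⟩⟩
    · exact ⟨0, fun h => absurd h hj⟩
  choose z hz using hex
  have heq : {t ∈ Ioo α β | Real.cos (φ t) = 0} = z '' (Finset.range k : Set ℕ) := by
    ext t
    constructor
    · rintro ⟨ht, hct⟩
      obtain ⟨m, hm⟩ := Real.cos_eq_zero_iff.1 hct
      have hm0 : 0 ≤ m := by
        by_contra! hlt
        have h1 : m ≤ -1 := by linarith
        have h2 : (m : ℝ) ≤ -1 := by exact_mod_cast h1
        have h3 := lt_of_le_of_cos_eq_zero hφ hpos (c := -(Real.pi / 2)) (by simp) le_rfl ht.2.le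
          ht.1 hα₁.le
        nlinarith
      obtain ⟨j, rfl⟩ := Int.eq_ofNat_of_zero_le hm0
      have hφt : φ t = (2 * (j : ℝ) + 1) * Real.pi / 2 := by rw [hm]; push_cast; ring
      have hjk : j < k := by
        by_contra! hle
        have h2 : (k : ℝ) ≤ j := by exact_mod_cast hle
        have h3 := lt_of_le_of_cos_eq_zero hφ hpos hct ht.1.le le_rfl ht.2 le_rfl
        nlinarith
      refine ⟨j, by simpa using hjk, ?_⟩
      obtain ⟨h1, h2⟩ := hz j hjk
      rcases lt_trichotomy (z j) t with hlt | heq | hlt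
      · have := lt_of_le_of_cos_eq_zero hφ hpos (hc j) h1.1.le ht.2.le hlt h2.ge
        linarith
      · exact heq
      · have := lt_of_le_of_cos_eq_zero hφ hpos (hc j) ht.1.le h1.2.le hlt hφt.ge
        linarith
    · rintro ⟨j, hj, rfl⟩
      obtain ⟨h1, h2⟩ := hz j (by simpa using hj)
      exact ⟨h1, by rw [h2, hc]⟩
  have hinj : InjOn z (Finset.range k : Set ℕ) := by
    intro i hi j hj hij
    have h1 := (hz i (by simpa using hi)).2
    have h2 := (hz j (by simpa using hj)).2
    rw [hij, h2] at h1
    have h3 : (j : ℝ) = i := by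
      have : (2 * (j : ℝ) + 1) * Real.pi = (2 * (i : ℝ) + 1) * Real.pi := by linarith
      have := mul_right_cancel₀ hπ.ne' this
      linarith
    exact_mod_cast h3.symm
  rw [heq]
  exact ⟨(Finset.finite_toSet _).image z, by
    rw [hinj.ncard_image, Set.ncard_coe_finset, Finset.card_range]⟩

/-- A lower bound for the angle after `k + 1` zeros of the cosine. -/
lemma lt_of_many_zeros (hφ : ∀ t ∈ Icc α β, HasDerivAt φ (φ' t) t)
    (hpos : ∀ t ∈ Icc α β, Real.cos (φ t) = 0 → 0 < φ' t) {k : ℕ} (hα : φ α = 0) {z : ℕ → ℝ}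
    (hz : ∀ j < k + 1, z j ∈ Icc α β ∧ Real.cos (φ (z j)) = 0)
    (hmono : ∀ i j, i < j → j < k + 1 → z i < z j) : k * Real.pi < φ β := by
  have hπ := Real.pi_pos
  have key : ∀ j < k + 1, j * Real.pi + Real.pi / 2 ≤ φ (z j) := by
    intro j
    induction j with
    | zero =>
      intro h0
      obtain ⟨h1, h2⟩ := hz 0 h0
      obtain ⟨m, hm⟩ := Real.cos_eq_zero_iff.1 h2
      have h3 : -(Real.pi / 2) < φ (z 0) := by
        rcases h1.1.eq_or_lt with h | h
        · rw [← h, hα]; linarith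
        · exact lt_of_le_of_cos_eq_zero hφ hpos (by simp) le_rfl h1.2 h (by rw [hα]; linarith)
      have h4 : (-1 : ℝ) < m := by
        by_contra! hle
        nlinarith
      have h5 : (0 : ℤ) ≤ m := by
        have : (-1 : ℤ) < m := by exact_mod_cast h4
        linarith
      have h6 : (0 : ℝ) ≤ m := by exact_mod_cast h5
      rw [hm]; push_cast; nlinarith
    | succ j ih =>
      intro hj
      have h0 := ih (by omega)
      obtain ⟨h1, h2⟩ := hz j (by omega)
      obtain ⟨h3, h4⟩ := hz (j + 1) hj
      have h5 := lt_of_le_of_cos_eq_zero hφ hpos (c := j * Real.pi + Real.pi / 2)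
        (Real.cos_eq_zero_iff.2 ⟨j, by push_cast; ring⟩) h1.1 h3.2 (hmono j (j + 1) (by omega) hj) h0
      obtain ⟨m, hm⟩ := Real.cos_eq_zero_iff.1 h4
      have h6 : (j : ℝ) < m := by
        by_contra! hle
        nlinarith
      have h7 : (j : ℤ) + 1 ≤ m := by
        have : (j : ℤ) < m := by exact_mod_cast h6
        linarith
      have h8 : (j : ℝ) + 1 ≤ m := by exact_mod_cast h7
      rw [hm]; push_cast; nlinarith
  obtain ⟨h1, -⟩ := hz k (by omega)
  have h2 := key k (by omega)
  rcases h1.2.eq_or_lt with h | h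
  · rw [← h]; linarith
  · have := lt_of_le_of_cos_eq_zero hφ hpos (c := k * Real.pi + Real.pi / 2)
      (Real.cos_eq_zero_iff.2 ⟨k, by push_cast; ring⟩) h1.1 le_rfl h h2
    linarith

end Angle

/-- The angular velocity, in the phase plane, of solutions of `u' = v`, `v' = -(h v) - g(u)`. -/
noncomputable def angVel (h g u v : ℝ → ℝ) (t : ℝ) : ℝ :=
  (v t ^ 2 + u t * (h t * v t + g (u t))) / (u t ^ 2 + v t ^ 2)

section AngularVelocity

variable {h g u v φ : ℝ → ℝ} {α β : ℝ}

lemma abs_angVel_le {H L t : ℝ} (hL0 : 0 ≤ L) (hH : |h t| ≤ H) (hL : |g (u t)| ≤ L * |u t|) :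
    |angVel h g u v t| ≤ 1 + H + L := by
  have hH0 := (abs_nonneg _).trans hH
  rcases eq_or_ne (u t ^ 2 + v t ^ 2) 0 with h0 | h0
  · rw [angVel, h0, div_zero, abs_zero]; positivity
  have h1 : 0 < u t ^ 2 + v t ^ 2 := lt_of_le_of_ne (by positivity) h0.symm
  rw [angVel, abs_div, abs_of_pos h1, div_le_iff₀ h1]
  have h2 : |u t * (h t * v t)| ≤ H * (|u t| * |v t|) := by
    rw [abs_mul, abs_mul]
    have := mul_le_mul_of_nonneg_right hH (mul_nonneg (abs_nonneg (u t)) (abs_nonneg (v t)))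
    linarith
  have h3 : |u t * g (u t)| ≤ L * u t ^ 2 := by
    rw [abs_mul, ← sq_abs (u t)]
    have := mul_le_mul_of_nonneg_left hL (abs_nonneg (u t))
    linarith
  have h4 : |u t| * |v t| ≤ u t ^ 2 + v t ^ 2 := by
    rw [← sq_abs (u t), ← sq_abs (v t)]
    nlinarith [sq_nonneg (|u t| - |v t|), sq_nonneg |u t|, sq_nonneg |v t|]
  have h5 := mul_le_mul_of_nonneg_left h4 hH0
  have h6 : 0 ≤ L * v t ^ 2 := by positivity
  rw [mul_add, ← add_assoc]
  refine (abs_add_le _ _).trans ?_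
  refine (add_le_add_left (abs_add_le _ _) _).trans ?_
  rw [abs_of_nonneg (sq_nonneg (v t))]
  linarith [sq_nonneg (u t)]

lemma IsSolIcc.continuousOn_angVel (hs : IsSolIcc h g α β u v) (hh : ContinuousOn h (Icc α β))
    (hg : Continuous g) (hne : ∀ t ∈ Icc α β, u t ^ 2 + v t ^ 2 ≠ 0) :
    ContinuousOn (angVel h g u v) (Icc α β) := by
  have hu := hs.continuousOn_fst
  have hv := hs.continuousOn_snd
  exact ((hv.pow 2).add (hu.mul ((hh.mul hv).add (hg.comp_continuousOn hu)))).div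
    ((hu.pow 2).add (hv.pow 2)) hne

/-- The angle of a nontrivial solution, obtained by integrating the angular velocity. -/
lemma IsSolIcc.exists_angle (hs : IsSolIcc h g α β u v) (hαβ : α ≤ β)
    (hh : ContinuousOn h (Icc α β)) (hg : Continuous g)
    (hne : ∀ t ∈ Icc α β, u t ^ 2 + v t ^ 2 ≠ 0) {φ₀ : ℝ}
    (h0 : u α * Real.sin φ₀ + v α * Real.cos φ₀ = 0) :
    ∃ φ : ℝ → ℝ, (∀ t ∈ Icc α β, φ t = φ₀ + ∫ s in α..t, angVel h g u v s) ∧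
      (∀ t ∈ Icc α β, HasDerivAt φ (angVel h g u v t) t) ∧
      ∀ t ∈ Icc α β, u t * Real.sin (φ t) + v t * Real.cos (φ t) = 0 := by
  have hω := hs.continuousOn_angVel hh hg hne
  set ω := angVel h g u v with hω_def
  have hext : Continuous (IccExtend hαβ ((Icc α β).domRestrict ω)) :=
    continuous_IccExtend_iff.2 (continuousOn_iff_continuous_domRestrict.1 hω)
  have hexteq : ∀ t ∈ Icc α β, IccExtend hαβ ((Icc α β).domRestrict ω) t = ω t := fun t ht =>
    IccExtend_of_mem hαβ _ ht
  set φ : ℝ → ℝ := fun t => φ₀ + ∫ s in α..t, IccExtend hαβ ((Icc α β).domRestrict ω) s with hφ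
  have hφd : ∀ t ∈ Icc α β, HasDerivAt φ (ω t) t := by
    intro t ht
    rw [← hexteq t ht]
    exact (hext.integral_hasStrictDerivAt α t).hasDerivAt.const_add φ₀
  refine ⟨φ, fun t ht => ?_, hφd, ?_⟩
  · simp only [hφ]
    congr 1
    refine intervalIntegral.integral_congr fun s hs' => ?_
    rw [uIcc_of_le ht.1] at hs'
    exact hexteq s ⟨hs'.1, hs'.2.trans ht.2⟩
  set μ : ℝ → ℝ := fun t => v t * (u t - (h t * v t + g (u t))) / (u t ^ 2 + v t ^ 2) with hμ
  have hu := hs.continuousOn_fst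
  have hv := hs.continuousOn_snd
  have hμc : ContinuousOn μ (Icc α β) :=
    (hv.mul (hu.sub ((hh.mul hv).add (hg.comp_continuousOn hu)))).div
      ((hu.pow 2).add (hv.pow 2)) hne
  obtain ⟨M, hM⟩ := isCompact_Icc.exists_bound_of_continuousOn hμc
  simp only [Real.norm_eq_abs] at hM
  set X : ℝ → ℝ := fun t => u t * Real.sin (φ t) + v t * Real.cos (φ t) with hX
  have hXd : ∀ t ∈ Icc α β, HasDerivAt X (μ t * X t) t := by
    intro t ht
    obtain ⟨h1, h2⟩ := hs t ht
    refine ((h1.mul (hφd t ht).sin).add (h2.mul (hφd t ht).cos)).congr_deriv ?_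
    have hn := hne t ht
    simp only [hX, hμ, hω_def, angVel]
    field_simp
    ring
  have hsq : ∀ t ∈ Icc α β, X t ^ 2 ≤ X α ^ 2 * Real.exp (2 * M * |t - α|) := fun t ht =>
    gronwall_two_sided (D := fun t => X t ^ 2) (L := 2 * M) (α := α) (β := β)
    (fun t ht => (hXd t ht).pow 2) (fun t ht => by
      have h1 : |(2 : ℕ) * X t ^ (2 - 1) * (μ t * X t)| = 2 * |μ t| * X t ^ 2 := by
        rw [show ((2 : ℕ) : ℝ) * X t ^ (2 - 1) * (μ t * X t) = 2 * μ t * X t ^ 2 by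
          push_cast; ring, abs_mul, abs_mul, abs_two, abs_of_nonneg (sq_nonneg (X t))]
      rw [h1]
      exact mul_le_mul_of_nonneg_right (by linarith [hM t ht]) (sq_nonneg _))
    (left_mem_Icc.2 hαβ) ht
  have hX0 : X α = 0 := by
    simp only [hX, hφ, intervalIntegral.integral_same, add_zero]
    exact h0
  intro t ht
  have h1 := hsq t ht
  rw [hX0] at h1
  have h2 : X t ^ 2 ≤ 0 := by simpa using h1
  exact pow_eq_zero_iff (two_ne_zero) |>.1 (le_antisymm h2 (sq_nonneg _))

lemma eq_zero_iff_cos_eq_zero {x y θ : ℝ} (hne : x ^ 2 + y ^ 2 ≠ 0)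
    (hθ : x * Real.sin θ + y * Real.cos θ = 0) : x = 0 ↔ Real.cos θ = 0 := by
  constructor
  · rintro rfl
    have hy : y ≠ 0 := by rintro rfl; simp at hne
    simpa [hy] using hθ
  · intro hc
    have hs : Real.sin θ ≠ 0 := by
      intro hs
      have := Real.sin_sq_add_cos_sq θ
      rw [hs, hc] at this; norm_num at this
    simpa [hc, hs] using hθ

lemma angVel_pos {t : ℝ} (hg0 : g 0 = 0) (hne : u t ^ 2 + v t ^ 2 ≠ 0) (hu : u t = 0) :
    0 < angVel h g u v t := by
  rw [hu] at hne
  have h1 : v t ^ 2 ≠ 0 := by simpa using hne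
  rw [angVel, hu, hg0]
  simp [div_self h1]

/-- Continuous dependence of the total angle on the solution. -/
lemma tendsto_integral_angVel {ι : Type*} {l : Filter ι} [l.IsCountablyGenerated]
    {U V : ι → ℝ → ℝ} {B : ℝ} (hαβ : α ≤ β) (hg : Continuous g)
    (hc : ∀ᶠ i in l, ContinuousOn (angVel h g (U i) (V i)) (Icc α β))
    (hB : ∀ᶠ i in l, ∀ t ∈ Icc α β, |angVel h g (U i) (V i) t| ≤ B)
    (hU : ∀ t ∈ Icc α β, Tendsto (fun i => U i t) l (nhds (u t)))
    (hV : ∀ t ∈ Icc α β, Tendsto (fun i => V i t) l (nhds (v t)))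
    (hne : ∀ t ∈ Icc α β, u t ^ 2 + v t ^ 2 ≠ 0) :
    Tendsto (fun i => ∫ s in α..β, angVel h g (U i) (V i) s) l
      (nhds (∫ s in α..β, angVel h g u v s)) := by
  have hsub : uIoc α β ⊆ Icc α β := by rw [uIoc_of_le hαβ]; exact Ioc_subset_Icc_self
  refine intervalIntegral.tendsto_integral_filter_of_dominated_convergence (fun _ => B) ?_ ?_
    intervalIntegrable_const ?_
  · filter_upwards [hc] with i hi
    exact (hi.mono hsub).aestronglyMeasurable measurableSet_uIoc
  · filter_upwards [hB] with i hi
    exact Eventually.of_forall fun t ht => hi t (hsub ht)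
  · refine Eventually.of_forall fun t ht => ?_
    have h1 := hU t (hsub ht)
    have h2 := hV t (hsub ht)
    exact ((h2.pow 2).add (h1.mul ((h2.const_mul _).add ((hg.tendsto _).comp h1)))).div
      ((h1.pow 2).add (h2.pow 2)) (hne t (hsub ht))

end AngularVelocity

section Shooting

variable {lam q : ℝ}

lemma tendsto_of_sub_sq_le {ι : Type*} {l : Filter ι} {x ε : ι → ℝ} {x₀ : ℝ}
    (hε : Tendsto ε l (nhds 0)) (h : ∀ᶠ i in l, (x i - x₀) ^ 2 ≤ ε i) :
    Tendsto x l (nhds x₀) := by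
  have h1 : Tendsto (fun i => Real.sqrt (ε i)) l (nhds 0) := by
    have := (Real.continuous_sqrt.tendsto 0).comp hε
    rwa [Real.sqrt_zero] at this
  rw [tendsto_iff_dist_tendsto_zero]
  refine squeeze_zero' (Eventually.of_forall fun _ => dist_nonneg) ?_ h1
  filter_upwards [h] with i hi
  rw [Real.dist_eq]
  exact Real.abs_le_sqrt hi

lemma isSolIcc_zero (h : ℝ → ℝ) (α β : ℝ) :
    IsSolIcc h (nlTerm lam q) α β (fun _ => 0) (fun _ => 0) := fun t _ =>
  ⟨hasDerivAt_const t 0, by simpa [nlTerm_zero] using hasDerivAt_const t (0 : ℝ)⟩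

lemma isSolIcc_one (h : ℝ → ℝ) (α β : ℝ) :
    IsSolIcc h (nlTerm lam q) α β (fun _ => 1) (fun _ => 0) := fun t _ =>
  ⟨hasDerivAt_const t 1, by simpa [nlTerm_one] using hasDerivAt_const t (0 : ℝ)⟩

/-- A solution that is nontrivial at one point is nontrivial everywhere. -/
lemma IsSolIcc.sq_add_sq_ne_zero (hlam : 0 < lam) (hq : 1 < q) {h u v : ℝ → ℝ} {α β : ℝ}
    (hs : IsSolIcc h (nlTerm lam q) α β u v) (hh : ContinuousOn h (Icc α β)) {s : ℝ}
    (hsI : s ∈ Icc α β) (hne : u s ^ 2 + v s ^ 2 ≠ 0) :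
    ∀ t ∈ Icc α β, u t ^ 2 + v t ^ 2 ≠ 0 := by
  intro t ht h0
  obtain ⟨H, hH⟩ := isCompact_Icc.exists_bound_of_continuousOn hh
  obtain ⟨R, hR⟩ := isCompact_Icc.exists_bound_of_continuousOn hs.continuousOn_fst
  simp only [Real.norm_eq_abs] at hH hR
  have hR0 : 0 ≤ R := (abs_nonneg _).trans (hR s hsI)
  obtain ⟨L, hL0, hL⟩ := exists_lipschitz_nlTerm hlam hq hR0
  have h1 := hs.dist_sq_le (isSolIcc_zero h α β) hL0.le hH
    (fun x hx => hL _ _ (hR x hx) (by simpa using hR0)) ht hsI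
  simp only [sub_zero, h0, zero_mul] at h1
  exact hne (le_antisymm h1 (by positivity))

lemma shooting (hlam : 0 < lam) (hq : 1 < q) {h : ℝ → ℝ} {α' α β β' : ℝ} (hα : α' < α)
    (hαβ : α ≤ β) (hβ : β < β') (hh : ContinuousOn h (Icc α' β')) {A : ℝ} (hA : 1 ≤ A) {k : ℕ}
    (hosc : ∀ u v : ℝ → ℝ, IsSolIcc h (nlTerm lam q) α β u v → v α = 0 → u α = A →
      ∃ z : ℕ → ℝ, (∀ j < k + 1, z j ∈ Icc α β ∧ u (z j) = 0) ∧
        ∀ i j, i < j → j < k + 1 → z i < z j) :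
    ∃ u v φ : ℝ → ℝ, IsSolIcc h (nlTerm lam q) α β u v ∧ u α ∈ Icc 1 A ∧ v α = 0 ∧ v β = 0 ∧
      (∀ t ∈ Icc α β, u t ^ 2 + v t ^ 2 ≠ 0) ∧ φ α = 0 ∧ φ β = k * Real.pi ∧
      (∀ t ∈ Icc α β, φ t = φ α + ∫ s in α..t, angVel h (nlTerm lam q) u v s) ∧
      (∀ t ∈ Icc α β, HasDerivAt φ (angVel h (nlTerm lam q) u v t) t) ∧
      ∀ t ∈ Icc α β, u t * Real.sin (φ t) + v t * Real.cos (φ t) = 0 := by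
  have hg : Continuous (nlTerm lam q) := continuous_nlTerm hq
  have hh' : ContinuousOn h (Icc α β) := hh.mono (Icc_subset_Icc hα.le hβ.le)
  have hαI : α ∈ Icc α β := left_mem_Icc.2 hαβ
  have hβI : β ∈ Icc α β := right_mem_Icc.2 hαβ
  obtain ⟨R, hR⟩ := exists_isSolIcc hlam hq hα hαβ hβ hh A
  obtain ⟨H, hH⟩ := isCompact_Icc.exists_bound_of_continuousOn hh'
  simp only [Real.norm_eq_abs] at hH
  have hR' : ∀ a : ℝ, ∃ u v : ℝ → ℝ, a ∈ Icc 1 A → IsSolIcc h (nlTerm lam q) α β u v ∧ u α = a ∧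
      v α = 0 ∧ ∀ t ∈ Icc α β, |u t| ≤ R ∧ |v t| ≤ R := by
    intro a
    by_cases ha : a ∈ Icc 1 A
    · obtain ⟨u, v, huv⟩ := hR a (by rw [abs_of_nonneg (by linarith [ha.1])]; exact ha.2)
      exact ⟨u, v, fun _ => huv⟩
    · exact ⟨0, 0, fun h => absurd h ha⟩
  choose U V hUV using hR'
  have hR1 : 1 ≤ R := by
    obtain ⟨-, h1, -, h2⟩ := hUV 1 ⟨le_rfl, hA⟩
    simpa [h1] using (h2 α hαI).1
  obtain ⟨L, hL0, hL⟩ := exists_lipschitz_nlTerm hlam hq (by linarith : 0 ≤ R)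
  have hgL : ∀ x, |x| ≤ R → |nlTerm lam q x| ≤ L * |x| := fun x hx => by
    simpa [nlTerm_zero] using hL x 0 hx (by simp; linarith)
  have hne : ∀ a ∈ Icc 1 A, ∀ t ∈ Icc α β, U a t ^ 2 + V a t ^ 2 ≠ 0 := by
    intro a ha
    obtain ⟨h1, h2, h3, -⟩ := hUV a ha
    refine h1.sq_add_sq_ne_zero hlam hq hh' hαI ?_
    rw [h2, h3]
    have := ha.1
    positivity
  have hang : ∀ a ∈ Icc 1 A, ∃ φ : ℝ → ℝ,
      (∀ t ∈ Icc α β, φ t = 0 + ∫ s in α..t, angVel h (nlTerm lam q) (U a) (V a) s) ∧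
      (∀ t ∈ Icc α β, HasDerivAt φ (angVel h (nlTerm lam q) (U a) (V a) t) t) ∧
      ∀ t ∈ Icc α β, U a t * Real.sin (φ t) + V a t * Real.cos (φ t) = 0 := by
    intro a ha
    obtain ⟨h1, h2, h3, -⟩ := hUV a ha
    exact h1.exists_angle hαβ hh' hg (hne a ha) (by simp [h3])
  set Φ : ℝ → ℝ := fun a => ∫ s in α..β, angVel h (nlTerm lam q) (U a) (V a) s with hΦ
  have hΦc : ContinuousOn Φ (Icc 1 A) := by
    intro a ha
    obtain ⟨h1, h2, h3, h4⟩ := hUV a ha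
    have hdist : ∀ t ∈ Icc α β, Tendsto (fun b => U b t) (nhdsWithin a (Icc 1 A)) (nhds (U a t)) ∧
        Tendsto (fun b => V b t) (nhdsWithin a (Icc 1 A)) (nhds (V a t)) := by
      intro t ht
      have hε : Tendsto (fun b => (b - a) ^ 2 * Real.exp ((1 + 2 * H + L) * |t - α|))
          (nhdsWithin a (Icc 1 A)) (nhds 0) := by
        have : Continuous fun b => (b - a) ^ 2 * Real.exp ((1 + 2 * H + L) * |t - α|) := by
          fun_prop
        simpa using (this.tendsto a).mono_left nhdsWithin_le_nhds
      have hle : ∀ b ∈ Icc 1 A, (U b t - U a t) ^ 2 + (V b t - V a t) ^ 2 ≤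
          (b - a) ^ 2 * Real.exp ((1 + 2 * H + L) * |t - α|) := by
        intro b hb
        obtain ⟨k1, k2, k3, k4⟩ := hUV b hb
        have := k1.dist_sq_le h1 hL0.le hH (fun x hx => hL _ _ (k4 x hx).1 (h4 x hx).1) hαI ht
        rw [k2, k3, h2, h3] at this
        simpa using this
      constructor
      · refine tendsto_of_sub_sq_le hε ?_
        filter_upwards [self_mem_nhdsWithin] with b hb
        linarith [hle b hb, sq_nonneg (V b t - V a t)]
      · refine tendsto_of_sub_sq_le hε ?_
        filter_upwards [self_mem_nhdsWithin] with b hb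
        linarith [hle b hb, sq_nonneg (U b t - U a t)]
    refine tendsto_integral_angVel (B := 1 + H + L) hαβ hg ?_ ?_ (fun t ht => (hdist t ht).1)
      (fun t ht => (hdist t ht).2) (hne a ha)
    · filter_upwards [self_mem_nhdsWithin] with b hb
      exact (hUV b hb).1.continuousOn_angVel hh' hg (hne b hb)
    · filter_upwards [self_mem_nhdsWithin] with b hb
      exact fun t ht => abs_angVel_le hL0.le (hH t ht) (hgL _ ((hUV b hb).2.2.2 t ht).1)
  have hΦ1 : Φ 1 = 0 := by
    obtain ⟨h1, h2, h3, h4⟩ := hUV 1 ⟨le_rfl, hA⟩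
    have hz : ∀ t ∈ Icc α β, angVel h (nlTerm lam q) (U 1) (V 1) t = 0 := by
      intro t ht
      have := h1.dist_sq_le (isSolIcc_one h α β) hL0.le hH
        (fun x hx => hL _ _ (h4 x hx).1 (by simpa using hR1)) hαI ht
      simp only [h2, h3, sub_self, sub_zero] at this
      have h5 : (U 1 t - 1) ^ 2 + V 1 t ^ 2 ≤ 0 := by simpa using this
      have h6 : U 1 t = 1 := by nlinarith [sq_nonneg (U 1 t - 1), sq_nonneg (V 1 t)]
      have h7 : V 1 t = 0 := by nlinarith [sq_nonneg (U 1 t - 1), sq_nonneg (V 1 t)]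
      simp [angVel, h6, h7, nlTerm_one]
    have : Φ 1 = ∫ _ in α..β, (0 : ℝ) := by
      refine intervalIntegral.integral_congr fun t ht => ?_
      rw [uIcc_of_le hαβ] at ht
      exact hz t ht
    simpa using this
  have hΦA : k * Real.pi < Φ A := by
    have hAI : A ∈ Icc 1 A := ⟨hA, le_rfl⟩
    obtain ⟨h1, h2, h3, -⟩ := hUV A hAI
    obtain ⟨φ, k1, k2, k3⟩ := hang A hAI
    obtain ⟨z, hz, hmono⟩ := hosc _ _ h1 h3 h2
    have hiff : ∀ t ∈ Icc α β, U A t = 0 ↔ Real.cos (φ t) = 0 := fun t ht =>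
      eq_zero_iff_cos_eq_zero (hne A hAI t ht) (k3 t ht)
    have := lt_of_many_zeros k2
      (fun t ht hc => angVel_pos nlTerm_zero (hne A hAI t ht) ((hiff t ht).2 hc))
      (by rw [k1 α hαI]; simp) (fun j hj => ⟨(hz j hj).1, (hiff _ (hz j hj).1).1 (hz j hj).2⟩) hmono
    rwa [k1 β hβI, zero_add] at this
  have hkπ : (0 : ℝ) ≤ k * Real.pi := by positivity
  obtain ⟨a, ha, hΦa⟩ := intermediate_value_Icc hA hΦc (show k * Real.pi ∈ Icc (Φ 1) (Φ A) from
    ⟨by rw [hΦ1]; exact hkπ, hΦA.le⟩)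
  obtain ⟨h1, h2, h3, -⟩ := hUV a ha
  obtain ⟨φ, k1, k2, k3⟩ := hang a ha
  have hφα : φ α = 0 := by rw [k1 α hαI]; simp
  have hφβ : φ β = k * Real.pi := by rw [k1 β hβI, zero_add, ← hΦa]
  refine ⟨U a, V a, φ, h1, by rwa [h2], h3, ?_, hne a ha, hφα, hφβ, by rwa [hφα], k2, k3⟩
  have h5 := k3 β hβI
  rw [hφβ, Real.sin_nat_mul_pi, mul_zero, zero_add] at h5
  refine (mul_eq_zero.1 h5).resolve_right fun hc => ?_
  have := Real.sin_sq_add_cos_sq (k * Real.pi)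
  rw [hc, Real.sin_nat_mul_pi] at this
  norm_num at this

end Shooting

/-- Neumann solutions starting close to the origin from a value at least `A` in modulus have `K`
zeros in `[τ / 2, τ]`, for some `τ ≤ c`. -/
def LargeOscillate (h : ℝ → ℝ) (lam q : ℝ) (K : ℕ) (c : ℝ) : Prop :=
  ∃ τ ∈ Ioc 0 c, ∃ A, 1 ≤ A ∧ ∀ δ ∈ Ioc 0 (τ / 2), ∀ u v : ℝ → ℝ,
    IsSolIcc h (nlTerm lam q) δ τ u v → v δ = 0 → A ≤ |u δ| →
      ∃ z : ℕ → ℝ, (∀ j < K, z j ∈ Icc (τ / 2) τ ∧ u (z j) = 0) ∧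
        ∀ i j, i < j → j < K → z i < z j

section Bounds

variable {lam q : ℝ} {h P : ℝ → ℝ} {c : ℝ}

lemma largeOscillate_of_tendsto (hlam : 0 < lam) (hq : 1 < q) {ν₀ : ℝ} (hν₀ : 1 ≤ ν₀)
    (hsub : q * (ν₀ - 1) < ν₀ + 3)
    (hlim : Tendsto (fun t => t * h t) (nhdsWithin 0 (Ioi 0)) (nhds ν₀)) (hc : 0 < c)
    (hP : ∀ t ∈ Ioc 0 c, HasDerivAt P (h t) t) (K : ℕ) : LargeOscillate h lam q K c := by
  set η := min 1 ((ν₀ + 3 - q * (ν₀ - 1)) / (2 * (q + 3))) with hη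
  have hη0 : 0 < η := lt_min one_pos (div_pos (by linarith) (by linarith))
  have hη1 : η ≤ 1 := min_le_left _ _
  have hη2 : η * (q + 3) < ν₀ + 3 - q * (ν₀ - 1) := by
    have h1 : η ≤ (ν₀ + 3 - q * (ν₀ - 1)) / (2 * (q + 3)) := min_le_right _ _
    rw [le_div_iff₀ (by linarith)] at h1
    nlinarith
  have hev : ∀ᶠ t in nhdsWithin (0 : ℝ) (Ioi 0), t * h t ∈ Ioo (ν₀ - η) (ν₀ + η) :=
    hlim.eventually (Ioo_mem_nhds (by linarith) (by linarith))
  obtain ⟨τ₀, hτ₀, hsubset⟩ := mem_nhdsGT_iff_exists_Ioc_subset.1 hev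
  have hτ₀' : (0 : ℝ) < τ₀ := hτ₀
  set τ := min τ₀ c with hτ
  have hτ0 : 0 < τ := lt_min hτ₀' hc
  have hsub' : (ν₀ + η - 1) / 2 < (1 + (ν₀ - η)) / (q + 1) := by
    rw [div_lt_div_iff₀ two_pos (by linarith)]
    nlinarith
  obtain ⟨A, hA, hosc⟩ := exists_many_zeros hlam hq hτ0 (ν := ν₀ + η) (θ := ν₀ - η) (by linarith)
    (by linarith) (by linarith) hsub'
    (fun t ht => hP t ⟨ht.1, ht.2.trans (min_le_right _ _)⟩)
    (fun t ht => by
      have := hsubset ⟨ht.1, ht.2.trans (min_le_left _ _)⟩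
      exact ⟨this.1.le, this.2.le⟩) K
  exact ⟨τ, ⟨hτ0, min_le_right _ _⟩, A, hA, hosc⟩

/-- Bounds for Neumann solutions that do not depend on the left end point. -/
lemma exists_bound_of_neumann (hlam : 0 < lam) (hq : 1 < q)
    (hP : ∀ t ∈ Ioc 0 c, HasDerivAt P (h t) t) (hpos : ∀ t ∈ Ioc 0 c, 0 ≤ h t) {A : ℝ}
    (hA : 0 ≤ A) :
    ∃ R, 1 ≤ R ∧ ∀ δ ∈ Ioo 0 c, ∀ u v : ℝ → ℝ, IsSolIcc h (nlTerm lam q) δ c u v → v δ = 0 →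
      |u δ| ≤ A → ∀ t ∈ Icc δ c, |u t| ≤ R ∧ |v t| ≤ R ∧ |v t| ≤ R * t := by
  obtain ⟨C, hC0, hC⟩ := exists_half_sq_le_nlPot hlam hq
  set E := lam * (A ^ (q + 1) / (q + 1)) + C with hE
  have hE0 : 0 ≤ E := by positivity
  set R₀ := 2 * E + 1 with hR₀
  have hR₀1 : 1 ≤ R₀ := by linarith
  set S := lam * R₀ ^ q with hS
  have hS0 : 0 ≤ S := by positivity
  refine ⟨max R₀ S, hR₀1.trans (le_max_left _ _), fun δ hδ u v hs hv hu => ?_⟩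
  have hsubI : ∀ t ∈ Icc δ c, t ∈ Ioc 0 c := fun t ht => ⟨hδ.1.trans_le ht.1, ht.2⟩
  have hb : ∀ t ∈ Icc δ c, |u t| ≤ R₀ ∧ |v t| ≤ R₀ := by
    intro t ht
    have h1 := hs.antitoneOn_energy hq (fun t ht => hpos t (hsubI t ht)) (left_mem_Icc.2 hδ.2.le)
      ht ht.1
    simp only [hv] at h1
    have h2 := nlPot_le_of_abs_le hlam hq hu
    have h3 := hC (u t)
    constructor <;> refine abs_le_of_sq_le_sq ?_ (by linarith) <;>
      nlinarith [sq_nonneg (u t), sq_nonneg (v t)]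
  intro t ht
  have ht' := hsubI t ht
  refine ⟨(hb t ht).1.trans (le_max_left _ _), (hb t ht).2.trans (le_max_left _ _), ?_⟩
  have h1 := hs.abs_snd_le (fun t ht => hP t (hsubI t ht)) (fun t ht => hpos t (hsubI t ht)) hv
    (fun x hx => abs_nlTerm_le hlam hq hR₀1 (hb x hx).1) ht
  refine h1.trans ?_
  have h2 := mul_le_mul_of_nonneg_right (le_max_right R₀ S) ht'.1.le
  have h3 := mul_nonneg hS0 hδ.1.le
  linarith

/-- Near the end point a Neumann solution is comparable to its boundary value. -/
lemma exists_near_neumann (hlam : 0 < lam) (hq : 1 < q) (hc : 0 < c)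
    (hP : ∀ t ∈ Ioc 0 c, HasDerivAt P (h t) t) (hpos : ∀ t ∈ Ioc 0 c, 0 ≤ h t) {R : ℝ}
    (hR : 0 ≤ R) :
    ∃ s ∈ Ioo 0 c, ∃ W, 0 < W ∧ ∀ δ ∈ Ioo 0 s, ∀ u v : ℝ → ℝ,
      IsSolIcc h (nlTerm lam q) δ c u v → v δ = 0 → (∀ t ∈ Icc δ c, |u t| ≤ R) →
        (∀ t ∈ Icc δ s, |u δ| / 2 ≤ |u t|) ∧ u s ^ 2 + v s ^ 2 ≤ W * u δ ^ 2 := by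
  obtain ⟨L, hL0, hL⟩ := exists_lipschitz_nlTerm hlam hq hR
  set s := min (c / 2) (1 / (L + 3)) with hs_def
  have hs0 : 0 < s := lt_min (by linarith) (by positivity)
  have hsc : s ≤ c / 2 := min_le_left _ _
  have hsL : L * s ^ 2 ≤ 1 / 3 := by
    have h1 : s ≤ 1 / (L + 3) := min_le_right _ _
    rw [le_div_iff₀ (by linarith)] at h1
    have h2 : (s * (L + 3)) ^ 2 ≤ 1 := pow_le_one₀ (by positivity) h1
    nlinarith [sq_nonneg s, sq_nonneg (s * L)]
  refine ⟨s, ⟨hs0, by linarith⟩, 9 / 4 + (3 / 2 * L * s) ^ 2, by positivity,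
    fun δ hδ u v hs hv hu => ?_⟩
  have hIs : ∀ t ∈ Icc δ s, t ∈ Icc δ c := fun t ht => ⟨ht.1, by linarith [ht.2]⟩
  have hI : ∀ t ∈ Icc δ s, t ∈ Ioc 0 c := fun t ht => ⟨hδ.1.trans_le ht.1, by linarith [ht.2]⟩
  have key : ∀ t ∈ Icc δ s, |u t - u δ| ≤ |u δ| / 2 ∧ |v t| ≤ 3 / 2 * L * |u δ| * (t - δ) :=
    fun t ht => (hs.mono le_rfl (by linarith : s ≤ c)).near_endpoint (fun t ht => hP t (hI t ht))
      (fun t ht => hpos t (hI t ht)) hv hL0.le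
      (fun x hx => by simpa [nlTerm_zero] using hL (u x) 0 (hu x (hIs x hx)) (by simpa using hR))
      hsL (by linarith [hδ.1]) ht
  constructor
  · intro t ht
    have h1 := (key t ht).1
    have h2 := abs_sub_abs_le_abs_sub (u δ) (u t)
    rw [abs_sub_comm] at h2
    linarith
  · obtain ⟨h1, h2⟩ := key s ⟨hδ.2.le, le_rfl⟩
    have h3 := abs_sub_abs_le_abs_sub (u s) (u δ)
    have h4 : |u s| ≤ 3 / 2 * |u δ| := by linarith
    have h5 : |v s| ≤ 3 / 2 * L * s * |u δ| := by
      refine h2.trans ?_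
      have h6 : 0 ≤ 3 / 2 * L * |u δ| := by positivity
      have h7 := mul_le_mul_of_nonneg_left (by linarith [hδ.1] : s - δ ≤ s) h6
      linarith
    have h8 := pow_le_pow_left₀ (abs_nonneg _) h4 2
    have h9 := pow_le_pow_left₀ (abs_nonneg _) h5 2
    rw [sq_abs, mul_pow, sq_abs] at h8 h9
    linarith

end Bounds

section Approximation

variable {lam q : ℝ} {h P : ℝ → ℝ} {c d : ℝ}

/-- While `cos ∘ φ` does not vanish, an angle starting in `(-π/2, π/2)` stays there. -/
lemma lt_add_pi_div_two_of_cos_ne_zero {φ : ℝ → ℝ} {s t x : ℝ} (hst : s ≤ t)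
    (hφ : ContinuousOn φ (Icc s t)) (hx : Real.cos x = 0) (hne : ∀ y ∈ Icc s t, Real.cos (φ y) ≠ 0)
    (hs : φ s < x) : φ t < x := by
  by_contra! hle
  obtain ⟨y, hy, hyx⟩ := intermediate_value_Icc hst hφ ⟨hs.le, hle⟩
  exact hne y hy (by rw [hyx, hx])

/-- The boundary value at the right end of a shooting solution is bounded. -/
lemma abs_right_value_lt {k : ℕ} {T δ B τ : ℝ} {u v φ : ℝ → ℝ} (hδ : δ ∈ Ioc 0 (τ / 2))
    (hT : T = d - δ) (hτd : τ ≤ d - δ)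
    (hB : ∀ δ ∈ Ioc 0 (τ / 2), ∀ u v : ℝ → ℝ,
      IsSolIcc (fun t => -h (d - t)) (nlTerm lam q) δ τ u v → v δ = 0 → B ≤ |u δ| →
      ∃ z : ℕ → ℝ, (∀ j < k + 1, z j ∈ Icc (τ / 2) τ ∧ u (z j) = 0) ∧
        ∀ i j, i < j → j < k + 1 → z i < z j)
    (hs : IsSolIcc h (nlTerm lam q) δ T u v) (hv : v T = 0)
    (hne : ∀ t ∈ Icc δ T, u t ^ 2 + v t ^ 2 ≠ 0) (hφδ : φ δ = 0) (hφT : φ T = k * Real.pi)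
    (hφ : ∀ t ∈ Icc δ T, HasDerivAt φ (angVel h (nlTerm lam q) u v t) t)
    (hang : ∀ t ∈ Icc δ T, u t * Real.sin (φ t) + v t * Real.cos (φ t) = 0) : |u T| < B := by
  by_contra! hle
  subst hT
  have h1 := hs.reflect d
  rw [sub_sub_cancel] at h1
  obtain ⟨z, hz, hmono⟩ := hB δ hδ _ _ (h1.mono le_rfl hτd) (by simp [hv]) hle
  have hiff : ∀ t ∈ Icc δ (d - δ), u t = 0 ↔ Real.cos (φ t) = 0 := fun t ht =>
    eq_zero_iff_cos_eq_zero (hne t ht) (hang t ht)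
  have hlt := lt_of_many_zeros hφ
    (fun t ht hc => angVel_pos nlTerm_zero (hne t ht) ((hiff t ht).2 hc)) hφδ (k := k)
    (z := fun j => d - z (k - j)) (fun j hj => by
      obtain ⟨h2, h3⟩ := hz (k - j) (by omega)
      have h4 : d - z (k - j) ∈ Icc δ (d - δ) :=
        ⟨by linarith [h2.2], by linarith [h2.1, hδ.2]⟩
      exact ⟨h4, (hiff _ h4).1 h3⟩)
    (fun i j hij hj => by
      have := hmono (k - j) (k - i) (by omega) (by omega)
      linarith)
  linarith

/-- Approximate solutions with bounds independent of the distance `δ` to the end points. -/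
lemma exists_approximants (hlam : 0 < lam) (hq : 1 < q) (hc : c ∈ Ioo 0 d)
    (hh : ContinuousOn h (Ioo 0 d)) (hP : ∀ t ∈ Ioo 0 d, HasDerivAt P (h t) t)
    (hpos : ∀ t ∈ Ioc 0 c, 0 ≤ h t) (hneg : ∀ t ∈ Ico c d, h t ≤ 0) {k : ℕ}
    (hl : LargeOscillate h lam q (k + 1) c)
    (hr : LargeOscillate (fun t => -h (d - t)) lam q (k + 1) (d - c)) :
    ∃ R m s₁ s₂ δ₀ : ℝ, 0 < m ∧ s₁ ≤ s₂ ∧ 0 < δ₀ ∧ δ₀ ≤ s₁ ∧ s₂ ≤ d - δ₀ ∧ ∀ δ ∈ Ioo 0 δ₀,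
      ∃ (u v : ℝ → ℝ) (θ : ℝ), IsSolIcc h (nlTerm lam q) δ (d - δ) u v ∧
        (∀ t ∈ Icc δ (d - δ), |u t| ≤ R ∧ |v t| ≤ R * t ∧ |v t| ≤ R * (d - t)) ∧
        (∀ t ∈ Icc δ s₁, m ≤ |u t|) ∧ (∀ t ∈ Icc s₂ (d - δ), m ≤ |u t|) ∧
        θ ∈ Icc (-(Real.pi / 2)) (Real.pi / 2) ∧
        u s₁ * Real.sin θ + v s₁ * Real.cos θ = 0 ∧
        θ + ∫ s in s₁..s₂, angVel h (nlTerm lam q) u v s ∈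
          Icc (k * Real.pi - Real.pi / 2) (k * Real.pi + Real.pi / 2) := by
  obtain ⟨hc0, hcd⟩ := hc
  obtain ⟨τ₁, ⟨hτ₁0, hτ₁⟩, A, hA, hoscA⟩ := hl
  obtain ⟨τ₂, ⟨hτ₂0, hτ₂⟩, B, hB, hoscB⟩ := hr
  have hPl : ∀ t ∈ Ioc 0 c, HasDerivAt P (h t) t := fun t ht => hP t ⟨ht.1, ht.2.trans_lt hcd⟩
  have hPr : ∀ t ∈ Ioc 0 (d - c), HasDerivAt (fun t => P (d - t)) (-h (d - t)) t := fun t ht =>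
    (hP (d - t) ⟨by linarith [ht.2], by linarith [ht.1]⟩).comp_const_sub d t
  have hposr : ∀ t ∈ Ioc 0 (d - c), 0 ≤ -h (d - t) := fun t ht =>
    neg_nonneg.2 (hneg _ ⟨by linarith [ht.2], by linarith [ht.1]⟩)
  obtain ⟨R₁, hR₁1, hR₁⟩ := exists_bound_of_neumann hlam hq hPl hpos (by linarith : 0 ≤ A)
  obtain ⟨R₂, hR₂1, hR₂⟩ := exists_bound_of_neumann hlam hq hPr hposr (by linarith : 0 ≤ B)
  obtain ⟨s₁, ⟨hs₁0, hs₁c⟩, W₁, -, hnear₁⟩ :=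
    exists_near_neumann hlam hq hc0 hPl hpos (by linarith : 0 ≤ R₁)
  obtain ⟨s, ⟨hs0, hsc⟩, W, hW0, hnear₂⟩ :=
    exists_near_neumann hlam hq (sub_pos.2 hcd) hPr hposr (by linarith : 0 ≤ R₂)
  set s₂ := d - s with hs₂
  have hs₁₂ : s₁ ≤ s₂ := by linarith
  have hIcc : Icc s₁ s₂ ⊆ Ioo 0 d := fun t ht =>
    ⟨hs₁0.trans_le ht.1, by linarith [ht.2]⟩
  obtain ⟨H, hH⟩ := isCompact_Icc.exists_bound_of_continuousOn (hh.mono hIcc)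
  simp only [Real.norm_eq_abs] at hH
  set R := R₁ + R₂ with hR
  obtain ⟨L, hL0, hL⟩ := exists_lipschitz_nlTerm hlam hq (by linarith : 0 ≤ R)
  set e := Real.exp ((1 + 2 * H + L) * |s₁ - s₂|) with he
  have he0 : 0 < e := Real.exp_pos _
  set m := min (1 / 2) (Real.sqrt (1 / (16 * (W * e)))) with hm
  have hm0 : 0 < m := lt_min (by norm_num) (Real.sqrt_pos.2 (by positivity))
  have hRc : 0 ≤ R / c := div_nonneg (by linarith) hc0.le
  have hRd : 0 ≤ R / (d - c) := div_nonneg (by linarith) (sub_pos.2 hcd).le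
  set δ₀ := min (min (τ₁ / 2) (τ₂ / 2)) (min s₁ s) with hδ₀
  have hδ₀0 : 0 < δ₀ := lt_min (lt_min (by linarith) (by linarith)) (lt_min hs₁0 hs0)
  have hδ₀1 : δ₀ ≤ τ₁ / 2 := (min_le_left _ _).trans (min_le_left _ _)
  have hδ₀2 : δ₀ ≤ τ₂ / 2 := (min_le_left _ _).trans (min_le_right _ _)
  have hδ₀3 : δ₀ ≤ s₁ := (min_le_right _ _).trans (min_le_left _ _)
  have hδ₀4 : δ₀ ≤ s := (min_le_right _ _).trans (min_le_right _ _)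
  refine ⟨R + R / c + R / (d - c), m, s₁, s₂, δ₀, hm0, hs₁₂, hδ₀0, hδ₀3, by linarith,
    fun δ hδ => ?_⟩
  obtain ⟨hδ0, hδδ⟩ := hδ
  have hδc : δ < c := by linarith
  have hδcd : δ < d - c := by linarith
  obtain ⟨u, v, φ, hs, hua, hvα, hvβ, hne, hφα, hφβ, hφint, hφd, hang⟩ :=
    shooting hlam hq (h := h) (α' := δ / 2) (α := δ) (β := d - δ) (β' := d - δ / 2) (A := A)
      (k := k) (by linarith) (by linarith) (by linarith)
      (hh.mono fun t ht => ⟨by linarith [ht.1], by linarith [ht.2]⟩) hA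
      (fun u v hs hv hu => by
        obtain ⟨z, hz, hmono⟩ := hoscA δ ⟨hδ0, by linarith⟩ u v (hs.mono le_rfl (by linarith)) hv
          (by rw [hu]; exact le_abs_self A)
        exact ⟨z, fun j hj => ⟨⟨by linarith [(hz j hj).1.1], by linarith [(hz j hj).1.2]⟩,
          (hz j hj).2⟩, hmono⟩)
  have hub : |u (d - δ)| < B :=
    abs_right_value_lt ⟨hδ0, by linarith⟩ rfl (by linarith) hoscB hs hvβ hne hφα hφβ hφd hang
  have hsl : IsSolIcc h (nlTerm lam q) δ c u v := hs.mono le_rfl (by linarith)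
  have hsr : IsSolIcc (fun t => -h (d - t)) (nlTerm lam q) δ (d - c) (fun t => u (d - t))
      (fun t => -v (d - t)) := by
    have h1 := hs.reflect d
    rw [sub_sub_cancel] at h1
    exact h1.mono le_rfl (by linarith)
  have huδ : |u δ| = u δ := abs_of_nonneg (by linarith [hua.1])
  have hbl := hR₁ δ ⟨hδ0, hδc⟩ u v hsl hvα (by rw [huδ]; exact hua.2)
  have hbr := hR₂ δ ⟨hδ0, hδcd⟩ _ _ hsr (by simp [hvβ]) hub.le
  obtain ⟨hn₁, -⟩ := hnear₁ δ ⟨hδ0, by linarith⟩ u v hsl hvα fun t ht => (hbl t ht).1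
  obtain ⟨hn₂, hn₂'⟩ := hnear₂ δ ⟨hδ0, by linarith⟩ _ _ hsr (by simp [hvβ])
    fun t ht => (hbr t ht).1
  have hbound : ∀ t ∈ Icc δ (d - δ), |u t| ≤ R ∧ |v t| ≤ (R + R / c + R / (d - c)) * t ∧
      |v t| ≤ (R + R / c + R / (d - c)) * (d - t) := by
    intro t ht
    have ht0 : 0 < t := hδ0.trans_le ht.1
    have htd : 0 < d - t := by linarith [ht.2]
    have hbig : ∀ {y : ℝ}, 0 < y → 0 ≤ R * y ∧ 0 ≤ R / c * y ∧ 0 ≤ R / (d - c) * y := fun hy =>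
      ⟨mul_nonneg (by linarith) hy.le, mul_nonneg hRc hy.le, mul_nonneg hRd hy.le⟩
    obtain ⟨p1, p2, p3⟩ := hbig ht0
    obtain ⟨p4, p5, p6⟩ := hbig htd
    rcases le_total t c with htc | htc
    · obtain ⟨h1, h2, h3⟩ := hbl t ⟨ht.1, htc⟩
      have h4 : R₁ ≤ R / (d - c) * (d - t) := by
        have h5 : R / (d - c) * (d - c) = R := div_mul_cancel₀ _ (by linarith)
        have h6 := mul_le_mul_of_nonneg_left (by linarith : d - c ≤ d - t) hRd
        linarith
      have h7 : 0 ≤ R₂ * t := mul_nonneg (by linarith) ht0.le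
      refine ⟨by linarith, ?_, by linarith⟩
      rw [hR] at p1 ⊢
      linarith
    · have h0 := hbr (d - t) ⟨by linarith [ht.2], by linarith⟩
      simp only [sub_sub_cancel, abs_neg] at h0
      obtain ⟨h1, h2, h3⟩ := h0
      have h4 : R₂ ≤ R / c * t := by
        have h5 : R / c * c = R := div_mul_cancel₀ _ hc0.ne'
        have h6 := mul_le_mul_of_nonneg_left htc hRc
        linarith
      have h7 : 0 ≤ R₁ * (d - t) := mul_nonneg (by linarith) htd.le
      refine ⟨by linarith, by linarith, ?_⟩
      rw [hR] at p4 ⊢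
      linarith
  have hm₁ : ∀ t ∈ Icc δ s₁, m ≤ |u t| := by
    intro t ht
    have h1 := hn₁ t ht
    have h2 : m ≤ 1 / 2 := min_le_left _ _
    have h3 := hua.1
    linarith
  have hb2 : 1 / (16 * (W * e)) ≤ (|u (d - δ)| / 2) ^ 2 := by
    have h1 : IsSolIcc h (nlTerm lam q) s₁ s₂ u v := hs.mono (by linarith) (by linarith)
    have h2 := h1.dist_sq_le (isSolIcc_zero h s₁ s₂) hL0.le hH
      (fun t ht => hL _ _ (hbound t ⟨by linarith [ht.1], by linarith [ht.2]⟩).1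
        (by simp only [abs_zero]; linarith)) (right_mem_Icc.2 hs₁₂) (left_mem_Icc.2 hs₁₂)
    simp only [sub_zero] at h2
    have h3 : u s₂ ^ 2 + v s₂ ^ 2 ≤ W * u (d - δ) ^ 2 := by simpa [hs₂] using hn₂'
    have h4 : (1 / 2) ^ 2 ≤ u s₁ ^ 2 := by
      rw [← sq_abs (u s₁)]
      refine pow_le_pow_left₀ (by norm_num) ?_ 2
      have := hn₁ s₁ ⟨by linarith, le_rfl⟩
      have := hua.1
      linarith
    have h5 := mul_le_mul_of_nonneg_right h3 he0.le
    rw [div_pow, sq_abs, div_le_div_iff₀ (by positivity) (by norm_num)]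
    have h6 := sq_nonneg (v s₁)
    nlinarith
  have hm₂ : ∀ t ∈ Icc s₂ (d - δ), m ≤ |u t| := by
    intro t ht
    have h1 := hn₂ (d - t) ⟨by linarith [ht.2], by linarith [ht.1]⟩
    simp only [sub_sub_cancel] at h1
    have h2 : m ≤ Real.sqrt (1 / (16 * (W * e))) := min_le_right _ _
    have h3 := Real.sqrt_le_sqrt hb2
    rw [Real.sqrt_sq (by positivity)] at h3
    linarith
  have hcos : ∀ t ∈ Icc δ (d - δ), m ≤ |u t| → Real.cos (φ t) ≠ 0 := by
    intro t ht hmt h0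
    have := (eq_zero_iff_cos_eq_zero (hne t ht) (hang t ht)).2 h0
    rw [this, abs_zero] at hmt
    linarith
  have hcross : ∀ t ∈ Icc δ (d - δ), Real.cos (φ t) = 0 →
      0 < angVel h (nlTerm lam q) u v t := fun t ht h0 =>
    angVel_pos nlTerm_zero (hne t ht) ((eq_zero_iff_cos_eq_zero (hne t ht) (hang t ht)).2 h0)
  have hφc : ContinuousOn φ (Icc δ (d - δ)) := fun t ht =>
    (hφd t ht).continuousAt.continuousWithinAt
  have hπ := Real.pi_pos
  have hs₁I : s₁ ∈ Icc δ (d - δ) := ⟨by linarith, by linarith⟩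
  have hs₂I : s₂ ∈ Icc δ (d - δ) := ⟨by linarith, by linarith⟩
  refine ⟨u, v, φ s₁, hs, fun t ht => ⟨by linarith [(hbound t ht).1], (hbound t ht).2⟩, hm₁, hm₂,
    ⟨?_, ?_⟩, hang s₁ hs₁I, ?_⟩
  · exact (lt_of_le_of_cos_eq_zero hφd hcross (by simp) le_rfl hs₁I.2 (by linarith)
      (by rw [hφα]; linarith)).le
  · exact (lt_add_pi_div_two_of_cos_ne_zero hs₁I.1 (hφc.mono (Icc_subset_Icc_right hs₁I.2))
      (by simp) (fun y hy => hcos y ⟨hy.1, hy.2.trans hs₁I.2⟩ (hm₁ y hy)) (by rw [hφα]; linarith)).le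
  · have hωc := hs.continuousOn_angVel
      (hh.mono fun t ht => ⟨by linarith [ht.1], by linarith [ht.2]⟩) (continuous_nlTerm hq) hne
    have hint : φ s₁ + ∫ s in s₁..s₂, angVel h (nlTerm lam q) u v s = φ s₂ := by
      rw [hφint s₁ hs₁I, hφint s₂ hs₂I, add_assoc, intervalIntegral.integral_add_adjacent_intervals]
      · refine (hωc.mono ?_).intervalIntegrable
        rw [uIcc_of_le hs₁I.1]; exact Icc_subset_Icc_right hs₁I.2
      · refine (hωc.mono ?_).intervalIntegrable
        rw [uIcc_of_le hs₁₂]; exact Icc_subset_Icc hs₁I.1 hs₂I.2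
    rw [hint]
    have hcosk : ∀ k : ℕ, Real.cos (k * Real.pi + Real.pi / 2) = 0 := fun k =>
      Real.cos_eq_zero_iff.2 ⟨k, by push_cast; ring⟩
    have hcosk' : Real.cos (k * Real.pi - Real.pi / 2) = 0 :=
      Real.cos_eq_zero_iff.2 ⟨(k : ℤ) - 1, by push_cast; ring⟩
    constructor
    · by_contra! hlt
      have := lt_add_pi_div_two_of_cos_ne_zero hs₂I.2 (hφc.mono (Icc_subset_Icc_left hs₂I.1))
        hcosk' (fun y hy => hcos y ⟨hs₂I.1.trans hy.1, hy.2⟩ (hm₂ y hy)) hlt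
      rw [hφβ] at this
      linarith
    · by_contra! hlt
      have := lt_of_le_of_cos_eq_zero hφd hcross (hcosk k) hs₂I.1 le_rfl
        (show s₂ < d - δ by linarith) hlt.le
      rw [hφβ] at this
      linarith

end Approximation

section Limit

variable {lam q d : ℝ} {h : ℝ → ℝ}

/-- On compact subintervals, bounded solutions with convergent data at one point are uniformly
Cauchy. -/
lemma uniform_cauchy_of_tendsto (hlam : 0 < lam) (hq : 1 < q) {α β s R a b : ℝ}
    (hh : ContinuousOn h (Icc α β)) (hs : s ∈ Icc α β) {U V : ℕ → ℝ → ℝ}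
    (hsol : ∀ᶠ i in atTop, IsSolIcc h (nlTerm lam q) α β (U i) (V i))
    (hR : ∀ᶠ i in atTop, ∀ t ∈ Icc α β, |U i t| ≤ R)
    (ha : Tendsto (fun i => U i s) atTop (nhds a)) (hb : Tendsto (fun i => V i s) atTop (nhds b))
    {ε : ℝ} (hε : 0 < ε) :
    ∃ N, ∀ i ≥ N, ∀ j ≥ N, ∀ t ∈ Icc α β, |U i t - U j t| ≤ ε ∧ |V i t - V j t| ≤ ε := by
  obtain ⟨H, hH⟩ := isCompact_Icc.exists_bound_of_continuousOn hh
  simp only [Real.norm_eq_abs] at hH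
  have hH0 : 0 ≤ H := (abs_nonneg _).trans (hH s hs)
  obtain ⟨L, hL, hLip⟩ := exists_lipschitz_nlTerm hlam hq (abs_nonneg R)
  set E := Real.exp ((1 + 2 * H + L) * (β - α)) with hE
  have hE0 : 0 < E := Real.exp_pos _
  set η := ε ^ 2 / (2 * E) with hη
  have hη0 : 0 < η := by positivity
  have hUs : Tendsto (fun p : ℕ × ℕ => (U p.1 s - U p.2 s) ^ 2 + (V p.1 s - V p.2 s) ^ 2)
      (atTop ×ˢ atTop) (nhds ((a - a) ^ 2 + (b - b) ^ 2)) :=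
    (((ha.comp tendsto_fst).sub (ha.comp tendsto_snd)).pow 2).add
      (((hb.comp tendsto_fst).sub (hb.comp tendsto_snd)).pow 2)
  rw [sub_self, sub_self, zero_pow two_ne_zero, add_zero] at hUs
  have h1 := (hUs.eventually (gt_mem_nhds hη0))
  rw [prod_atTop_atTop_eq, eventually_atTop_prod_self] at h1
  obtain ⟨N₁, hN₁⟩ := h1
  obtain ⟨N₂, hN₂⟩ := eventually_atTop.1 (hsol.and hR)
  refine ⟨max N₁ N₂, fun i hi j hj t ht => ?_⟩
  obtain ⟨si, ri⟩ := hN₂ i ((le_max_right _ _).trans hi)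
  obtain ⟨sj, rj⟩ := hN₂ j ((le_max_right _ _).trans hj)
  have h2 := hN₁ i j ((le_max_left _ _).trans hi) ((le_max_left _ _).trans hj)
  have h3 := si.dist_sq_le sj hL.le hH
    (fun x hx => hLip _ _ ((ri x hx).trans (le_abs_self R)) ((rj x hx).trans (le_abs_self R))) hs ht
  have h4 : Real.exp ((1 + 2 * H + L) * |t - s|) ≤ E := by
    rw [hE]; gcongr
    rw [abs_le]; constructor <;> linarith [ht.1, ht.2, hs.1, hs.2]
  have h5 : (U i t - U j t) ^ 2 + (V i t - V j t) ^ 2 ≤ ε ^ 2 := by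
    refine h3.trans ((mul_le_mul h2.le h4 (Real.exp_pos _).le hη0.le).trans ?_)
    rw [hη, div_mul_eq_mul_div, div_le_iff₀ (by positivity)]
    nlinarith [sq_nonneg ε]
  constructor
  · exact abs_le_of_sq_le_sq (by linarith [sq_nonneg (V i t - V j t)]) hε.le
  · exact abs_le_of_sq_le_sq (by linarith [sq_nonneg (U i t - U j t)]) hε.le

/-- Compactness for bounded families of solutions on an exhaustion of an interval. -/
lemma exists_limit_solution (hlam : 0 < lam) (hq : 1 < q) {s R a b : ℝ}
    (hh : ContinuousOn h (Ioo 0 d)) (hs : s ∈ Ioo 0 d) {U V : ℕ → ℝ → ℝ}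
    (hsol : ∀ α ∈ Ioo 0 d, ∀ β ∈ Ioo 0 d,
      ∀ᶠ i in atTop, IsSolIcc h (nlTerm lam q) α β (U i) (V i))
    (hR : ∀ α ∈ Ioo 0 d, ∀ β ∈ Ioo 0 d, ∀ᶠ i in atTop, ∀ t ∈ Icc α β, |U i t| ≤ R)
    (ha : Tendsto (fun i => U i s) atTop (nhds a)) (hb : Tendsto (fun i => V i s) atTop (nhds b)) :
    ∃ u v : ℝ → ℝ, (∀ α ∈ Ioo 0 d, ∀ β ∈ Ioo 0 d, IsSolIcc h (nlTerm lam q) α β u v) ∧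
      ∀ t ∈ Ioo 0 d, Tendsto (fun i => U i t) atTop (nhds (u t)) ∧
        Tendsto (fun i => V i t) atTop (nhds (v t)) := by
  have hcauchy : ∀ α ∈ Ioo 0 d, ∀ β ∈ Ioo 0 d, ∀ ε > 0,
      ∃ N, ∀ i ≥ N, ∀ j ≥ N, ∀ t ∈ Icc α β, |U i t - U j t| ≤ ε ∧ |V i t - V j t| ≤ ε := by
    intro α hα β hβ ε hε
    have hα' : min α s ∈ Ioo 0 d := ⟨lt_min hα.1 hs.1, (min_le_right _ _).trans_lt hs.2⟩
    have hβ' : max β s ∈ Ioo 0 d := ⟨lt_max_of_lt_left hβ.1, max_lt hβ.2 hs.2⟩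
    obtain ⟨N, hN⟩ := uniform_cauchy_of_tendsto hlam hq
      (hh.mono fun t ht => ⟨hα'.1.trans_le ht.1, ht.2.trans_lt hβ'.2⟩)
      ⟨min_le_right α s, le_max_right β s⟩ (hsol _ hα' _ hβ') (hR _ hα' _ hβ') ha hb hε
    exact ⟨N, fun i hi j hj t ht => hN i hi j hj t
      ⟨(min_le_left _ _).trans ht.1, ht.2.trans (le_max_left _ _)⟩⟩
  have hlim : ∀ t, ∃ p : ℝ × ℝ, t ∈ Ioo 0 d → Tendsto (fun i => U i t) atTop (nhds p.1) ∧
      Tendsto (fun i => V i t) atTop (nhds p.2) := by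
    intro t
    by_cases ht : t ∈ Ioo 0 d
    · have h1 : CauchySeq fun i => U i t := Metric.cauchySeq_iff.2 fun ε hε => by
        obtain ⟨N, hN⟩ := hcauchy t ht t ht (ε / 2) (half_pos hε)
        exact ⟨N, fun i hi j hj => ((hN i hi j hj t ⟨le_rfl, le_rfl⟩).1).trans_lt (half_lt_self hε)⟩
      have h2 : CauchySeq fun i => V i t := Metric.cauchySeq_iff.2 fun ε hε => by
        obtain ⟨N, hN⟩ := hcauchy t ht t ht (ε / 2) (half_pos hε)
        exact ⟨N, fun i hi j hj => ((hN i hi j hj t ⟨le_rfl, le_rfl⟩).2).trans_lt (half_lt_self hε)⟩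
      obtain ⟨x, hx⟩ := cauchySeq_tendsto_of_complete h1
      obtain ⟨y, hy⟩ := cauchySeq_tendsto_of_complete h2
      exact ⟨(x, y), fun _ => ⟨hx, hy⟩⟩
    · exact ⟨0, fun h => absurd h ht⟩
  choose p hp using hlim
  refine ⟨fun t => (p t).1, fun t => (p t).2, ?_, hp⟩
  have hunif : ∀ α ∈ Ioo 0 d, ∀ β ∈ Ioo 0 d, ∀ ε > 0,
      ∃ N, ∀ i ≥ N, ∀ t ∈ Icc α β, |U i t - (p t).1| ≤ ε ∧ |V i t - (p t).2| ≤ ε := by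
    intro α hα β hβ ε hε
    obtain ⟨N, hN⟩ := hcauchy α hα β hβ ε hε
    refine ⟨N, fun i hi t ht => ?_⟩
    obtain ⟨h1, h2⟩ := hp t ⟨hα.1.trans_le ht.1, ht.2.trans_lt hβ.2⟩
    constructor
    · exact le_of_tendsto (h1.const_sub (U i t)).abs
        (eventually_atTop.2 ⟨N, fun j hj => (hN i hi j hj t ht).1⟩)
    · exact le_of_tendsto (h2.const_sub (V i t)).abs
        (eventually_atTop.2 ⟨N, fun j hj => (hN i hi j hj t ht).2⟩)
  intro α hα β hβ t ht
  have ht' : t ∈ Ioo 0 d := ⟨hα.1.trans_le ht.1, ht.2.trans_lt hβ.2⟩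
  obtain ⟨α', hα'⟩ := exists_between ht'.1
  obtain ⟨β', hβ'⟩ := exists_between ht'.2
  have hαI : α' ∈ Ioo 0 d := ⟨hα'.1, hα'.2.trans ht'.2⟩
  have hβI : β' ∈ Ioo 0 d := ⟨ht'.1.trans hβ'.1, hβ'.2⟩
  have hmem : ∀ x ∈ Ioo α' β', x ∈ Icc α' β' := fun x hx => Ioo_subset_Icc_self hx
  have hu := hunif α' hαI β' hβI
  have hlimI : ∀ x ∈ Ioo α' β', _ := fun x hx => hp x ⟨hαI.1.trans hx.1, hx.2.trans hβI.2⟩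
  constructor
  · refine hasDerivAt_of_tendstoUniformlyOn (f := U) (f' := V) (g := fun x => (p x).1)
      (g' := fun x => (p x).2) (l := atTop) (s := Ioo α' β')
      isOpen_Ioo ?_ ?_ (fun x hx => (hlimI x hx).1) ⟨hα'.2, hβ'.1⟩
    · refine Metric.tendstoUniformlyOn_iff.2 fun ε hε => ?_
      obtain ⟨N, hN⟩ := hu (ε / 2) (half_pos hε)
      refine eventually_atTop.2 ⟨N, fun i hi x hx => ?_⟩
      rw [dist_comm]
      exact ((hN i hi x (hmem x hx)).2).trans_lt (half_lt_self hε)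
    · filter_upwards [hsol α' hαI β' hβI] with i hi x hx
      exact (hi x (hmem x hx)).1
  · obtain ⟨H, hH⟩ := isCompact_Icc.exists_bound_of_continuousOn
      (hh.mono fun x (hx : x ∈ Icc α' β') => ⟨hαI.1.trans_le hx.1, hx.2.trans_lt hβI.2⟩)
    simp only [Real.norm_eq_abs] at hH
    have hH0 : 0 ≤ H := (abs_nonneg _).trans (hH t ⟨hα'.2.le, hβ'.1.le⟩)
    obtain ⟨L, hL, hLip⟩ := exists_lipschitz_nlTerm hlam hq (abs_nonneg R)
    have hpR : ∀ x ∈ Ioo α' β', |(p x).1| ≤ |R| := fun x hx =>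
      le_of_tendsto (hlimI x hx).1.abs ((hR α' hαI β' hβI).mono fun i hi =>
        (hi x (hmem x hx)).trans (le_abs_self R))
    refine hasDerivAt_of_tendstoUniformlyOn (f := V)
      (f' := fun i x => -(h x * V i x) - nlTerm lam q (U i x))
      (g' := fun x => -(h x * (p x).2) - nlTerm lam q (p x).1) (l := atTop) (s := Ioo α' β')
      isOpen_Ioo ?_ ?_ (fun x hx => (hlimI x hx).2) ⟨hα'.2, hβ'.1⟩
    · refine Metric.tendstoUniformlyOn_iff.2 fun ε hε => ?_
      obtain ⟨N, hN⟩ := hu (ε / (2 * (H + L))) (by positivity)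
      filter_upwards [eventually_ge_atTop N, hR α' hαI β' hβI] with i hi hRi x hx
      obtain ⟨h1, h2⟩ := hN i hi x (hmem x hx)
      have h3 := hLip (U i x) (p x).1 ((hRi x (hmem x hx)).trans (le_abs_self R)) (hpR x hx)
      rw [dist_comm, Real.dist_eq]
      have e : -(h x * V i x) - nlTerm lam q (U i x) -
          (-(h x * (p x).2) - nlTerm lam q (p x).1) =
          -(h x * (V i x - (p x).2)) - (nlTerm lam q (U i x) - nlTerm lam q (p x).1) := by ring
      rw [e]
      have h4 : |h x * (V i x - (p x).2)| ≤ H * (ε / (2 * (H + L))) := by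
        rw [abs_mul]; exact mul_le_mul (hH x (hmem x hx)) h2 (abs_nonneg _) hH0
      have h5 := h3.trans (mul_le_mul_of_nonneg_left h1 hL.le)
      have h6 : H * (ε / (2 * (H + L))) + L * (ε / (2 * (H + L))) = ε / 2 := by field_simp
      have h7 := abs_sub (-(h x * (V i x - (p x).2)))
        (nlTerm lam q (U i x) - nlTerm lam q (p x).1)
      rw [abs_neg] at h7
      linarith
    · filter_upwards [hsol α' hαI β' hβI] with i hi x hx
      exact (hi x (hmem x hx)).2

end Limit

section Neumann

variable {lam q d : ℝ} {h : ℝ → ℝ}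

/-- A solution on the open interval whose derivative decays linearly at the end points extends to
a solution of the Neumann problem. -/
lemma exists_solOn (hq : 1 < q) {R : ℝ} (hR : 0 ≤ R) (hd : 0 < d)
    (hh : ContinuousOn h (Ioo 0 d)) {u v : ℝ → ℝ}
    (hs : ∀ α ∈ Ioo 0 d, ∀ β ∈ Ioo 0 d, IsSolIcc h (nlTerm lam q) α β u v)
    (hv : ∀ t ∈ Ioo 0 d, |v t| ≤ R * t ∧ |v t| ≤ R * (d - t)) :
    ∃ U U' U'' : ℝ → ℝ, SolOn h lam q (Icc 0 d) (Ioo 0 d) U U' U'' ∧ U' 0 = 0 ∧ U' d = 0 ∧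
      ∀ t ∈ Ioo 0 d, U t = u t := by
  have hs' : ∀ t ∈ Ioo 0 d, HasDerivAt u (v t) t ∧
      HasDerivAt v (-(h t * v t) - nlTerm lam q (u t)) t := fun t ht =>
    hs t ht t ht t ⟨le_rfl, le_rfl⟩
  set W : ℝ → ℝ := (Ioo 0 d).indicator v with hW
  have hWv : ∀ t ∈ Ioo 0 d, W t = v t := fun t ht => indicator_of_mem ht v
  have hW0 : ∀ t ∉ Ioo 0 d, W t = 0 := fun t ht => indicator_of_notMem ht v
  have hWb : ∀ t, |W t| ≤ R * max 0 t ∧ |W t| ≤ R * max 0 (d - t) := by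
    intro t
    by_cases ht : t ∈ Ioo 0 d
    · rw [hWv t ht, max_eq_right ht.1.le, max_eq_right (sub_nonneg.2 ht.2.le)]
      exact hv t ht
    · rw [hW0 t ht, abs_zero]
      constructor <;> positivity
  have hWloc : ∀ t ∈ Ioo 0 d, W =ᶠ[nhds t] v := fun t ht =>
    eventually_of_mem (isOpen_Ioo.mem_nhds ht) hWv
  have hWc : Continuous W := by
    rw [continuous_iff_continuousAt]
    intro t
    by_cases ht : t ∈ Ioo 0 d
    · exact (hs' t ht).2.continuousAt.congr (hWloc t ht).symm
    · rw [ContinuousAt, hW0 t ht]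
      rw [mem_Ioo, not_and_or, not_lt, not_lt] at ht
      rcases ht with ht | ht
      · refine squeeze_zero_norm (fun x => (hWb x).1) ?_
        have : Continuous fun x : ℝ => R * max 0 x := by fun_prop
        simpa [max_eq_left ht] using this.tendsto t
      · refine squeeze_zero_norm (fun x => (hWb x).2) ?_
        have : Continuous fun x : ℝ => R * max 0 (d - x) := by fun_prop
        simpa [max_eq_left (sub_nonpos.2 ht)] using this.tendsto t
  have hmid : d / 2 ∈ Ioo 0 d := ⟨half_pos hd, half_lt_self hd⟩
  set U : ℝ → ℝ := fun t => u (d / 2) + ∫ s in (d / 2)..t, W s with hU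
  have hUd : ∀ t, HasDerivAt U (W t) t := fun t =>
    (hWc.integral_hasStrictDerivAt (d / 2) t).hasDerivAt.const_add _
  have hUu : ∀ t ∈ Ioo 0 d, U t = u t := by
    intro t ht
    have : ∫ s in (d / 2)..t, W s = u t - u (d / 2) := by
      refine intervalIntegral.integral_eq_sub_of_hasDerivAt (fun x hx => ?_)
        (hWc.intervalIntegrable _ _)
      have hx' := ordConnected_Ioo.uIcc_subset hmid ht hx
      rw [hWv x hx']
      exact (hs' x hx').1
    rw [hU]; simp only [this]; ring
  refine ⟨U, W, fun t => -(h t * v t) - nlTerm lam q (u t), ⟨fun t _ => (hUd t).hasDerivWithinAt,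
    hWc.continuousOn, fun t ht => ?_, ?_, fun t ht => ?_⟩, hW0 0 (by simp), hW0 d (by simp), hUu⟩
  · exact ((hs' t ht).2.congr_of_eventuallyEq (hWloc t ht)).hasDerivWithinAt
  · have hvc : ContinuousOn v (Ioo 0 d) := fun t ht => (hs' t ht).2.continuousAt.continuousWithinAt
    have huc : ContinuousOn u (Ioo 0 d) := fun t ht => (hs' t ht).1.continuousAt.continuousWithinAt
    exact (hh.mul hvc).neg.sub ((continuous_nlTerm hq).comp_continuousOn huc)
  · simp only [hWv t ht, hUu t ht, nlTerm]; ring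

/-- The zeros of a solution with prescribed total angle. -/
lemma IsSolIcc.ncard_zeros (hlam : 0 < lam) (hq : 1 < q) {α β θ : ℝ} (hαβ : α ≤ β)
    (hh : ContinuousOn h (Icc α β)) {u v : ℝ → ℝ} (hs : IsSolIcc h (nlTerm lam q) α β u v)
    (hα : u α ≠ 0) (hβ : u β ≠ 0) (hθ : θ ∈ Icc (-(Real.pi / 2)) (Real.pi / 2))
    (h0 : u α * Real.sin θ + v α * Real.cos θ = 0) {k : ℕ}
    (hk : θ + ∫ s in α..β, angVel h (nlTerm lam q) u v s ∈
      Icc (k * Real.pi - Real.pi / 2) (k * Real.pi + Real.pi / 2)) :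
    {t ∈ Ioo α β | u t = 0}.Finite ∧ {t ∈ Ioo α β | u t = 0}.ncard = k := by
  have hαI : α ∈ Icc α β := ⟨le_rfl, hαβ⟩
  have hβI : β ∈ Icc α β := ⟨hαβ, le_rfl⟩
  have hne := hs.sq_add_sq_ne_zero hlam hq hh hαI (by positivity)
  obtain ⟨φ, hφi, hφd, hφ⟩ := hs.exists_angle hαβ hh (continuous_nlTerm hq) hne h0
  have hiff : ∀ t ∈ Icc α β, (u t = 0 ↔ Real.cos (φ t) = 0) := fun t ht =>
    eq_zero_iff_cos_eq_zero (hne t ht) (hφ t ht)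
  have hset : {t ∈ Ioo α β | u t = 0} = {t ∈ Ioo α β | Real.cos (φ t) = 0} := by
    ext t
    exact and_congr_right fun ht => hiff t (Ioo_subset_Icc_self ht)
  have hφα : φ α = θ := by rw [hφi α hαI]; simp
  have hcα : Real.cos (φ α) ≠ 0 := fun h => hα ((hiff α hαI).2 h)
  have hcβ : Real.cos (φ β) ≠ 0 := fun h => hβ ((hiff β hβI).2 h)
  rw [← hφi β hβI] at hk
  rw [← hφα] at hθ
  have hsub : Real.cos (k * Real.pi - Real.pi / 2) = 0 :=
    Real.cos_eq_zero_iff.2 ⟨(k : ℤ) - 1, by push_cast; ring⟩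
  have hadd : Real.cos (k * Real.pi + Real.pi / 2) = 0 :=
    Real.cos_eq_zero_iff.2 ⟨k, by push_cast; ring⟩
  rw [hset]
  refine ncard_zeros_cos hφd (fun t ht hc => angVel_pos nlTerm_zero (hne t ht) ((hiff t ht).2 hc))
    hαβ (hθ.1.lt_of_ne fun h => hcα ?_) (hθ.2.lt_of_ne fun h => hcα ?_)
    (hk.1.lt_of_ne fun h => hcβ ?_) (hk.2.lt_of_ne fun h => hcβ ?_)
  · rw [← h, Real.cos_neg, Real.cos_pi_div_two]
  · rw [h, Real.cos_pi_div_two]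
  · rw [← h, hsub]
  · rw [h, hadd]

end Neumann

section Existence

variable {lam q d : ℝ} {h P : ℝ → ℝ}

/-- Solutions of the Neumann problem with exactly `k` zeros, for damping of one sign change. -/
lemma exists_neumann_solution (hlam : 0 < lam) (hq : 1 < q) {c : ℝ} (hc : c ∈ Ioo 0 d)
    (hh : ContinuousOn h (Ioo 0 d)) (hP : ∀ t ∈ Ioo 0 d, HasDerivAt P (h t) t)
    (hpos : ∀ t ∈ Ioc 0 c, 0 ≤ h t) (hneg : ∀ t ∈ Ico c d, h t ≤ 0) {k : ℕ}
    (hl : LargeOscillate h lam q (k + 1) c)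
    (hr : LargeOscillate (fun t => -h (d - t)) lam q (k + 1) (d - c)) :
    ∃ u u' u'' : ℝ → ℝ, SolOn h lam q (Icc 0 d) (Ioo 0 d) u u' u'' ∧ u' 0 = 0 ∧ u' d = 0 ∧
      {t ∈ Ioo 0 d | u t = 0}.Finite ∧ {t ∈ Ioo 0 d | u t = 0}.ncard = k := by
  obtain ⟨R, m, s₁, s₂, δ₀, hm, hs₁₂, hδ₀, hδs₁, hδs₂, happ⟩ :=
    exists_approximants hlam hq hc hh hP hpos hneg hl hr
  have hd : 0 < d := hc.1.trans hc.2
  have hs₁ : s₁ ∈ Ioo 0 d := ⟨by linarith, by linarith⟩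
  have hs₂ : s₂ ∈ Ioo 0 d := ⟨by linarith, by linarith⟩
  have hδ : ∀ i : ℕ, δ₀ / (i + 2) ∈ Ioo 0 δ₀ := fun i =>
    ⟨by positivity, div_lt_self hδ₀ (by have := Nat.cast_nonneg (α := ℝ) i; linarith)⟩
  have hδlim : Tendsto (fun i : ℕ => δ₀ / ((i : ℝ) + 2)) atTop (nhds 0) :=
    tendsto_const_nhds.div_atTop (tendsto_natCast_atTop_atTop.atTop_add tendsto_const_nhds)
  choose U V Θ hsol hbd hm₁ hm₂ hΘ hang hint using fun i : ℕ => happ _ (hδ i)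
  have hs₁I : ∀ i : ℕ, s₁ ∈ Icc (δ₀ / ((i : ℝ) + 2)) (d - δ₀ / (i + 2)) := fun i =>
    ⟨by linarith [(hδ i).2], by linarith [(hδ i).2]⟩
  have hs₂I : ∀ i : ℕ, s₂ ∈ Icc (δ₀ / ((i : ℝ) + 2)) (d - δ₀ / (i + 2)) := fun i =>
    ⟨by linarith [(hδ i).2], by linarith [(hδ i).2]⟩
  have hR0 : 0 ≤ R := (abs_nonneg _).trans (hbd 0 s₁ (hs₁I 0)).1
  have hcpt : IsCompact (Icc (-R) R ×ˢ Icc (-(R * s₁)) (R * s₁) ×ˢ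
      Icc (-(Real.pi / 2)) (Real.pi / 2)) := isCompact_Icc.prod (isCompact_Icc.prod isCompact_Icc)
  obtain ⟨⟨a, b, θ⟩, hmem, ψ, hψ, hlim⟩ := hcpt.tendsto_subseq
    (x := fun i => (U i s₁, V i s₁, Θ i)) fun i =>
      ⟨abs_le.1 (hbd i s₁ (hs₁I i)).1, abs_le.1 (hbd i s₁ (hs₁I i)).2.1, hΘ i⟩
  rw [nhds_prod_eq, nhds_prod_eq] at hlim
  have ha : Tendsto (fun i => U (ψ i) s₁) atTop (nhds a) := tendsto_fst.comp hlim
  have hb : Tendsto (fun i => V (ψ i) s₁) atTop (nhds b) :=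
    tendsto_fst.comp (tendsto_snd.comp hlim)
  have hθ : Tendsto (fun i => Θ (ψ i)) atTop (nhds θ) := tendsto_snd.comp (tendsto_snd.comp hlim)
  have hev : ∀ α ∈ Ioo 0 d, ∀ β ∈ Ioo 0 d, ∀ᶠ i in atTop,
      δ₀ / ((ψ i : ℝ) + 2) ≤ α ∧ β ≤ d - δ₀ / ((ψ i : ℝ) + 2) := by
    intro α hα β hβ
    have h1 := hδlim.comp hψ.tendsto_atTop
    filter_upwards [h1.eventually (gt_mem_nhds hα.1),
      h1.eventually (gt_mem_nhds (sub_pos.2 hβ.2))] with i hi hi'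
    simp only [Function.comp_apply] at hi hi'
    exact ⟨hi.le, by linarith⟩
  obtain ⟨u, v, huv, hconv⟩ := exists_limit_solution hlam hq hh hs₁
    (U := fun i => U (ψ i)) (V := fun i => V (ψ i))
    (fun α hα β hβ => (hev α hα β hβ).mono fun i hi => (hsol (ψ i)).mono hi.1 hi.2)
    (fun α hα β hβ => (hev α hα β hβ).mono fun i hi t ht =>
      (hbd (ψ i) t ⟨hi.1.trans ht.1, ht.2.trans hi.2⟩).1) ha hb
  have hbd' : ∀ t ∈ Ioo 0 d, |v t| ≤ R * t ∧ |v t| ≤ R * (d - t) := fun t ht =>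
    ⟨le_of_tendsto (hconv t ht).2.abs ((hev t ht t ht).mono fun i hi => (hbd (ψ i) t hi).2.1),
      le_of_tendsto (hconv t ht).2.abs ((hev t ht t ht).mono fun i hi => (hbd (ψ i) t hi).2.2)⟩
  have hm₁' : ∀ t ∈ Ioo 0 d, t ≤ s₁ → u t ≠ 0 := by
    intro t ht hts h0
    have := ge_of_tendsto (hconv t ht).1.abs
      ((hev t ht t ht).mono fun i hi => hm₁ (ψ i) t ⟨hi.1, hts⟩)
    rw [h0, abs_zero] at this
    linarith
  have hm₂' : ∀ t ∈ Ioo 0 d, s₂ ≤ t → u t ≠ 0 := by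
    intro t ht hts h0
    have := ge_of_tendsto (hconv t ht).1.abs
      ((hev t ht t ht).mono fun i hi => hm₂ (ψ i) t ⟨hts, hi.2⟩)
    rw [h0, abs_zero] at this
    linarith
  have hsub : Icc s₁ s₂ ⊆ Ioo 0 d := fun t ht => ⟨hs₁.1.trans_le ht.1, ht.2.trans_lt hs₂.2⟩
  have hu₁ := hm₁' s₁ hs₁ le_rfl
  have hs := huv s₁ hs₁ s₂ hs₂
  have hne := hs.sq_add_sq_ne_zero hlam hq (hh.mono hsub) ⟨le_rfl, hs₁₂⟩ (by positivity)
  have hangle : u s₁ * Real.sin θ + v s₁ * Real.cos θ = 0 := by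
    refine tendsto_nhds_unique (((hconv s₁ hs₁).1.mul ((Real.continuous_sin.tendsto θ).comp hθ)).add
      ((hconv s₁ hs₁).2.mul ((Real.continuous_cos.tendsto θ).comp hθ))) ?_
    refine tendsto_const_nhds.congr fun i => ?_
    exact (hang (ψ i)).symm
  obtain ⟨H, hH⟩ := isCompact_Icc.exists_bound_of_continuousOn (hh.mono hsub)
  simp only [Real.norm_eq_abs] at hH
  obtain ⟨L, hL, hLip⟩ := exists_lipschitz_nlTerm hlam hq hR0
  have htot : θ + ∫ s in s₁..s₂, angVel h (nlTerm lam q) u v s ∈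
      Icc (k * Real.pi - Real.pi / 2) (k * Real.pi + Real.pi / 2) := by
    refine isClosed_Icc.mem_of_tendsto (hθ.add (tendsto_integral_angVel
      (U := fun i => U (ψ i)) (V := fun i => V (ψ i)) (B := 1 + H + L) hs₁₂
      (continuous_nlTerm hq) (Eventually.of_forall fun i => ?_)
      (Eventually.of_forall fun i t ht => ?_) (fun t ht => (hconv t (hsub ht)).1)
      (fun t ht => (hconv t (hsub ht)).2) hne)) (Eventually.of_forall fun i => hint (ψ i))
    · have hi := (hsol (ψ i)).mono (hs₁I (ψ i)).1 (hs₂I (ψ i)).2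
      refine hi.continuousOn_angVel (hh.mono hsub) (continuous_nlTerm hq)
        (hi.sq_add_sq_ne_zero hlam hq (hh.mono hsub) ⟨le_rfl, hs₁₂⟩ ?_)
      have := abs_pos.1 (hm.trans_le (hm₁ (ψ i) s₁ ⟨(hs₁I (ψ i)).1, le_rfl⟩))
      positivity
    · refine abs_angVel_le hL.le (hH t ht) ?_
      have hb := (hbd (ψ i) t ⟨(hs₁I (ψ i)).1.trans ht.1, ht.2.trans (hs₂I (ψ i)).2⟩).1
      simpa [nlTerm_zero] using hLip (U (ψ i) t) 0 hb (by simpa using hR0)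
  obtain ⟨hfin, hcard⟩ := hs.ncard_zeros hlam hq hs₁₂ (hh.mono hsub) hu₁
    (hm₂' s₂ hs₂ le_rfl) hmem.2.2 hangle htot
  obtain ⟨W, W', W'', hW, hW0, hWd, hWu⟩ := exists_solOn hq hR0 hd hh huv hbd'
  have hset : {t ∈ Ioo 0 d | W t = 0} = {t ∈ Ioo s₁ s₂ | u t = 0} := by
    ext t
    constructor
    · rintro ⟨ht, h0⟩
      rw [hWu t ht] at h0
      exact ⟨⟨not_le.1 fun hle => hm₁' t ht hle h0, not_le.1 fun hle => hm₂' t ht hle h0⟩, h0⟩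
    · rintro ⟨ht, h0⟩
      have ht' := hsub (Ioo_subset_Icc_self ht)
      exact ⟨ht', (hWu t ht').trans h0⟩
  exact ⟨W, W', W'', hW, hW0, hWd, by rwa [hset], by rwa [hset]⟩

end Existence

/-- The subcriticality bound for the smallest multiplicity implies it for any larger one. -/
lemma subcritical_of_le {N M q : ℝ} (hq : 1 < q) (hN : 2 ≤ N) (hNM : N ≤ M)
    (h : 2 < M → q < (M + 2) / (M - 2)) : q * (N - 1 - 1) < N - 1 + 3 := by
  rcases hN.eq_or_lt with rfl | hN
  · norm_num
  · have hM : 2 < M := hN.trans_le hNM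
    have h1 := h hM
    rw [lt_div_iff₀ (by linarith)] at h1
    nlinarith

theorem stmt_0
    (d lam : ℝ) (hd : 0 < d) (hlam : 0 < lam)
    (n m₁ m₂ : ℤ) (hn : 3 ≤ n)
    (hm₁0 : 0 ≤ m₁) (hm₁n : m₁ ≤ n - 2) (hm₂0 : 0 ≤ m₂) (hm₂n : m₂ ≤ n - 2)
    (h : ℝ → ℝ) (hC1 : ContDiffOn ℝ 1 h (Set.Ioo 0 d))
    (hder : ∀ t ∈ Set.Ioo 0 d, deriv h t < 0)
    (hlim0 : Filter.Tendsto (fun t => t * h t) (nhdsWithin 0 (Set.Ioi 0))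
      (nhds ((n : ℝ) - (m₁ : ℝ) - 1)))
    (hlimd : Filter.Tendsto (fun t => (t - d) * h t) (nhdsWithin d (Set.Iio d))
      (nhds ((n : ℝ) - (m₂ : ℝ) - 1)))
    (q : ℝ) (hq1 : 1 < q)
    (hqsub : min m₁ m₂ < n - 2 →
      q < ((n : ℝ) - (min m₁ m₂ : ℝ) + 2) / ((n : ℝ) - (min m₁ m₂ : ℝ) - 2))
    (k : ℕ) (hk : 0 < k) :
    ∃ u u' u'' : ℝ → ℝ,
      SolOn h lam q (Set.Icc 0 d) (Set.Ioo 0 d) u u' u'' ∧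
      u' 0 = 0 ∧ u' d = 0 ∧
      {t ∈ Set.Ioo 0 d | u t = 0}.Finite ∧
      {t ∈ Set.Ioo 0 d | u t = 0}.ncard = k := by
  have hh : ContinuousOn h (Ioo 0 d) := hC1.continuousOn
  have hanti : StrictAntiOn h (Ioo 0 d) := strictAntiOn_of_deriv_neg (convex_Ioo 0 d) hh
    fun t ht => hder t (interior_subset ht)
  have hN₁ : (2 : ℝ) ≤ n - m₁ := by exact_mod_cast (by omega : (2 : ℤ) ≤ n - m₁)
  have hN₂ : (2 : ℝ) ≤ n - m₂ := by exact_mod_cast (by omega : (2 : ℤ) ≤ n - m₂)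
  have hsub : 2 < (n : ℝ) - min (m₁ : ℝ) m₂ →
      q < ((n : ℝ) - (min m₁ m₂ : ℝ) + 2) / ((n : ℝ) - (min m₁ m₂ : ℝ) - 2) := fun hM =>
    hqsub (by
      have : (2 : ℤ) < n - min m₁ m₂ := by exact_mod_cast hM
      omega)
  have hsub₁ := subcritical_of_le hq1 hN₁
    (sub_le_sub_left (min_le_left (m₁ : ℝ) m₂) n) hsub
  have hsub₂ := subcritical_of_le hq1 hN₂
    (sub_le_sub_left (min_le_right (m₁ : ℝ) m₂) n) hsub
  obtain ⟨x, hx, hxpos⟩ : ∃ x ∈ Ioo 0 d, 0 < h x := by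
    have h1 := hlim0.eventually (lt_mem_nhds (show (0 : ℝ) < n - m₁ - 1 by linarith))
    obtain ⟨x, hx1, hx⟩ := (h1.and (Ioo_mem_nhdsGT hd)).exists
    exact ⟨x, hx, (pos_iff_pos_of_mul_pos hx1).1 hx.1⟩
  obtain ⟨y, hy, hyneg⟩ : ∃ y ∈ Ioo 0 d, h y < 0 := by
    have h1 := hlimd.eventually (lt_mem_nhds (show (0 : ℝ) < n - m₂ - 1 by linarith))
    obtain ⟨y, hy1, hy⟩ := (h1.and (Ioo_mem_nhdsLT hd)).exists
    exact ⟨y, hy, (neg_iff_neg_of_mul_pos hy1).1 (sub_neg.2 hy.2)⟩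
  obtain ⟨c, hc, hc0⟩ : ∃ c ∈ Ioo 0 d, h c = 0 :=
    isPreconnected_Ioo.intermediate_value hy hx hh ⟨hyneg.le, hxpos.le⟩
  have hP : ∀ t ∈ Ioo 0 d, HasDerivAt (fun x => ∫ s in c..x, h s) (h t) t := fun t ht =>
    hasDerivAt_integral_of_continuousOn isOpen_Ioo ordConnected_Ioo hh hc ht
  have hpos : ∀ t ∈ Ioc 0 c, 0 ≤ h t := fun t ht => by
    rw [← hc0]; exact hanti.antitoneOn ⟨ht.1, ht.2.trans_lt hc.2⟩ hc ht.2
  have hneg : ∀ t ∈ Ico c d, h t ≤ 0 := fun t ht => by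
    rw [← hc0]; exact hanti.antitoneOn hc ⟨hc.1.trans_le ht.1, ht.2⟩ ht.1
  refine exists_neumann_solution hlam hq1 hc hh hP hpos hneg
    (largeOscillate_of_tendsto hlam hq1 (by linarith) hsub₁ hlim0 hc.1
      (fun t ht => hP t ⟨ht.1, ht.2.trans_lt hc.2⟩) (k + 1))
    (largeOscillate_of_tendsto hlam hq1 (by linarith) hsub₂ ?_ (sub_pos.2 hc.2)
      (P := fun t => ∫ s in c..(d - t), h s)
      (fun t ht => (hP (d - t) ⟨by linarith [ht.2, hc.1], by linarith [ht.1]⟩).comp_const_sub d t)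
      (k + 1))
  have h1 : Tendsto (fun t => d - t) (nhdsWithin 0 (Ioi 0)) (nhdsWithin d (Iio d)) := by
    refine tendsto_nhdsWithin_of_tendsto_nhds_of_eventually_within _ ?_ ?_
    · have : Continuous fun t : ℝ => d - t := by fun_prop
      simpa using (this.tendsto 0).mono_left nhdsWithin_le_nhds
    · filter_upwards [self_mem_nhdsWithin] with t ht
      exact sub_lt_self d ht
  refine (hlimd.comp h1).congr fun t => ?_
  simp only [Function.comp_apply]
  ring
end

section
/- For every ε ∈ (0,A] and every positive integer k there exists D_k > 0 such that for every D ≥ D_k, every function w ∈ C¹([0,A]) ∩ C²((0,A]) satisfying the singular ODE on (0,A] with w(0) = D and w'(0) = 0 has at least k zeros in the open interval (0,ε). -/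
open Set Filter

lemma abs_rpow_add_one {p : ℝ} (hp : 1 < p) (x : ℝ) :
    |x| ^ (p + 1) = |x| ^ (p - 1) * x ^ 2 := by
  rw [show p + 1 = (p - 1) + 2 by ring, Real.rpow_add' (abs_nonneg x) (by linarith)]
  norm_num

lemma sq_le_abs_rpow_add_const {p c : ℝ} (hp : 1 < p) (hc : 0 < c) (C : ℝ) :
    ∃ K, 0 ≤ K ∧ ∀ x : ℝ, C * x ^ 2 ≤ c * |x| ^ (p + 1) + K := by
  set B : ℝ := (|C| / c) ^ (p - 1)⁻¹ with hB
  have hB0 : 0 ≤ B := by positivity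
  have hBp : B ^ (p - 1) = |C| / c := Real.rpow_inv_rpow (by positivity) (by linarith)
  refine ⟨|C| * B ^ 2, by positivity, fun x => ?_⟩
  have h1 : C * x ^ 2 ≤ |C| * x ^ 2 := by gcongr; exact le_abs_self C
  refine h1.trans ?_
  rcases le_total |x| B with h | h
  · have : x ^ 2 ≤ B ^ 2 := by rw [← sq_abs x]; gcongr
    have h2 : |C| * x ^ 2 ≤ |C| * B ^ 2 := by gcongr
    have : 0 ≤ c * |x| ^ (p + 1) := by positivity
    linarith
  · have h2 : |C| / c ≤ |x| ^ (p - 1) := by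
      rw [← hBp]; exact Real.rpow_le_rpow hB0 h (by linarith)
    rw [div_le_iff₀ hc] at h2
    rw [abs_rpow_add_one hp]
    have h3 : |C| * x ^ 2 ≤ |x| ^ (p - 1) * c * x ^ 2 := by gcongr
    have : 0 ≤ |C| * B ^ 2 := by positivity
    linarith

/-- The energy `v² / 2 + λ (|u|^(p+1) / (p+1) - u² / 2)` at position `u` and velocity `v`. -/
noncomputable def energy (lam p u v : ℝ) : ℝ :=
  v ^ 2 / 2 + lam * (|u| ^ (p + 1) / (p + 1) - u ^ 2 / 2)

/-- A solution with large energy on an interval of length at least `L` vanishes there: otherwise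
`arctan (w' / (√Q w))` would decrease by more than `π`. -/
lemma exists_zero_of_large_energy_s1 {lam p K L : ℝ} (hlam : 0 < lam) (hp : 1 < p) (hL : 0 < L) :
    ∃ M, ∀ a b : ℝ, L ≤ b - a → ∀ h w w' w'' : ℝ → ℝ,
      (∀ t ∈ Icc a b, HasDerivAt w (w' t) t) →
      (∀ t ∈ Icc a b, HasDerivAt w' (w'' t) t) →
      (∀ t ∈ Icc a b, |h t| ≤ K) →
      (∀ t ∈ Icc a b, w'' t + h t * w' t + lam * (|w t| ^ (p - 1) * w t - w t) = 0) →
      (∀ t ∈ Icc a b, M ≤ energy lam p (w t) (w' t)) →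
      ∃ t ∈ Icc a b, w t = 0 := by
  set q : ℝ := 4 * Real.pi / L with hq
  have hq0 : 0 < q := by have := Real.pi_pos; positivity
  set R : ℝ := K ^ 2 + lam + q ^ 2 / 4 with hR
  have hR0 : 0 < R := by positivity
  set B : ℝ := (R / lam) ^ (p - 1)⁻¹ with hB
  have hB0 : 0 < B := by positivity
  have hBp : B ^ (p - 1) = R / lam := Real.rpow_inv_rpow (by positivity) (by linarith)
  refine ⟨B ^ 2 * R, fun a b hab h w w' w'' hw hw' hh hode hE => ?_⟩
  by_contra! hne
  set φ : ℝ → ℝ := fun t => Real.arctan (w' t / w t / q) with hφ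
  have hφd : ∀ t ∈ Icc a b, HasDerivAt φ
      (1 / (1 + (w' t / w t / q) ^ 2) * ((w'' t * w t - w' t * w' t) / w t ^ 2 / q)) t :=
    fun t ht => (((hw' t ht).div (hw t ht) (hne t ht)).div_const q).arctan
  have hle : ∀ t ∈ Icc a b,
      1 / (1 + (w' t / w t / q) ^ 2) * ((w'' t * w t - w' t * w' t) / w t ^ 2 / q) ≤ -(q / 4) := by
    intro t ht
    have hwt := hne t ht
    set z := w' t / w t with hz
    have hw'z : w' t = z * w t := by rw [hz]; field_simp
    have hw2 : 0 < w t ^ 2 := by positivity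
    have hy0 : 0 ≤ |w t| ^ (p - 1) := by positivity
    have hnum : (w'' t * w t - w' t * w' t) / w t ^ 2 =
        -(h t * z) - lam * (|w t| ^ (p - 1) - 1) - z ^ 2 := by
      have : w'' t = -(h t * (z * w t)) - lam * (|w t| ^ (p - 1) * w t - w t) := by
        have := hode t ht; rw [hw'z] at this; linarith
      rw [this, hw'z]; field_simp
    have hEt := hE t ht
    rw [energy, abs_rpow_add_one hp, hw'z] at hEt
    have hkey : R ≤ z ^ 2 / 2 + lam * |w t| ^ (p - 1) := by
      rcases le_total |w t| B with hb | hb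
      · have hwB : w t ^ 2 ≤ B ^ 2 := by rw [← sq_abs (w t)]; gcongr
        have h1 : w t ^ 2 * R ≤ B ^ 2 * R := by gcongr
        have h2 : |w t| ^ (p - 1) * w t ^ 2 / (p + 1) ≤ |w t| ^ (p - 1) * w t ^ 2 :=
          div_le_self (by positivity) (by linarith)
        have h3 : lam * (|w t| ^ (p - 1) * w t ^ 2 / (p + 1) - w t ^ 2 / 2) ≤
            lam * (|w t| ^ (p - 1) * w t ^ 2) := by
          gcongr; linarith
        have h4 : w t ^ 2 * R ≤ w t ^ 2 * (z ^ 2 / 2 + lam * |w t| ^ (p - 1)) := by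
          nlinarith
        exact le_of_mul_le_mul_left h4 hw2
      · have h2 : R / lam ≤ |w t| ^ (p - 1) := by
          rw [← hBp]; exact Real.rpow_le_rpow hB0.le hb (by linarith)
        rw [div_le_iff₀ hlam] at h2
        nlinarith [sq_nonneg z]
    have hhz : -(h t * z) ≤ z ^ 2 / 4 + K ^ 2 := by
      have : h t ^ 2 ≤ K ^ 2 := sq_le_sq' (by linarith [neg_le_of_abs_le (hh t ht)])
        (le_of_abs_le (hh t ht))
      nlinarith [sq_nonneg (z / 2 + h t)]
    rw [hnum]
    have hfin : -(h t * z) - lam * (|w t| ^ (p - 1) - 1) - z ^ 2 ≤ -((z ^ 2 + q ^ 2) / 4) := by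
      rw [hR] at hkey; nlinarith
    have hden : 0 < q ^ 2 + z ^ 2 := by positivity
    calc 1 / (1 + (z / q) ^ 2) * ((-(h t * z) - lam * (|w t| ^ (p - 1) - 1) - z ^ 2) / q)
        ≤ 1 / (1 + (z / q) ^ 2) * (-((z ^ 2 + q ^ 2) / 4) / q) := by gcongr
      _ = -(q / 4) := by field_simp; ring
  have hab' : a < b := by linarith
  obtain ⟨c, hc, hceq⟩ := exists_hasDerivAt_eq_slope φ _ hab'
    (fun t ht => (hφd t ht).continuousAt.continuousWithinAt)
    (fun t ht => hφd t (Ioo_subset_Icc_self ht))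
  have h1 := hle c (Ioo_subset_Icc_self hc)
  rw [hceq, div_le_iff₀ (by linarith)] at h1
  have h2 : q / 4 * L ≤ q / 4 * (b - a) := by gcongr
  have h3 : q / 4 * L = Real.pi := by rw [hq]; field_simp
  have h4 := Real.arctan_lt_pi_div_two (w' a / w a / q)
  have h5 := Real.neg_pi_div_two_lt_arctan (w' b / w b / q)
  simp only [hφ] at h1
  linarith

lemma hasDerivAt_energy {lam p a b t : ℝ} {w w' : ℝ → ℝ} (hp : 1 < p)
    (hw : HasDerivAt w a t) (hw' : HasDerivAt w' b t) :
    HasDerivAt (fun t => energy lam p (w t) (w' t))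
      (w' t * b + lam * (|w t| ^ (p - 1) * w t - w t) * a) t := by
  have h1 := (hasDerivAt_abs_rpow (w t) (p := p + 1) (by linarith)).comp t hw
  have h2 := ((hw'.pow 2).div_const 2).add
    (((h1.div_const (p + 1)).sub ((hw.pow 2).div_const 2)).const_mul lam)
  refine h2.congr_deriv ?_
  rw [show p + 1 - 2 = p - 1 by ring]
  field_simp
  ring

lemma SolOn.hasDerivAt {h : ℝ → ℝ} {lam q A t : ℝ} {w w' w'' : ℝ → ℝ}
    (hs : SolOn h lam q (Icc 0 A) (Ioc 0 A) w w' w'') (ht : t ∈ Ioo 0 A) :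
    HasDerivAt w (w' t) t :=
  (hs.1 t (Ioo_subset_Icc_self ht)).hasDerivAt (Icc_mem_nhds ht.1 ht.2)

lemma SolOn.hasDerivAt' {h : ℝ → ℝ} {lam q A t : ℝ} {w w' w'' : ℝ → ℝ}
    (hs : SolOn h lam q (Icc 0 A) (Ioc 0 A) w w' w'') (ht : t ∈ Ioo 0 A) :
    HasDerivAt w' (w'' t) t :=
  (hs.2.2.1 t (Ioo_subset_Ioc_self ht)).hasDerivAt (Ioc_mem_nhds ht.1 ht.2)

lemma SolOn.continuousOn {h : ℝ → ℝ} {lam q A : ℝ} {w w' w'' : ℝ → ℝ}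
    (hs : SolOn h lam q (Icc 0 A) (Ioc 0 A) w w' w'') : ContinuousOn w (Icc 0 A) :=
  fun t ht => (hs.1 t ht).continuousWithinAt

lemma SolOn.continuousOn_energy {h : ℝ → ℝ} {lam p A : ℝ} {w w' w'' : ℝ → ℝ} (hp : 1 < p)
    (hs : SolOn h lam p (Icc 0 A) (Ioc 0 A) w w' w'') :
    ContinuousOn (fun t => energy lam p (w t) (w' t)) (Icc 0 A) := by
  have h1 : ContinuousOn (fun t => |w t| ^ (p + 1)) (Icc 0 A) :=
    hs.continuousOn.abs.rpow_const fun _ _ => Or.inr (by linarith)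
  exact ((hs.2.1.pow 2).div_const 2).add
    (((h1.div_const _).sub ((hs.continuousOn.pow 2).div_const 2)).const_mul _)

lemma SolOn.energy_le {h : ℝ → ℝ} {lam p A : ℝ} {w w' w'' : ℝ → ℝ} (hp : 1 < p)
    (hs : SolOn h lam p (Icc 0 A) (Ioc 0 A) w w' w'') (hh : ∀ t ∈ Ioo 0 A, 0 ≤ h t)
    {r : ℝ} (hr : r ∈ Icc 0 A) :
    energy lam p (w r) (w' r) ≤ energy lam p (w 0) (w' 0) := by
  have hanti : AntitoneOn (fun t => energy lam p (w t) (w' t)) (Icc 0 A) := by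
    refine antitoneOn_of_hasDerivWithinAt_nonpos (convex_Icc 0 A) (hs.continuousOn_energy hp)
      (f' := fun t => w' t * w'' t + lam * (|w t| ^ (p - 1) * w t - w t) * w' t) ?_ ?_
    · rw [interior_Icc]
      intro t ht
      exact (hasDerivAt_energy hp (hs.hasDerivAt ht) (hs.hasDerivAt' ht)).hasDerivWithinAt
    · rw [interior_Icc]
      intro t ht
      have h1 := hs.2.2.2.2 t (Ioo_subset_Ioc_self ht)
      have h2 : w' t * w'' t + lam * (|w t| ^ (p - 1) * w t - w t) * w' t =
          -(h t * w' t ^ 2) := by linear_combination w' t * h1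
      simp only [h2]
      have := hh t ht
      have : 0 ≤ h t * w' t ^ 2 := by positivity
      linarith
  exact hanti ⟨le_rfl, hr.1.trans hr.2⟩ hr hr.1

/-- A solution starting at height `D` stays above `D / 2` up to a time of order
`D ^ (-(p - 1) / 2)`. -/
lemma exists_half_le {lam p : ℝ} (hlam : 0 < lam) (hp : 1 < p) :
    ∃ V, 0 < V ∧ ∀ (A D : ℝ) (h w w' w'' : ℝ → ℝ), 1 ≤ D →
      SolOn h lam p (Icc 0 A) (Ioc 0 A) w w' w'' → (∀ t ∈ Ioo 0 A, 0 ≤ h t) →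
      w 0 = D → w' 0 = 0 →
      ∀ r ∈ Icc 0 A, r ≤ V * D ^ (-((p - 1) / 2)) → D / 2 ≤ w r := by
  obtain ⟨K, hK0, hK⟩ := sq_le_abs_rpow_add_const hp
    (c := lam / (p + 1)) (by have : 0 < p + 1 := by linarith
                             positivity) (lam / 2)
  have hp1 : 0 < p + 1 := by linarith
  set V : ℝ := 1 + 2 * lam / (p + 1) + 2 * K with hV
  have hV1 : 1 ≤ V := by
    have : 0 ≤ 2 * lam / (p + 1) := by positivity
    linarith
  refine ⟨1 / (2 * V), by positivity, fun A D h w w' w'' hD hs hh h0 h0' r hr hrV => ?_⟩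
  have hD0 : 0 < D := by linarith
  have hDp : 1 ≤ D ^ (p + 1) := Real.one_le_rpow hD (by linarith)
  have hspeed : ∀ t ∈ Icc 0 A, |w' t| ≤ V * D ^ ((p + 1) / 2) := by
    intro t ht
    have hE := hs.energy_le hp hh ht
    rw [h0, h0', energy, energy, abs_of_pos hD0] at hE
    have hKt := hK (w t)
    refine abs_le_of_sq_le_sq ?_ (by positivity)
    have hsq : (D ^ ((p + 1) / 2)) ^ 2 = D ^ (p + 1) := by
      rw [← Real.rpow_natCast, ← Real.rpow_mul hD0.le]; congr 1; push_cast; ring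
    rw [mul_pow, hsq]
    have h1 : w' t ^ 2 ≤ 2 * lam / (p + 1) * D ^ (p + 1) + 2 * K := by
      have e1 : lam * (D ^ (p + 1) / (p + 1)) = lam / (p + 1) * D ^ (p + 1) := by ring
      have e2 : lam * (|w t| ^ (p + 1) / (p + 1)) = lam / (p + 1) * |w t| ^ (p + 1) := by ring
      have e3 : 2 * lam / (p + 1) * D ^ (p + 1) = 2 * (lam / (p + 1) * D ^ (p + 1)) := by ring
      have : 0 ≤ lam * (D ^ 2 / 2) := by positivity
      rw [mul_sub, mul_sub, e1, e2] at hE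
      rw [e3]
      linarith
    have h2 : 2 * K ≤ 2 * K * D ^ (p + 1) := le_mul_of_one_le_right (by positivity) hDp
    have h3 : V * D ^ (p + 1) ≤ V ^ 2 * D ^ (p + 1) := by
      gcongr; nlinarith
    have h4 : V * D ^ (p + 1) =
        D ^ (p + 1) + 2 * lam / (p + 1) * D ^ (p + 1) + 2 * K * D ^ (p + 1) := by rw [hV]; ring
    linarith
  set c : ℝ := V * D ^ ((p + 1) / 2) with hc
  have hmono : MonotoneOn (fun t => w t + c * t) (Icc 0 A) := by
    refine monotoneOn_of_hasDerivWithinAt_nonneg (convex_Icc 0 A)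
      (hs.continuousOn.add (continuousOn_const.mul continuousOn_id))
      (f' := fun t => w' t + c * 1) ?_ ?_
    · rw [interior_Icc]
      intro t ht
      exact ((hs.hasDerivAt ht).add ((hasDerivAt_id t).const_mul c)).hasDerivWithinAt
    · rw [interior_Icc]
      intro t ht
      have := neg_le_of_abs_le (hspeed t (Ioo_subset_Icc_self ht))
      linarith
  have h1 := hmono ⟨le_rfl, hr.1.trans hr.2⟩ hr hr.1
  simp only [h0, mul_zero, add_zero] at h1
  have h2 : c * r ≤ c * (1 / (2 * V) * D ^ (-((p - 1) / 2))) := by gcongr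
  have h3 : c * (1 / (2 * V) * D ^ (-((p - 1) / 2))) = D / 2 := by
    have : D ^ ((p + 1) / 2) * D ^ (-((p - 1) / 2)) = D := by
      rw [← Real.rpow_add hD0]; ring_nf; simp
    calc c * (1 / (2 * V) * D ^ (-((p - 1) / 2)))
        = (V * (1 / (2 * V))) * (D ^ ((p + 1) / 2) * D ^ (-((p - 1) / 2))) := by rw [hc]; ring
      _ = D / 2 := by rw [this]; field_simp
  linarith

/-- The Pohozaev functional. -/
noncomputable def pohozaev (lam p N a r u v : ℝ) : ℝ :=
  r ^ N * energy lam p u v + a * r ^ (N - 1) * (u * v)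

lemma hasDerivAt_pohozaev {lam p N a t b d η : ℝ} {w w' : ℝ → ℝ} (hp : 1 < p) (ht : 0 < t)
    (hw : HasDerivAt w b t) (hw' : HasDerivAt w' d t) (hb : b = w' t)
    (hode : d + η / t * w' t + lam * (|w t| ^ (p - 1) * w t - w t) = 0) :
    HasDerivAt (fun t => pohozaev lam p N a t (w t) (w' t))
      (t ^ (N - 1) * ((N / 2 - η + a) * w' t ^ 2 + a * (N - 1 - η) / t * (w t * w' t)
        + lam * ((N / (p + 1) - a) * |w t| ^ (p + 1) - (N / 2 - a) * w t ^ 2))) t := by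
  subst hb
  have hN : HasDerivAt (fun t : ℝ => t ^ N) (N * t ^ (N - 1)) t :=
    Real.hasDerivAt_rpow_const (Or.inl ht.ne')
  have hN1 : HasDerivAt (fun t : ℝ => t ^ (N - 1)) ((N - 1) * t ^ (N - 1 - 1)) t :=
    Real.hasDerivAt_rpow_const (Or.inl ht.ne')
  have h1 := (hN.mul (hasDerivAt_energy (lam := lam) hp hw hw')).add
    ((hN1.const_mul a).mul (hw.mul hw'))
  refine h1.congr_deriv ?_
  have hd : d = -(η / t * w' t) - lam * (|w t| ^ (p - 1) * w t - w t) := by linarith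
  have e1 : t ^ N = t ^ (N - 1) * t := by
    rw [Real.rpow_sub_one ht.ne']; field_simp
  rw [Real.rpow_sub_one ht.ne' (N - 1), e1, energy, abs_rpow_add_one hp, hd]
  have : p + 1 ≠ 0 := by linarith
  simp only [Pi.mul_apply]
  field_simp
  ring

lemma exists_le_pohozaev_density {lam p N a Λ : ℝ} (hlam : 0 < lam) (hp : 1 < p)
    (ha : N / 2 - 1 < a) (haN : a < N / (p + 1)) :
    ∃ c, 0 < c ∧ ∃ C, 0 ≤ C ∧ ∀ t η u v : ℝ, 0 < t → |η - (N - 1)| ≤ Λ * t →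
      Λ * t ≤ (1 - N / 2 + a) / 2 →
      c * |u| ^ (p + 1) - C ≤ (N / 2 - η + a) * v ^ 2 + a * (N - 1 - η) / t * (u * v)
        + lam * ((N / (p + 1) - a) * |u| ^ (p + 1) - (N / 2 - a) * u ^ 2) := by
  set σ : ℝ := 1 - N / 2 + a with hσ
  have hσ0 : 0 < σ := by linarith
  set τ : ℝ := lam * (N / (p + 1) - a) with hτ
  have hτ0 : 0 < τ := mul_pos hlam (by linarith)
  obtain ⟨K, hK0, hK⟩ := sq_le_abs_rpow_add_const hp (half_pos hτ0)
    ((|a| * Λ) ^ 2 / (2 * σ) + lam * (N / 2 - a))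
  refine ⟨τ / 2, half_pos hτ0, K, hK0, fun t η u v ht hη htσ => ?_⟩
  have hη' := le_of_abs_le hη
  have h1 : σ / 2 * v ^ 2 ≤ (N / 2 - η + a) * v ^ 2 := by
    gcongr; linarith
  set x : ℝ := a * (N - 1 - η) / t with hx
  have hxabs : |x| ≤ |a| * Λ := by
    rw [hx, abs_div, abs_mul, abs_of_pos ht, div_le_iff₀ ht, abs_sub_comm, mul_assoc]
    gcongr
  have hx2 : x ^ 2 ≤ (|a| * Λ) ^ 2 := by rw [← sq_abs x]; gcongr
  have h2 : 0 ≤ σ / 2 * v ^ 2 + x * (u * v) + x ^ 2 / (2 * σ) * u ^ 2 := by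
    have : σ / 2 * v ^ 2 + x * (u * v) + x ^ 2 / (2 * σ) * u ^ 2
        = (σ * v + x * u) ^ 2 / (2 * σ) := by field_simp; ring
    rw [this]; positivity
  have h3 : x ^ 2 / (2 * σ) * u ^ 2 ≤ (|a| * Λ) ^ 2 / (2 * σ) * u ^ 2 := by gcongr
  have h4 := hK u
  have h5 : lam * ((N / (p + 1) - a) * |u| ^ (p + 1) - (N / 2 - a) * u ^ 2)
      = τ * |u| ^ (p + 1) - lam * (N / 2 - a) * u ^ 2 := by rw [hτ]; ring
  rw [h5]
  linarith

lemma exists_pohozaev_le_energy {lam p a : ℝ} (hlam : 0 < lam) (hp : 1 < p) :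
    ∃ C, ∀ N r u v : ℝ, 1 ≤ N → 0 ≤ r → r ≤ 1 →
      pohozaev lam p N a r u v ≤ (1 + |a|) * (energy lam p u v + C) := by
  have hp1 : 0 < p + 1 := by linarith
  obtain ⟨C, -, hC⟩ := sq_le_abs_rpow_add_const hp (c := lam / (p + 1)) (by positivity)
    (lam / 2 + 1 / 2)
  refine ⟨C, fun N r u v hN hr0 hr1 => ?_⟩
  have h1 : (u ^ 2 + v ^ 2) / 2 ≤ energy lam p u v + C := by
    have e : lam * (|u| ^ (p + 1) / (p + 1) - u ^ 2 / 2) =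
      lam / (p + 1) * |u| ^ (p + 1) - lam / 2 * u ^ 2 := by ring
    rw [energy, e]
    linarith [hC u]
  have hC0 : 0 ≤ C := by
    have := hC 0
    rwa [abs_zero, Real.zero_rpow hp1.ne', mul_zero, zero_add, zero_pow two_ne_zero,
      mul_zero] at this
  have h0 : 0 ≤ energy lam p u v + C := le_trans (by positivity) h1
  have h2 : r ^ N ≤ 1 := Real.rpow_le_one hr0 hr1 (by linarith)
  have h3 : r ^ (N - 1) ≤ 1 := Real.rpow_le_one hr0 hr1 (by linarith)
  have h4 : r ^ N * energy lam p u v ≤ energy lam p u v + C :=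
    calc r ^ N * energy lam p u v ≤ r ^ N * (energy lam p u v + C) := by gcongr; linarith
      _ ≤ 1 * (energy lam p u v + C) := by gcongr
      _ = _ := one_mul _
  have h5 : |u * v| ≤ energy lam p u v + C := by
    refine le_trans ?_ h1
    rw [abs_le]
    constructor <;> nlinarith [sq_nonneg (u + v), sq_nonneg (u - v)]
  have h6 : a * r ^ (N - 1) * (u * v) ≤ |a| * (energy lam p u v + C) :=
    calc a * r ^ (N - 1) * (u * v) ≤ |a * r ^ (N - 1) * (u * v)| := le_abs_self _
      _ = |a| * r ^ (N - 1) * |u * v| := by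
        rw [abs_mul, abs_mul, abs_of_nonneg (Real.rpow_nonneg hr0 _)]
      _ ≤ |a| * 1 * (energy lam p u v + C) := by gcongr
      _ = _ := by rw [mul_one]
  rw [pohozaev]
  linarith

/-- The contribution of `[0, r₀]`, where `w ≥ D / 2`, to the Pohozaev functional at later times. -/
lemma SolOn.le_pohozaev {H : ℝ → ℝ} {lam p N a A δ c C D r₀ : ℝ} {w w' w'' : ℝ → ℝ}
    (hp : 1 < p) (hN : 1 < N) (hc : 0 < c) (hD : 0 ≤ D) (hδA : δ ≤ A)
    (hs : SolOn (fun r => H r / r) lam p (Icc 0 A) (Ioc 0 A) w w' w'')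
    (hdens : ∀ t ∈ Ioo 0 δ, ∀ u v : ℝ, c * |u| ^ (p + 1) - C ≤
      (N / 2 - H t + a) * v ^ 2 + a * (N - 1 - H t) / t * (u * v)
        + lam * ((N / (p + 1) - a) * |u| ^ (p + 1) - (N / 2 - a) * u ^ 2))
    (hr₀ : 0 ≤ r₀) (hr₀δ : r₀ ≤ δ) (hhalf : ∀ r ∈ Icc 0 r₀, D / 2 ≤ w r) {r : ℝ}
    (hr : r ∈ Icc r₀ δ) :
    c * (D / 2) ^ (p + 1) / N * r₀ ^ N - C / N * r ^ N ≤ pohozaev lam p N a r (w r) (w' r) := by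
  have hN0 : 0 < N := by linarith
  have hsub : Icc 0 δ ⊆ Icc 0 A := Icc_subset_Icc_right hδA
  have hP : ContinuousOn (fun t => pohozaev lam p N a t (w t) (w' t)) (Icc 0 δ) := by
    have h1 : ContinuousOn (fun t : ℝ => t ^ N) (Icc 0 δ) :=
      continuousOn_id.rpow_const fun _ _ => Or.inr hN0.le
    have h2 : ContinuousOn (fun t : ℝ => t ^ (N - 1)) (Icc 0 δ) :=
      continuousOn_id.rpow_const fun _ _ => Or.inr (by linarith)
    exact (h1.mul ((hs.continuousOn_energy hp).mono hsub)).add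
      ((continuousOn_const.mul h2).mul ((hs.continuousOn.mono hsub).mul (hs.2.1.mono hsub)))
  have hrpow : ContinuousOn (fun t : ℝ => t ^ N) (Icc 0 δ) :=
    continuousOn_id.rpow_const fun _ _ => Or.inr hN0.le
  have hmono : ∀ κ x y : ℝ, 0 ≤ x → y ≤ δ → (∀ t ∈ Ioo x y, κ ≤ c * |w t| ^ (p + 1)) →
      MonotoneOn (fun t => pohozaev lam p N a t (w t) (w' t) + (C - κ) / N * t ^ N)
        (Icc x y) := by
    intro κ x y hx hy hκ
    have hxy : Icc x y ⊆ Icc 0 δ := Icc_subset_Icc hx hy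
    refine monotoneOn_of_hasDerivWithinAt_nonneg (convex_Icc x y)
      ((hP.add (continuousOn_const.mul hrpow)).mono hxy)
      (f' := fun t => t ^ (N - 1) * ((N / 2 - H t + a) * w' t ^ 2
        + a * (N - 1 - H t) / t * (w t * w' t)
        + lam * ((N / (p + 1) - a) * |w t| ^ (p + 1) - (N / 2 - a) * w t ^ 2))
        + (C - κ) / N * (N * t ^ (N - 1))) ?_ ?_
    · rw [interior_Icc]
      intro t ht
      have ht0 : 0 < t := hx.trans_lt ht.1
      have htA : t ∈ Ioo 0 A := ⟨ht0, ht.2.trans_le (hy.trans hδA)⟩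
      exact ((hasDerivAt_pohozaev hp ht0 (hs.hasDerivAt htA) (hs.hasDerivAt' htA) rfl
        (hs.2.2.2.2 t (Ioo_subset_Ioc_self htA))).add
        ((Real.hasDerivAt_rpow_const (Or.inl ht0.ne')).const_mul _)).hasDerivWithinAt
    · rw [interior_Icc]
      intro t ht
      have ht0 : 0 < t := hx.trans_lt ht.1
      have h1 := hdens t ⟨ht0, ht.2.trans_le hy⟩ (w t) (w' t)
      have h2 := hκ t ht
      have h3 : (C - κ) / N * (N * t ^ (N - 1)) = t ^ (N - 1) * (C - κ) := by
        field_simp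
      rw [h3, ← mul_add]
      exact mul_nonneg (Real.rpow_nonneg ht0.le _) (by linarith)
  have h1 := hmono (c * (D / 2) ^ (p + 1)) 0 r₀ le_rfl hr₀δ
    (fun t ht => by
      have h := hhalf t (Ioo_subset_Icc_self ht)
      gcongr
      exact h.trans (le_abs_self _))
    ⟨le_rfl, hr₀⟩ ⟨hr₀, le_rfl⟩ hr₀
  have h2 := hmono 0 r₀ δ hr₀ le_rfl (fun t _ => by positivity)
    ⟨le_rfl, hr₀δ⟩ hr hr.1
  simp only [pohozaev, Real.zero_rpow hN0.ne', Real.zero_rpow (sub_pos.2 hN).ne', sub_zero]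
    at h1 h2 ⊢
  have e : (C - c * (D / 2) ^ (p + 1)) / N * r₀ ^ N
      = C / N * r₀ ^ N - c * (D / 2) ^ (p + 1) / N * r₀ ^ N := by ring
  rw [e] at h1
  linarith

lemma exists_large_energy_s1 {A lam p Λ : ℝ} (hlam : 0 < lam) (hp : 1 < p) (hΛ : 0 ≤ Λ)
    {H : ℝ → ℝ} (hH : ∀ r ∈ Icc 0 A, 0 < H r) (hA : 0 < A)
    (hLip : ∀ r ∈ Icc 0 A, |H r - H 0| ≤ Λ * r)
    (hsub : (H 0 + 1) / 2 < (p + 1) / (p - 1)) :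
    ∃ δ, 0 < δ ∧ ∀ ε, 0 < ε → ε ≤ A → ε ≤ δ → ∀ M, ∃ D₀, 0 < D₀ ∧ ∀ D, D₀ ≤ D →
      ∀ w w' w'' : ℝ → ℝ,
        SolOn (fun r => H r / r) lam p (Icc 0 A) (Ioc 0 A) w w' w'' →
        w 0 = D → w' 0 = 0 → ∀ r ∈ Icc (ε / 2) ε, M ≤ energy lam p (w r) (w' r) := by
  set N : ℝ := H 0 + 1 with hNdef
  have hN : 1 < N := by have := hH 0 ⟨le_rfl, hA.le⟩; linarith
  have hp1 : 0 < p + 1 := by linarith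
  have hpm : 0 < p - 1 := by linarith
  have hexp : N * (p - 1) < 2 * (p + 1) := by
    rw [div_lt_div_iff₀ two_pos hpm] at hsub; linarith
  obtain ⟨a, ha, haN⟩ : ∃ a, N / 2 - 1 < a ∧ a < N / (p + 1) := by
    apply exists_between
    rw [lt_div_iff₀ hp1]; linarith
  obtain ⟨c, hc, C, hC, hdens⟩ := exists_le_pohozaev_density (Λ := Λ) hlam hp ha haN
  obtain ⟨C', hC'⟩ := exists_pohozaev_le_energy (a := a) hlam hp
  obtain ⟨V, hV, hhalf⟩ := exists_half_le hlam hp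
  set σ : ℝ := (1 - N / 2 + a) / 2 with hσ
  have hσ0 : 0 < σ := by rw [hσ]; linarith
  refine ⟨min 1 (σ / (Λ + 1)), by positivity, fun ε hε hεA hεδ M => ?_⟩
  have hε1 : ε ≤ 1 := hεδ.trans (min_le_left _ _)
  have hεσ : Λ * ε ≤ σ := by
    have := hεδ.trans (min_le_right _ _)
    rw [le_div_iff₀ (by positivity)] at this
    linarith
  set γ : ℝ := p + 1 - N * ((p - 1) / 2) with hγ
  have hγ0 : 0 < γ := by linarith
  set b : ℝ := c * (1 / 2) ^ (p + 1) / N * V ^ N with hb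
  have hb0 : 0 < b := by positivity
  have hlim1 : Tendsto (fun D : ℝ => V * D ^ (-((p - 1) / 2))) atTop (nhds 0) := by
    simpa using (tendsto_rpow_neg_atTop (half_pos hpm)).const_mul V
  have hlim2 : Tendsto (fun D : ℝ => b * D ^ γ) atTop atTop :=
    (tendsto_rpow_atTop hγ0).const_mul_atTop hb0
  obtain ⟨D₀, hD₀⟩ := eventually_atTop.1 ((hlim1.eventually_le_const (half_pos hε)).and
    (hlim2.eventually_ge_atTop ((1 + |a|) * (M + C') + C / N)))
  refine ⟨max 1 D₀, by positivity, fun D hD w w' w'' hs h0 h0' r hr => ?_⟩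
  have hD1 : 1 ≤ D := (le_max_left _ _).trans hD
  have hD0 : 0 < D := by linarith
  obtain ⟨hsmall, hbig⟩ := hD₀ D ((le_max_right _ _).trans hD)
  set r₀ : ℝ := V * D ^ (-((p - 1) / 2)) with hr₀
  have hr₀0 : 0 ≤ r₀ := by positivity
  have hP := hs.le_pohozaev (N := N) (a := a) (δ := ε) (r₀ := r₀) (D := D) (C := C)
    hp hN hc hD0.le hεA
    (fun t ht u v => hdens t (H t) u v ht.1
      (by
        rw [hNdef, add_sub_cancel_right]
        exact hLip t ⟨ht.1.le, ht.2.le.trans hεA⟩)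
      (le_trans (by have := ht.2.le; gcongr) hεσ))
    hr₀0 (by linarith)
    (fun t ht => hhalf A D _ w w' w'' hD1 hs
      (fun s hs' => div_nonneg (hH s (Ioo_subset_Icc_self hs')).le hs'.1.le) h0 h0' t
      ⟨ht.1, ht.2.trans (by linarith)⟩ ht.2)
    (r := r) ⟨hsmall.trans hr.1, hr.2⟩
  have hr0 : 0 ≤ r := le_trans (by positivity) hr.1
  have hE := hC' N r (w r) (w' r) hN.le hr0 (hr.2.trans hε1)
  have hbD : c * (D / 2) ^ (p + 1) / N * r₀ ^ N = b * D ^ γ := by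
    rw [hr₀, Real.mul_rpow hV.le (by positivity), ← Real.rpow_mul hD0.le,
      div_eq_mul_one_div D 2, Real.mul_rpow hD0.le (by norm_num), hb, hγ,
      show p + 1 - N * ((p - 1) / 2) = (p + 1) + -((p - 1) / 2) * N by ring,
      Real.rpow_add hD0 (p + 1)]
    ring
  have hrN : C / N * r ^ N ≤ C / N :=
    mul_le_of_le_one_right (by positivity)
      (Real.rpow_le_one hr0 (hr.2.trans hε1) (by linarith))
  rw [hbD] at hP
  have hfin : (1 + |a|) * (M + C') ≤ (1 + |a|) * (energy lam p (w r) (w' r) + C') := by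
    linarith
  have := le_of_mul_le_mul_left hfin (by positivity)
  linarith

theorem stmt_1
    (A lam p : ℝ) (hA : 0 < A) (hlam : 0 < lam) (hp : 1 < p)
    (H : ℝ → ℝ) (hHC1 : ContDiffOn ℝ 1 H (Set.Icc 0 A))
    (hHpos : ∀ r ∈ Set.Icc 0 A, 0 < H r)
    (hsub : (H 0 + 1) / 2 < (p + 1) / (p - 1))
    (ε : ℝ) (hε0 : 0 < ε) (hεA : ε ≤ A) (k : ℕ) (hk : 0 < k) :
    ∃ Dk : ℝ, 0 < Dk ∧ ∀ D : ℝ, Dk ≤ D →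
      ∀ w w' w'' : ℝ → ℝ,
        SolOn (fun r => H r / r) lam p (Set.Icc 0 A) (Set.Ioc 0 A) w w' w'' →
        w 0 = D → w' 0 = 0 →
        ∃ s : Finset ℝ, (∀ t ∈ s, t ∈ Set.Ioo 0 ε ∧ w t = 0) ∧ k ≤ s.card := by
  obtain ⟨Λ, hΛ⟩ := hHC1.exists_lipschitzOnWith one_ne_zero (convex_Icc 0 A) isCompact_Icc
  have h0A : (0 : ℝ) ∈ Icc 0 A := ⟨le_rfl, hA.le⟩
  have hLip : ∀ r ∈ Icc 0 A, |H r - H 0| ≤ Λ * r := by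
    intro r hr
    have := hΛ.dist_le_mul r hr 0 h0A
    rwa [Real.dist_eq, Real.dist_eq, sub_zero, abs_of_nonneg hr.1] at this
  obtain ⟨δ, hδ, hmain⟩ := exists_large_energy_s1 hlam hp Λ.coe_nonneg hHpos hA hLip hsub
  set η : ℝ := min ε δ with hη
  have hη0 : 0 < η := lt_min hε0 hδ
  have hηε : η ≤ ε := min_le_left _ _
  have hηA : η ≤ A := hηε.trans hεA
  have hk0 : (0 : ℝ) < k := by exact_mod_cast hk
  set L : ℝ := η / (4 * k) with hL
  have hL0 : 0 < L := by positivity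
  have hkL : 2 * k * L = η / 2 := by rw [hL]; field_simp; ring
  obtain ⟨M, hM⟩ := exists_zero_of_large_energy_s1 (K := (H 0 + Λ * A) / (η / 2)) hlam hp hL0
  obtain ⟨D₀, hD₀, hE⟩ := hmain η hη0 hηA (min_le_right _ _) M
  refine ⟨D₀, hD₀, fun D hD w w' w'' hs h0 h0' => ?_⟩
  have hEw := hE D hD w w' w'' hs h0 h0'
  have hsubset : ∀ i : Fin k, ∀ t ∈ Icc (η / 2 + 2 * i * L) (η / 2 + 2 * i * L + L),
      η / 2 ≤ t ∧ t < η := by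
    intro i t ht
    have hi : (i : ℝ) + 1 ≤ k := by exact_mod_cast i.2
    have h1 : 0 ≤ 2 * (i : ℝ) * L := by positivity
    have h2 : 2 * ((i : ℝ) + 1) * L ≤ 2 * k * L := by gcongr
    exact ⟨by linarith [ht.1], by linarith [ht.2]⟩
  have hIoo : ∀ i : Fin k, ∀ t ∈ Icc (η / 2 + 2 * i * L) (η / 2 + 2 * i * L + L),
      t ∈ Ioo 0 A := fun i t ht =>
    ⟨(half_pos hη0).trans_le (hsubset i t ht).1, (hsubset i t ht).2.trans_le hηA⟩
  have hzero : ∀ i : Fin k, ∃ t ∈ Icc (η / 2 + 2 * i * L) (η / 2 + 2 * i * L + L),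
      w t = 0 := by
    intro i
    refine hM _ _ (by linarith) (fun r => H r / r) w w' w''
      (fun t ht => hs.hasDerivAt (hIoo i t ht)) (fun t ht => hs.hasDerivAt' (hIoo i t ht)) ?_
      (fun t ht => hs.2.2.2.2 t (Ioo_subset_Ioc_self (hIoo i t ht)))
      (fun t ht => hEw t ⟨(hsubset i t ht).1, (hsubset i t ht).2.le⟩)
    intro t ht
    have htA := Ioo_subset_Icc_self (hIoo i t ht)
    have h1 := le_of_abs_le (hLip t htA)
    have h2 : Λ * t ≤ Λ * A := by have := htA.2; gcongr
    have h3 := hHpos t htA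
    rw [abs_of_nonneg (div_nonneg h3.le htA.1)]
    have h4 := (hsubset i t ht).1
    exact div_le_div₀ (by linarith) (by linarith) (by positivity) h4
  choose z hz hwz using hzero
  have hmono : StrictMono z := by
    intro i j hij
    have hij' : (i : ℝ) + 1 ≤ j := by exact_mod_cast hij
    have h1 : 2 * ((i : ℝ) + 1) * L ≤ 2 * j * L := by gcongr
    linarith [(hz i).2, (hz j).1]
  refine ⟨Finset.univ.image z, ?_, ?_⟩
  · intro t ht
    obtain ⟨i, -, rfl⟩ := Finset.mem_image.1 ht
    exact ⟨⟨(hIoo i _ (hz i)).1, (hsubset i _ (hz i)).2.trans_le hηε⟩, hwz i⟩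
  · rw [Finset.card_image_of_injective _ hmono.injective, Finset.card_univ, Fintype.card_fin]
end
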